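/- Let (R, m) be a Noetherian local ring of dimension d. Then H_m^d(R) has finite injective dimension if and only if R is quasi-Gorenstein, i.e. H_m^d(R) ≅ E(R/m). -/

import Mathlib

open CategoryTheory IsLocalRing Pointwise

noncomputable section

/-- `E` is an injective hull of `S ⧸ J` over `S`. -/
def IsInjHull (S : Type) [CommRing S] (J : Ideal S) (E : Type) [AddCommGroup E]
    [Module S E] : Prop :=
  Module.Injective S E ∧
    ∃ f : (S ⧸ J) →ₗ[S] E, Function.Injective f ∧
      ∀ N : Submodule S E, N ≠ ⊥ → N ⊓ LinearMap.range f ≠ ⊥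

/-- Local cohomology `H^i_J(M)`. -/
abbrev LC (S : Type) [CommRing S] (J : Ideal S) (i : ℕ) (M : ModuleCat S) : ModuleCat S :=
  (localCohomology J i).obj M

/-- Krull dimension of a module (dimension of its support). -/
def mdim (S : Type) [CommRing S] (M : Type) [AddCommGroup M] [Module S M] : WithBot ℕ∞ :=
  Order.krullDim (Module.support S M)

/-- Depth/grade of an ideal `J` on `M`: supremum of lengths of `M`-regular sequences in `J`. -/
def gradeI (S : Type) [CommRing S] (J : Ideal S) (M : Type) [AddCommGroup M]
    [Module S M] : ℕ∞ :=
  sSup {n : ℕ∞ | ∃ rs : List S, (rs.length : ℕ∞) = n ∧ (∀ r ∈ rs, r ∈ J) ∧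
    RingTheory.Sequence.IsRegular M rs}

/-- The local "height" of `M` at a prime `p`, i.e. `dim_{S_p} M_p`. -/
def htM (S : Type) [CommRing S] (M : Type) [AddCommGroup M] [Module S M]
    (p : PrimeSpectrum S) : WithBot ℕ∞ :=
  mdim (Localization.AtPrime p.asIdeal) (LocalizedModule p.asIdeal.primeCompl M)

/-- `ht_M(a) = inf { dim_{S_p} M_p : p ⊇ a, p ∈ Supp M }`. -/
def htI (S : Type) [CommRing S] (M : Type) [AddCommGroup M] [Module S M]
    (a : Ideal S) : WithBot ℕ∞ :=
  sInf {d | ∃ p ∈ Module.support S M, a ≤ p.asIdeal ∧ d = htM S M p}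

/-- Serre's condition `S_n` for the module `M`. -/
def Serre (S : Type) [CommRing S] (n : ℕ) (M : Type) [AddCommGroup M] [Module S M] : Prop :=
  ∀ (p : Ideal S) [p.IsPrime],
    min (n : WithBot ℕ∞)
        (mdim (Localization.AtPrime p) (LocalizedModule p.primeCompl M)) ≤
      (gradeI (Localization.AtPrime p) (IsLocalRing.maximalIdeal (Localization.AtPrime p))
        (LocalizedModule p.primeCompl M) : ℕ∞)

/-- Attached primes of `M` (Macdonald): primes of the form `Ann(M ⧸ N)`. -/
def attachedPrimes (S : Type) [CommRing S] (M : Type) [AddCommGroup M] [Module S M] :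
    Set (Ideal S) :=
  {p | p.IsPrime ∧ ∃ N : Submodule S M, p = Module.annihilator S (M ⧸ N)}

/-- `ω` is a canonical module of the `d`-dimensional module `M` over `(S, J)`:
its "Matlis dual" `Hom_S(ω, E)` is isomorphic to `H^d_J(M)`. -/
def IsCanonicalModule (S : Type) [CommRing S] (J : Ideal S) (d : ℕ)
    (M ω : ModuleCat S) : Prop :=
  Module.Finite S ω ∧ ∃ E : ModuleCat S, IsInjHull S J ↥E ∧
    Nonempty ((↥ω →ₗ[S] ↥E) ≃ₗ[S] ↥(LC S J d M))

/-- `(S, J)` is quasi-Gorenstein: `H^d_J(S)` is an injective hull of `S ⧸ J`, `d = dim S`. -/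
def IsQuasiGorensteinAt (S : Type) [CommRing S] (J : Ideal S) : Prop :=
  ∃ d : ℕ, ringKrullDim S = (d : WithBot ℕ∞) ∧
    ∃ E : ModuleCat S, IsInjHull S J ↥E ∧
      Nonempty (↥(LC S J d (ModuleCat.of S S)) ≃ₗ[S] ↥E)

/-- Totally reflexive modules. -/
def TotallyReflexive (S : Type) [CommRing S] (M : ModuleCat S) : Prop :=
  Module.Finite S ↥M ∧ Module.IsReflexive S ↥M ∧
    ∀ i : ℕ, 0 < i →
      Subsingleton ↥(((Ext S (ModuleCat S) i).obj (Opposite.op M)).obj (ModuleCat.of S S)) ∧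
      Subsingleton ↥(((Ext S (ModuleCat S) i).obj
        (Opposite.op (ModuleCat.of S (Module.Dual S ↥M)))).obj (ModuleCat.of S S))

/-- `G`-dimension at most `n`. -/
def GdimLE (S : Type) [CommRing S] : ℕ → ModuleCat S → Prop
  | 0, M => TotallyReflexive S M
  | n + 1, M => ∃ (G : ModuleCat S) (f : ↥G →ₗ[S] ↥M), Function.Surjective f ∧
      TotallyReflexive S G ∧ GdimLE S n (ModuleCat.of S (LinearMap.ker f))

/-- Injective dimension at most `n`. -/
def InjDimLE (S : Type) [CommRing S] : ℕ → ModuleCat S → Prop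
  | 0, M => Module.Injective S ↥M
  | n + 1, M => ∃ (E : ModuleCat S) (f : ↥M →ₗ[S] ↥E), Function.Injective f ∧
      Module.Injective S ↥E ∧ InjDimLE S n (ModuleCat.of S (↥E ⧸ LinearMap.range f))

/-- Injective dimension, as an element of `ℕ∞`. -/
def injDim (S : Type) [CommRing S] (M : ModuleCat S) : ℕ∞ :=
  sInf {n : ℕ∞ | ∃ k : ℕ, (k : ℕ∞) = n ∧ InjDimLE S k M}

/-- Minimal number of generators. -/
def genNumber (S : Type) [CommRing S] (M : Type) [AddCommGroup M] [Module S M] : ℕ∞ :=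
  sInf {n : ℕ∞ | ∃ s : Finset M, (s.card : ℕ∞) = n ∧ Submodule.span S (↑s : Set M) = ⊤}

/-- The socle `0 :_M J`. -/
def socle (S : Type) [CommRing S] (J : Ideal S) (M : Type) [AddCommGroup M] [Module S M] :
    Submodule S M :=
  ⨅ r ∈ J, LinearMap.ker (LinearMap.lsmul S M r)

/-- Limit closure of the sequence `x` on `M`. -/
def limClo (S : Type) [CommRing S] {v : ℕ} (x : Fin v → S) (M : Type) [AddCommGroup M]
    [Module S M] : Submodule S M :=
  ⨆ t : ℕ, (Ideal.span (Set.range fun i => x i ^ (t + 1)) • (⊤ : Submodule S M)).comap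
      (LinearMap.lsmul S M ((∏ i, x i) ^ t))

end

/-- Krull dimension of a ring, valued in `WithBot ℕ∞`. -/
noncomputable def rdim (S : Type) [CommRing S] : WithBot ℕ∞ :=
  Order.krullDim (PrimeSpectrum S)

namespace QuasiGorenstein

section Completion

/-- A local ring that is complete for its finitely generated maximal ideal and whose residue field
is covered by a Noetherian ring is Noetherian. -/
theorem isNoetherianRing_of_isAdicComplete (R : Type) [CommRing R] [IsNoetherianRing R]
    (A : Type) [CommRing A] [IsLocalRing A]
    [IsAdicComplete (maximalIdeal A) A] [Algebra R A]
    (hfg : (maximalIdeal A).FG)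
    (hs : Function.Surjective ((Ideal.Quotient.mk (maximalIdeal A)).comp (algebraMap R A))) :
    IsNoetherianRing A := by
  obtain ⟨n, x, hx⟩ := Submodule.fg_iff_exists_fin_generating_family.mp hfg
  let I := MvPolynomial.idealOfVars (Fin n) R
  let S := AdicCompletion I (MvPolynomial (Fin n) R)
  have : IsNoetherianRing S :=
    isNoetherianRing_of_ringEquiv _ (MvPowerSeries.toAdicCompletionAlgEquiv (Fin n) R).toRingEquiv
  let φ : MvPolynomial (Fin n) R →+* A := (MvPolynomial.aeval x).toRingHom
  have hI : I = Ideal.span (Set.range MvPolynomial.X) := rfl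
  have hφ : I.map φ = maximalIdeal A := by
    rw [← hx, hI, Ideal.map_span, ← Set.range_comp]
    change Submodule.span A _ = _
    congr 2
    ext; simp [φ]
  have hle (k : ℕ) : I ^ k ≤ (maximalIdeal A ^ k).comap φ := by
    rw [← Ideal.map_le_iff_le_comap, Ideal.map_pow, hφ]
  let F : S →+* A := IsAdicComplete.liftRingHom (maximalIdeal A)
    (fun k => (Ideal.quotientMap (maximalIdeal A ^ k) φ (hle k)).comp
      (AdicCompletion.evalₐ I k : S →+* _)) (by
        intro a b hab
        ext y
        induction y using AdicCompletion.induction_on with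
        | h y =>
          have h2 : Ideal.Quotient.mk (I ^ a) (y.val a) = Ideal.Quotient.mk (I ^ a) (y.val b) := by
            have := y.2 hab
            rwa [SModEq.sub_mem, smul_eq_mul, Ideal.mul_top,
              ← Ideal.Quotient.mk_eq_mk_iff_sub_mem] at this
          exact congrArg (Ideal.quotientMap (maximalIdeal A ^ a) φ (hle a)) h2.symm)
  have hF (p : MvPolynomial (Fin n) R) : F (algebraMap _ S p) = φ p := by
    refine (IsHausdorff.eq_iff_smodEq (I := maximalIdeal A)).mpr fun k => ?_
    rw [SModEq.sub_mem, smul_eq_mul, Ideal.mul_top, ← Ideal.Quotient.mk_eq_mk_iff_sub_mem]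
    rw [IsAdicComplete.mk_liftRingHom]
    simp
  have hSF : (I.map (algebraMap _ S)).map F = maximalIdeal A := by
    rw [Ideal.map_map, ← hφ]
    exact congrArg (fun g => Ideal.map g I) (RingHom.ext hF)
  have : IsAdicComplete (I.map (algebraMap _ S)) S :=
    AdicCompletion.isAdicComplete_self _ (MvPolynomial.idealOfVars_fg (Fin n) R)
  have : IsHausdorff ((I.map (algebraMap _ S)).map F) A := by
    rw [hSF]; infer_instance
  refine isNoetherianRing_of_surjective S A F
    (surjective_of_mk_map_comp_surjective (I := I.map (algebraMap _ S)) F ?_)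
  have key (y : A) : ∃ z : S, F z - y ∈ (I.map (algebraMap _ S)).map F := by
    obtain ⟨r, hr⟩ := hs (Ideal.Quotient.mk _ y)
    refine ⟨algebraMap (MvPolynomial (Fin n) R) S (MvPolynomial.C r), ?_⟩
    rw [hF, hSF, ← Ideal.Quotient.mk_eq_mk_iff_sub_mem, ← hr]
    exact congrArg _ (MvPolynomial.aeval_C x r)
  intro y
  obtain ⟨y, rfl⟩ := Ideal.Quotient.mk_surjective y
  obtain ⟨z, hz⟩ := key y
  exact ⟨z, (Ideal.Quotient.mk_eq_mk_iff_sub_mem _ _).mpr hz⟩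

variable (R : Type) [CommRing R] [IsNoetherianRing R] [IsLocalRing R]

instance : IsNoetherianRing (AdicCompletion (maximalIdeal R) R) := by
  apply isNoetherianRing_of_isAdicComplete R
  · rw [AdicCompletion.maximalIdeal_eq_map]
    exact (maximalIdeal R).fg_of_isNoetherianRing.map _
  · intro y
    obtain ⟨z, hz⟩ := (AdicCompletion.residueField_map_bijective (R := R)).2 y
    obtain ⟨r, rfl⟩ := Ideal.Quotient.mk_surjective z
    exact ⟨r, hz⟩

theorem ringKrullDim_adicCompletion :
    ringKrullDim (AdicCompletion (maximalIdeal R) R) = ringKrullDim R := by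
  rw [← IsLocalRing.maximalIdeal_height_eq_ringKrullDim,
    ← IsLocalRing.maximalIdeal_height_eq_ringKrullDim]
  rw [Ideal.height_eq_height_add_of_liesOver_of_hasGoingDown (maximalIdeal R)
    (maximalIdeal (AdicCompletion (maximalIdeal R) R)), ← AdicCompletion.maximalIdeal_eq_map]
  simp

end Completion

section MacRae

/-- Vectors that are independent modulo a prime `p` can be completed by standard basis vectors to
a square matrix with determinant outside `p`. -/
theorem exists_det_notMem {A : Type} [CommRing A] (p : Ideal A) [p.IsPrime] {r n : ℕ}
    (k : Fin r → Fin n → A)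
    (h : ∀ a : Fin r → A, (∀ j, ∑ i, a i * k i j ∈ p) → ∀ i, a i ∈ p) :
    ∃ s : ℕ, s + r = n ∧ ∃ J : Fin s → Fin n, ∀ e : Fin s ⊕ Fin r ≃ Fin n,
      (Matrix.of fun i j => Sum.elim (fun a => Pi.single (J a) 1) k i (e j)).det ∉ p := by
  classical
  let κ := FractionRing (A ⧸ p)
  let φ : A →+* κ := (algebraMap (A ⧸ p) κ).comp (Ideal.Quotient.mk p)
  have hφ (a : A) : φ a = 0 ↔ a ∈ p := by
    simp [φ, Ideal.Quotient.eq_zero_iff_mem]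
  let v : Fin n ⊕ Fin r → Fin n → κ := Sum.elim (fun j => Pi.single j 1) (fun i j => φ (k i j))
  have hk : LinearIndependent κ (fun i j => φ (k i j)) := by
    rw [← LinearIndependent.iff_fractionRing (R := A ⧸ p), Fintype.linearIndependent_iff]
    intro g hg i
    choose a ha using fun i => Ideal.Quotient.mk_surjective (g i)
    rw [← ha, Ideal.Quotient.eq_zero_iff_mem]
    refine h a (fun j => ?_) i
    rw [← hφ, map_sum]
    have := congr_fun hg j
    simp only [Finset.sum_apply, Pi.zero_apply, ← ha, Algebra.smul_def] at this
    simpa [φ] using this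
  have hs : LinearIndepOn κ v (Set.range Sum.inr) := by
    have h1 : LinearIndepOn κ v (Set.range (Sum.inr : Fin r → Fin n ⊕ Fin r)) ↔
        LinearIndependent κ (v ∘ Sum.inr) := linearIndepOn_range_iff Sum.inr_injective v
    exact h1.mpr hk
  obtain ⟨b, -, hb, hspan, hind⟩ := exists_linearIndepOn_extension hs (Set.subset_univ _)
  have htop : Submodule.span κ (Set.range fun x : b => v x) = ⊤ := by
    rw [eq_top_iff]
    intro y _
    have : y = ∑ j, y j • (Pi.single j 1 : Fin n → κ) := by
      ext i; simp [Finset.sum_apply, Pi.single_apply]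
    rw [this]
    refine Submodule.sum_mem _ fun j _ => Submodule.smul_mem _ _ ?_
    have := hspan ⟨Sum.inl j, trivial, rfl⟩
    rwa [Set.image_eq_range] at this
  let B := Module.Basis.mk hind htop.ge
  have hcard : Fintype.card b = n := by
    rw [← Module.finrank_eq_card_basis B]; simp
  let T := {j : Fin n // Sum.inl j ∈ b}
  let E : T ⊕ Fin r ≃ b :=
    Equiv.ofBijective (Sum.elim (fun j => ⟨Sum.inl j.1, j.2⟩) fun i => ⟨Sum.inr i, hb ⟨i, rfl⟩⟩) (by
      constructor
      · rintro (⟨x, hx⟩ | x) (⟨y, hy⟩ | y) <;> intro hxy <;>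
          simp [T, Subtype.ext_iff] at hxy ⊢ <;> exact hxy
      · rintro ⟨x | x, hx⟩
        · exact ⟨Sum.inl ⟨x, hx⟩, rfl⟩
        · exact ⟨Sum.inr x, rfl⟩)
  refine ⟨Fintype.card T, ?_, fun a => ((Fintype.equivFin T).symm a).1, fun e => ?_⟩
  · refine Eq.trans ?_ ((Fintype.card_congr E).trans hcard)
    simp
  rw [← hφ, RingHom.map_det]
  let E' : Fin (Fintype.card T) ⊕ Fin r ≃ b :=
    (Equiv.sumCongr (Fintype.equivFin T).symm (.refl _)).trans E
  have h2 : LinearIndependent κ (fun i => v (E' i)) := hind.comp E' E'.injective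
  have h3 := h2.map' (LinearEquiv.funCongrLeft κ κ e).toLinearMap (LinearEquiv.ker _)
  have h4 := Matrix.linearIndependent_rows_iff_isUnit (A := Matrix.of fun i j => v (E' i) (e j))
  have h5 := (Matrix.isUnit_iff_isUnit_det _).mp (h4.mp h3)
  refine ne_of_eq_of_ne (congrArg Matrix.det ?_) h5.ne_zero
  ext i j
  rcases i with i | i
  · change φ ((Pi.single ((Fintype.equivFin T).symm i).1 1 : Fin n → A) (e j)) =
      (Pi.single ((Fintype.equivFin T).symm i).1 1 : Fin n → κ) (e j)
    simp only [Pi.single_apply]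
    split_ifs <;> simp
  · rfl

end MacRae
section MacRae

/-- Finite free resolutions of length at most `n` by finite free modules. -/
def FFR (A : Type) [CommRing A] : ℕ → ∀ (M : Type) [AddCommGroup M] [Module A M], Prop
  | 0, M, _, _ => Module.Finite A M ∧ Module.Free A M
  | n + 1, M, _, _ => ∃ (r : ℕ) (f : (Fin r → A) →ₗ[A] M), Function.Surjective f ∧
      FFR A n (LinearMap.ker f)

/-- Primes of the form `(x : z)` with `x` zero or a nonzerodivisor. -/
def IsD1 {A : Type} [CommRing A] (p : Ideal A) : Prop :=
  p.IsPrime ∧ ∃ x z : A, (x = 0 ∨ x ∈ nonZeroDivisors A) ∧ ∀ a, a ∈ p ↔ x ∣ a * z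

/-- A determinant function of rank `r`, generating the top exterior power at the primes
satisfying `IsD1`. -/
def HasDet (A M : Type) [CommRing A] [AddCommGroup M] [Module A M] (r : ℕ) : Prop :=
  ∃ δ : (Fin r → M) → A,
    (∀ (C : Matrix (Fin r) (Fin r) A) m, δ (fun i => ∑ j, C i j • m j) = C.det * δ m) ∧
    ∀ p, IsD1 p → ∃ m, δ m ∉ p ∧ ∃ s ∉ p, ∀ y, ∃ c : Fin r → A, s • y = ∑ j, c j • m j

variable {A : Type} [CommRing A]

theorem isD1_of_mem_associatedPrimes [IsNoetherianRing A] {x : A}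
    (hx : x = 0 ∨ x ∈ nonZeroDivisors A) {p : Ideal A}
    (hp : IsAssociatedPrime p (A ⧸ Ideal.span {x})) : IsD1 p := by
  obtain ⟨h1, y, hy⟩ := isAssociatedPrime_iff.mp hp
  obtain ⟨z, rfl⟩ := Ideal.Quotient.mk_surjective y
  refine ⟨h1, x, z, hx, fun a => ?_⟩
  rw [hy, Submodule.mem_colon_singleton, Submodule.mem_bot, Algebra.smul_def,
    Ideal.Quotient.algebraMap_eq, ← map_mul, Ideal.Quotient.eq_zero_iff_mem,
    Ideal.mem_span_singleton]

theorem isD1_of_mem_associatedPrimes_self [IsNoetherianRing A] {p : Ideal A}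
    (hp : IsAssociatedPrime p A) : IsD1 p := by
  have e : (A ⧸ Ideal.span {(0 : A)}) ≃ₗ[A] A := Submodule.quotEquivOfEqBot _ (by simp)
  exact isD1_of_mem_associatedPrimes (x := 0) (Or.inl rfl) (e.isAssociatedPrime_iff.mpr hp)

/-- Every proper conductor `(x : a)` is contained in a prime satisfying `IsD1`. -/
theorem exists_isD1 [IsNoetherianRing A] {x a : A} (hx : x = 0 ∨ x ∈ nonZeroDivisors A)
    (ha : ¬ x ∣ a) : ∃ p, IsD1 p ∧ ∀ v, x ∣ v * a → v ∈ p := by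
  have : (Ideal.Quotient.mk (Ideal.span {x}) a) ≠ 0 := by
    rwa [Ne, Ideal.Quotient.eq_zero_iff_mem, Ideal.mem_span_singleton]
  obtain ⟨p, hp, hle⟩ := exists_le_isAssociatedPrime_of_isNoetherianRing A _ this
  refine ⟨p, isD1_of_mem_associatedPrimes hx hp, fun v hv => hle ?_⟩
  rwa [Submodule.mem_colon_singleton, Submodule.mem_bot, Algebra.smul_def,
    Ideal.Quotient.algebraMap_eq, ← map_mul, Ideal.Quotient.eq_zero_iff_mem,
    Ideal.mem_span_singleton]

theorem eq_zero_of_isD1 [IsNoetherianRing A] {b : A}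
    (h : ∀ p : Ideal A, IsD1 p → ∃ v ∉ p, v * b = 0) : b = 0 := by
  by_contra hb
  obtain ⟨p, hp, hv⟩ := exists_isD1 (x := 0) (Or.inl rfl) (a := b) (by simpa using hb)
  obtain ⟨v, hvp, h0⟩ := h p hp
  exact hvp (hv v (by simp [h0]))

theorem exists_mem_notMem_of_finite (J : Ideal A) (S : Set (Ideal A)) (hS : S.Finite)
    (hp : ∀ p ∈ S, p.IsPrime) (hJ : ∀ p ∈ S, ¬ J ≤ p) : ∃ x ∈ J, ∀ p ∈ S, x ∉ p := by
  by_contra! h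
  have h1 : (J : Set A) ⊆ ⋃ i ∈ (↑hS.toFinset : Set (Ideal A)), (i : Set A) := by
    intro x hx
    obtain ⟨p, hpS, hxp⟩ := h x hx
    simp only [Set.mem_iUnion]
    exact ⟨p, by simpa using hpS, hxp⟩
  rw [Ideal.subset_union_prime (f := fun i => i) ⊥ ⊥ (fun i hi _ _ => hp i (by simpa using hi))]
    at h1
  obtain ⟨p, hpS, hle⟩ := h1
  exact hJ p (by simpa using hpS) hle

theorem exists_mem_nonZeroDivisors [IsNoetherianRing A] (J : Ideal A)
    (hJ : ∀ p : Ideal A, IsD1 p → ¬ J ≤ p) : ∃ x ∈ J, x ∈ nonZeroDivisors A := by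
  obtain ⟨x, hx, h⟩ := exists_mem_notMem_of_finite J (associatedPrimes A A)
    (associatedPrimes.finite A A) (fun p hp => hp.1)
    (fun p hp => hJ p (isD1_of_mem_associatedPrimes_self hp))
  refine ⟨x, hx, by_contra fun hn => ?_⟩
  have : x ∈ ⋃ p ∈ associatedPrimes A A, (p : Set A) := by
    rw [biUnion_associatedPrimes_eq_compl_nonZeroDivisors]; exact hn
  simp only [Set.mem_iUnion] at this
  obtain ⟨p, hp, hxp⟩ := this
  exact h p hp hxp

theorem exists_eq_mul_of_isD1 [IsNoetherianRing A] {S : Type} (θ δ : S → A)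
    (hδ : ∀ a, (∀ s, a * δ s = 0) → a = 0)
    (h : ∀ p : Ideal A, IsD1 p → ∃ v ∉ p, ∃ a, ∀ s, v * θ s = a * δ s) :
    ∃ a, ∀ s, θ s = a * δ s := by
  let J : Ideal A :=
    { carrier := {v | ∃ a, ∀ s, v * θ s = a * δ s}
      add_mem' := by
        rintro u v ⟨a, ha⟩ ⟨b, hb⟩
        exact ⟨a + b, fun s => by rw [add_mul, ha, hb, add_mul]⟩
      zero_mem' := ⟨0, by simp⟩
      smul_mem' := by
        rintro c v ⟨a, ha⟩
        exact ⟨c * a, fun s => by rw [smul_eq_mul, mul_assoc, ha, mul_assoc]⟩ }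
  have hJ (p : Ideal A) (hp : IsD1 p) : ¬ J ≤ p := fun hle => by
    obtain ⟨v, hv, hv'⟩ := h p hp
    exact hv (hle hv')
  obtain ⟨x, ⟨a, ha⟩, hx⟩ := exists_mem_nonZeroDivisors J hJ
  by_cases hxa : x ∣ a
  · obtain ⟨b, rfl⟩ := hxa
    refine ⟨b, fun s => ?_⟩
    have := ha s
    rw [mul_assoc] at this
    exact (mul_cancel_left_mem_nonZeroDivisors hx).mp this
  · obtain ⟨p, hp, hv⟩ := exists_isD1 (Or.inr hx) hxa
    obtain ⟨v, hvp, b, hb⟩ := h p hp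
    refine absurd (hv v ?_) hvp
    refine ⟨b, ?_⟩
    rw [← sub_eq_zero]
    apply hδ
    intro s
    linear_combination x * hb s - v * ha s

/-- A determinant function detects linear relations. -/
theorem mul_eq_zero_of_relation {M : Type} [AddCommGroup M] [Module A M] {r : ℕ}
    {δ : (Fin r → M) → A}
    (hδ : ∀ (C : Matrix (Fin r) (Fin r) A) m, δ (fun i => ∑ j, C i j • m j) = C.det * δ m)
    (m : Fin r → M) (a : Fin r → A) (h : ∑ i, a i • m i = 0) (i : Fin r) : a i * δ m = 0 := by
  have h1 := hδ ((1 : Matrix (Fin r) (Fin r) A).updateRow i a) m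
  have h2 := hδ ((1 : Matrix (Fin r) (Fin r) A).updateRow i 0) m
  have h3 : ((1 : Matrix (Fin r) (Fin r) A).updateRow i a).det = a i := by
    have := Matrix.det_updateRow_sum (1 : Matrix (Fin r) (Fin r) A) i a
    rw [Matrix.det_one, smul_eq_mul, mul_one] at this
    rw [← this]
    congr
    ext j
    simp [Finset.sum_apply, Matrix.one_apply]
  have h4 : ((1 : Matrix (Fin r) (Fin r) A).updateRow i 0).det = 0 :=
    Matrix.det_eq_zero_of_row_eq_zero i (by simp)
  rw [h3] at h1
  rw [h4, zero_mul] at h2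
  rw [← h1, ← h2]
  congr
  ext l
  by_cases hl : l = i
  · subst hl; simpa using h
  · simp [Matrix.updateRow_ne hl]

theorem det_sumElim_rows {r s : ℕ} {ι : Type} (f : Fin r → ι → A) (k : Fin s → ι → A)
    (e : Fin r ⊕ Fin s ≃ ι) (C : Matrix (Fin r) (Fin r) A) (D : Matrix (Fin r) (Fin s) A)
    (C' : Matrix (Fin s) (Fin s) A) :
    (Matrix.of fun i j => Sum.elim (fun i => ∑ j, C i j • f j + ∑ j, D i j • k j)
      (fun i => ∑ j, C' i j • k j) i (e j)).det =
      C.det * C'.det * (Matrix.of fun i j => Sum.elim f k i (e j)).det := by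
  rw [← Matrix.det_fromBlocks_zero₂₁ C D C', ← Matrix.det_mul]
  congr 1
  ext i j
  rcases i with i | i <;> simp [Matrix.mul_apply, Finset.sum_apply]

end MacRae
section MacRae

variable {A : Type} [CommRing A]

/-- If the kernel `K` of a surjection from a free module has a determinant function, then at every
prime satisfying `IsD1` a local basis of `K` remains independent modulo the prime. -/
theorem mem_of_sum_mem {M : Type} [AddCommGroup M] [Module A M]
    (hM : ∀ x ∈ nonZeroDivisors A, ∀ m : M, x • m = 0 → m = 0)
    {n r : ℕ} (f : (Fin n → A) →ₗ[A] M) {δ : (Fin r → LinearMap.ker f) → A}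
    (hδ : ∀ (C : Matrix (Fin r) (Fin r) A) m, δ (fun i => ∑ j, C i j • m j) = C.det * δ m)
    {p : Ideal A} (hp : IsD1 p) (k : Fin r → LinearMap.ker f) (hk : δ k ∉ p) {s : A} (hs : s ∉ p)
    (hspan : ∀ y, ∃ c : Fin r → A, s • y = ∑ j, c j • k j) (a : Fin r → A)
    (ha : ∀ j, ∑ i, a i * (k i : Fin n → A) j ∈ p) (i : Fin r) : a i ∈ p := by
  obtain ⟨hprime, x, z, hx, hxz⟩ := hp
  have h1 : ∃ w : LinearMap.ker f, z • ∑ i, a i • k i = x • w := by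
    rcases hx with rfl | hx
    · refine ⟨0, ?_⟩
      ext j
      obtain ⟨c, hc⟩ := (hxz _).mp (ha j)
      simpa [Finset.sum_apply, mul_comm z] using hc
    · choose w hw using fun j => (hxz _).mp (ha j)
      have hw' : z • ((∑ i, a i • k i : LinearMap.ker f) : Fin n → A) = x • w := by
        ext j
        simpa [Finset.sum_apply, mul_comm z] using hw j
      refine ⟨⟨w, hM x hx _ ?_⟩, Subtype.ext hw'⟩
      rw [← map_smul, ← hw', map_smul, LinearMap.mem_ker.mp (Subtype.prop _), smul_zero]
  obtain ⟨w, hw⟩ := h1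
  obtain ⟨c, hc⟩ := hspan w
  have h2 : ∑ i, (s * z * a i - x * c i) • k i = 0 := by
    have h (i) : (s * z * a i - x * c i) • k i = s • z • a i • k i - x • c i • k i := by module
    rw [Finset.sum_congr rfl fun i _ => h i, Finset.sum_sub_distrib, ← Finset.smul_sum,
      ← Finset.smul_sum, ← Finset.smul_sum, hw, ← hc, smul_comm, sub_self]
  have h3 := mul_eq_zero_of_relation hδ k _ h2 i
  have h4 : δ k * s * a i ∈ p := (hxz _).mpr ⟨c i * δ k, by linear_combination h3⟩
  rcases hprime.mem_or_mem h4 with h5 | h5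
  · rcases hprime.mem_or_mem h5 with h6 | h6
    · exact absurd h6 hk
    · exact absurd h6 hs
  · exact h5

theorem hasDet_of_free (A M : Type) [CommRing A] [Nontrivial A] [AddCommGroup M] [Module A M]
    [Module.Finite A M] [Module.Free A M] : ∃ r, HasDet A M r := by
  let b := Module.finBasis A M
  refine ⟨_, fun m => (b.toMatrix m).det, fun C m => ?_, fun p hp => ⟨b, ?_, 1, ?_, ?_⟩⟩
  · beta_reduce
    rw [mul_comm, ← Matrix.det_transpose C, ← Matrix.det_mul]
    congr 1
    ext i j
    simp [Module.Basis.toMatrix_apply, Matrix.mul_apply, mul_comm]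
  · beta_reduce
    rw [Module.Basis.toMatrix_self, Matrix.det_one]
    exact fun h => hp.1.ne_top ((Ideal.eq_top_iff_one _).mpr h)
  · exact fun h => hp.1.ne_top ((Ideal.eq_top_iff_one _).mpr h)
  · intro y
    exact ⟨b.repr y, by rw [one_smul, b.sum_repr]⟩

theorem hasDet_of_ker [IsNoetherianRing A] [Nontrivial A] {M : Type} [AddCommGroup M]
    [Module A M] (hM : ∀ x ∈ nonZeroDivisors A, ∀ m : M, x • m = 0 → m = 0)
    {n r' : ℕ} (f : (Fin n → A) →ₗ[A] M) (hf : Function.Surjective f)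
    (hK : HasDet A (LinearMap.ker f) r') : ∃ r, HasDet A M r := by
  classical
  obtain ⟨δ, hδ, hloc⟩ := hK
  have key (p : Ideal A) (hp : IsD1 p) : ∃ k, δ k ∉ p ∧ (∃ s ∉ p, ∀ y, ∃ c : Fin r' → A,
      s • y = ∑ j, c j • k j) ∧ ∃ r : ℕ, r + r' = n ∧ ∃ J : Fin r → Fin n,
      ∀ e : Fin r ⊕ Fin r' ≃ Fin n, (Matrix.of fun i j =>
        Sum.elim (fun a => Pi.single (J a) 1) (fun i => (k i : Fin n → A)) i (e j)).det ∉ p := by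
    obtain ⟨k, hk, s, hs, hspan⟩ := hloc p hp
    have := hp.1
    exact ⟨k, hk, ⟨s, hs, hspan⟩, exists_det_notMem p (fun i => (k i : Fin n → A))
      (mem_of_sum_mem hM f hδ hp k hk hs hspan)⟩
  obtain ⟨r, hr⟩ : ∃ r, r + r' = n := by
    obtain ⟨p, hp⟩ := associatedPrimes.nonempty A A
    obtain ⟨k, -, -, r, hr, -⟩ := key p (isD1_of_mem_associatedPrimes_self hp)
    exact ⟨r, hr⟩
  let e : Fin r ⊕ Fin r' ≃ Fin n := finSumFinEquiv.trans (finCongr hr)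
  let D (u : Fin r → Fin n → A) (k : Fin r' → LinearMap.ker f) : A :=
    (Matrix.of fun i j => Sum.elim u (fun i => (k i : Fin n → A)) i (e j)).det
  have hD (u : Fin r → Fin n → A) (k : Fin r' → LinearMap.ker f) (C : Matrix (Fin r) (Fin r) A)
      (B : Matrix (Fin r) (Fin r') A) (C' : Matrix (Fin r') (Fin r') A) :
      D (fun i => ∑ j, C i j • u j + ∑ j, B i j • (k j : Fin n → A))
        (fun i => ∑ j, C' i j • k j) = C.det * C'.det * D u k := by
    rw [← det_sumElim_rows u (fun i => (k i : Fin n → A)) e C B C']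
    simp only [D]
    congr 1
    ext i j
    rcases i with i | i <;> simp
  have hshift (s : A) (k : Fin r' → LinearMap.ker f)
      (hspan : ∀ y, ∃ c : Fin r' → A, s • y = ∑ j, c j • k j) (u w : Fin r → Fin n → A)
      (C : Matrix (Fin r) (Fin r) A)
      (huw : ∀ i, f (w i) = f (∑ j, C i j • u j)) : s ^ r * D w k = s ^ r * C.det * D u k := by
    choose B hB using fun i => hspan ⟨w i - ∑ j, C i j • u j, by
      rw [LinearMap.mem_ker, map_sub, huw, sub_self]⟩
    have h1 := hD u k (s • C) (Matrix.of B) 1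
    have h2 := hD w k (s • 1) 0 1
    simp only [Matrix.det_smul, Matrix.det_one, Fintype.card_fin, mul_one] at h1 h2
    rw [← h1, ← h2]
    congr 1
    ext i : 1
    have := congrArg Subtype.val (hB i)
    simp only [Submodule.coe_smul, Submodule.coe_sum, smul_sub] at this
    simp only [Matrix.smul_apply, smul_eq_mul, mul_smul, ← Finset.smul_sum, Matrix.of_apply,
      Matrix.zero_apply, zero_smul, Finset.sum_const_zero, add_zero]
    rw [← this]
    simp [Matrix.one_apply]
  have hfaith (a : A) (ha : ∀ k, a * δ k = 0) : a = 0 := eq_zero_of_isD1 fun p hp => by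
    obtain ⟨k, hk, -⟩ := hloc p hp
    exact ⟨δ k, hk, by rw [mul_comm, ha]⟩
  have hc (u : Fin r → Fin n → A) : ∃ c, ∀ k, D u k = c * δ k := by
    refine exists_eq_mul_of_isD1 (D u) δ hfaith fun p hp => ?_
    obtain ⟨k₀, hk, s, hs, hspan⟩ := hloc p hp
    refine ⟨s ^ r' * δ k₀, ?_, s ^ r' * D u k₀, fun k => ?_⟩
    · exact fun h => (hp.1.mem_or_mem h).elim (fun h => hs (hp.1.mem_of_pow_mem _ h)) hk
    choose C hC using fun i => hspan (k i)
    have h1 := hδ (Matrix.of C) k₀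
    have h2 := hδ (s • 1) k
    have h3 := hD u k₀ 1 0 (Matrix.of C)
    have h4 := hD u k 1 0 (s • 1)
    have h5 : (fun i => ∑ j, Matrix.of C i j • k₀ j) =
        fun i => ∑ j, (s • (1 : Matrix (Fin r') (Fin r') A)) i j • k j := by
      ext i : 1
      rw [show ∑ j, Matrix.of C i j • k₀ j = _ from (hC i).symm]
      simp [Matrix.one_apply]
    rw [h5, h2] at h1
    rw [h5] at h3
    have h6 : D (fun i => ∑ j, (1 : Matrix (Fin r) (Fin r) A) i j • u j +
        ∑ j, (0 : Matrix (Fin r) (Fin r') A) i j • (k₀ j : Fin n → A))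
        (fun i => ∑ j, (s • (1 : Matrix (Fin r') (Fin r') A)) i j • k j) =
        D (fun i => ∑ j, (1 : Matrix (Fin r) (Fin r) A) i j • u j +
        ∑ j, (0 : Matrix (Fin r) (Fin r') A) i j • (k j : Fin n → A))
        (fun i => ∑ j, (s • (1 : Matrix (Fin r') (Fin r') A)) i j • k j) := by
      simp
    rw [h6, h4] at h3
    simp only [Matrix.det_smul, Matrix.det_one, Fintype.card_fin, mul_one, one_mul] at h1 h3
    linear_combination δ k₀ * h3 - D u k₀ * h1
  choose c hc using hc
  let g := Function.surjInv hf
  have hg := Function.surjInv_eq hf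
  refine ⟨r, fun m => c fun i => g (m i), fun C m => ?_, fun p hp => ?_⟩
  · rw [← sub_eq_zero]
    refine eq_zero_of_isD1 fun p hp => ?_
    obtain ⟨k₀, hk, s, hs, hspan⟩ := hloc p hp
    refine ⟨s ^ r * δ k₀, ?_, ?_⟩
    · exact fun h => (hp.1.mem_or_mem h).elim (fun h => hs (hp.1.mem_of_pow_mem _ h)) hk
    have := hshift s k₀ hspan (fun i => g (m i)) (fun i => g (∑ j, C i j • m j)) C (fun i => by
      simp [g, hg])
    rw [hc, hc] at this
    linear_combination this
  · obtain ⟨k, hk, ⟨s, hs, hspan⟩, r₁, hr₁, J, hJ⟩ := key p hp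
    obtain rfl : r₁ = r := by omega
    specialize hJ e
    let m : Fin r₁ → M := fun i => f (Pi.single (J i) 1)
    refine ⟨m, fun hmem => hJ ?_, _, hJ, fun y => ?_⟩
    · have := hshift s k hspan (fun i => Pi.single (J i) 1) (fun i => g (m i)) 1 (fun i => by
        simp [g, hg, m, Matrix.one_apply])
      rw [hc, Matrix.det_one, mul_one] at this
      have h1 : s ^ r₁ * D (fun i => Pi.single (J i) 1) k ∈ p := by
        rw [← this]
        exact Ideal.mul_mem_left _ _ (Ideal.mul_mem_right _ _ hmem)
      exact (hp.1.mem_or_mem h1).resolve_left fun h => hs (hp.1.mem_of_pow_mem _ h)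
    · obtain ⟨Y, rfl⟩ := hf y
      set N : Matrix (Fin r₁ ⊕ Fin r') (Fin r₁ ⊕ Fin r') A := Matrix.of fun i j =>
        Sum.elim (fun a => Pi.single (J a) 1) (fun i => (k i : Fin n → A)) i (e j) with hN
      let v := Matrix.vecMul (fun j => Y (e j)) N.adjugate
      refine ⟨fun i => v (Sum.inl i), ?_⟩
      have h1 : Matrix.vecMul v N = N.det • fun j => Y (e j) := by
        simp only [v]
        rw [Matrix.vecMul_vecMul, Matrix.adjugate_mul, Matrix.vecMul_smul, Matrix.vecMul_one]
      have h2 : N.det • Y = ∑ i, v (Sum.inl i) • (Pi.single (J i) 1 : Fin n → A) +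
          ((∑ i, v (Sum.inr i) • k i : LinearMap.ker f) : Fin n → A) := by
        ext j
        obtain ⟨j, rfl⟩ := e.surjective j
        rw [Pi.smul_apply]
        have := congr_fun h1 j
        rw [Pi.smul_apply] at this
        rw [← this]
        simp [Matrix.vecMul, dotProduct, hN, Finset.sum_apply]
      rw [← map_smul, h2, map_add, LinearMap.mem_ker.mp (Subtype.prop _), add_zero]
      simp [m]

theorem hasDet_of_ffr [IsNoetherianRing A] [Nontrivial A] (n : ℕ) :
    ∀ (M : Type) [AddCommGroup M] [Module A M], FFR A n M →
      (∀ x ∈ nonZeroDivisors A, ∀ m : M, x • m = 0 → m = 0) → ∃ r, HasDet A M r := by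
  induction n with
  | zero =>
    intro M _ _ ⟨_, _⟩ _
    exact hasDet_of_free A M
  | succ n ih =>
    intro M _ _ ⟨r, f, hf, hn⟩ hM
    obtain ⟨r', h⟩ := ih _ hn (by
      rintro x hx ⟨m, hm⟩ h0
      ext j
      exact (mul_right_mem_nonZeroDivisors_eq_zero_iff hx).mp
        (by simpa [mul_comm] using congr_fun (congrArg Subtype.val h0) j))
    exact hasDet_of_ker hM f hf h

theorem eq_zero_of_smul_eq_zero [IsNoetherianRing A] {M : Type} [AddCommGroup M] [Module A M]
    {x : A} (hx : ∀ p : Ideal A, IsAssociatedPrime p M → x ∉ p) {m : M} (h : x • m = 0) :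
    m = 0 := by
  by_contra hm
  obtain ⟨p, hp, hle⟩ := exists_le_isAssociatedPrime_of_isNoetherianRing A m hm
  exact hx p hp (hle (by rwa [Submodule.mem_colon_singleton, Submodule.mem_bot]))

/-- A finite module of rank one with a finite free resolution which satisfies the two expected
conditions on associated primes is free. -/
theorem linearEquiv_of_ffr [IsNoetherianRing A] [IsLocalRing A] {ω : Type} [AddCommGroup ω]
    [Module A ω] (n : ℕ) (hω : FFR A n ω)
    (hAss : ∀ p : Ideal A, IsAssociatedPrime p ω → IsAssociatedPrime p A)
    (hreg : ∀ x ∈ nonZeroDivisors A, x ∈ maximalIdeal A →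
      ∀ p : Ideal A, IsAssociatedPrime p (QuotSMulTop x ω) →
        IsAssociatedPrime p (A ⧸ Ideal.span {x}))
    (p : Ideal A) (hp : IsAssociatedPrime p ω)
    (hrank : ∀ r (m : Fin r → ω),
      (∀ a : Fin r → A, ∑ i, a i • m i = 0 → ∃ t ∉ p, ∀ i, t * a i = 0) → r ≤ 1) :
    Nonempty (ω ≃ₗ[A] A) := by
  have hnzd (q : Ideal A) (hq : IsAssociatedPrime q A) (x : A) (hx : x ∈ nonZeroDivisors A) :
      x ∉ q := fun hxq => by
    have : x ∈ ⋃ p ∈ associatedPrimes A A, (p : Set A) := by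
      simp only [Set.mem_iUnion]; exact ⟨q, hq, hxq⟩
    rw [biUnion_associatedPrimes_eq_compl_nonZeroDivisors] at this
    exact this hx
  obtain ⟨r, δ, hδ, hloc⟩ := hasDet_of_ffr n ω hω fun x hx m hm =>
    eq_zero_of_smul_eq_zero (fun q hq => hnzd q (hAss q hq) x hx) hm
  obtain rfl : r = 1 := by
    obtain ⟨m, hm, s, hs, hspan⟩ := hloc p (isD1_of_mem_associatedPrimes_self (hAss p hp))
    refine le_antisymm (hrank r m fun a ha => ⟨δ m, hm, fun i => ?_⟩) ?_
    · rw [mul_comm]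
      exact mul_eq_zero_of_relation hδ m a ha i
    · by_contra! hr
      obtain rfl : r = 0 := by omega
      obtain ⟨w, rfl⟩ := (isAssociatedPrime_iff.mp hp).2
      obtain ⟨c, hc⟩ := hspan w
      refine hs ?_
      rw [Submodule.mem_colon_singleton, Submodule.mem_bot, hc]
      simp
  let δ' (w : ω) : A := δ fun _ => w
  have hsmul (a : A) (w : ω) : δ' (a • w) = a * δ' w := by
    have := hδ (Matrix.of fun _ _ => a) (fun _ => w)
    simpa using this
  have hspan' (q : Ideal A) (hq : IsD1 q) : ∃ m, δ' m ∉ q ∧ ∃ s ∉ q, ∀ y, ∃ c : A,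
      s • y = c • m := by
    obtain ⟨m, hm, s, hs, h⟩ := hloc q hq
    have hm' : m = fun _ => m 0 := by ext i; rw [Subsingleton.elim i 0]
    refine ⟨m 0, hm' ▸ hm, s, hs, fun y => ?_⟩
    obtain ⟨c, hc⟩ := h y
    exact ⟨c 0, by simpa using hc⟩
  let D : ω →ₗ[A] A :=
    { toFun := δ'
      map_smul' := hsmul
      map_add' := fun y z => by
        rw [← sub_eq_zero]
        refine eq_zero_of_isD1 fun q hq => ?_
        obtain ⟨m, -, s, hs, h⟩ := hspan' q hq
        obtain ⟨c, hc⟩ := h y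
        obtain ⟨c', hc'⟩ := h z
        refine ⟨s, hs, ?_⟩
        rw [mul_sub, mul_add, ← hsmul, ← hsmul, ← hsmul, smul_add, hc, hc', ← add_smul, hsmul,
          hsmul, hsmul]
        ring }
  have hD (y : ω) : D y = δ' y := rfl
  have hinj : Function.Injective D := by
    rw [injective_iff_map_eq_zero]
    intro y hy
    by_contra hy0
    obtain ⟨q, hq, hle⟩ := exists_le_isAssociatedPrime_of_isNoetherianRing A y hy0
    obtain ⟨m, hm, s, hs, h⟩ := hspan' q (isD1_of_mem_associatedPrimes_self (hAss q hq))
    obtain ⟨c, hc⟩ := h y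
    have h1 : δ' m * s ∈ q := hle (by
      rw [Submodule.mem_colon_singleton, Submodule.mem_bot, mul_smul, hc, smul_smul, mul_comm,
        ← hsmul, ← hc, hsmul, ← hD, hy, mul_zero, zero_smul])
    exact (hq.1.mem_or_mem h1).elim hm hs
  have hsurj : Function.Surjective D := by
    have hc (q : Ideal A) (hq : IsD1 q) : ¬ LinearMap.range D ≤ q := fun hle => by
      obtain ⟨m, hm, -⟩ := hspan' q hq
      exact hm (hle ⟨m, rfl⟩)
    rw [← LinearMap.range_eq_top]
    by_contra htop
    have hle : LinearMap.range D ≤ maximalIdeal A := IsLocalRing.le_maximalIdeal htop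
    obtain ⟨_, ⟨w₁, rfl⟩, hx₁⟩ := exists_mem_nonZeroDivisors _ hc
    obtain ⟨_, ⟨w₂, rfl⟩, hx₂⟩ := exists_mem_notMem_of_finite _
      (associatedPrimes A (A ⧸ Ideal.span {D w₁})) (associatedPrimes.finite A _)
      (fun q hq => hq.1) (fun q hq => hc q (isD1_of_mem_associatedPrimes (Or.inr hx₁) hq))
    have h1 : D w₂ • w₁ = D w₁ • w₂ := hinj (by
      rw [map_smul, map_smul, smul_eq_mul, smul_eq_mul, mul_comm])
    have h2 : (Submodule.Quotient.mk w₁ : QuotSMulTop (D w₁) ω) = 0 := by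
      refine eq_zero_of_smul_eq_zero (x := D w₂)
        (fun q hq => hx₂ q (hreg _ hx₁ (hle ⟨w₁, rfl⟩) q hq)) ?_
      rw [← Submodule.Quotient.mk_smul, h1, Submodule.Quotient.mk_eq_zero]
      exact Submodule.smul_mem_pointwise_smul _ _ _ trivial
    rw [Submodule.Quotient.mk_eq_zero, Submodule.mem_smul_pointwise_iff_exists] at h2
    obtain ⟨w, -, hw⟩ := h2
    have h3 : D w₁ * D w = D w₁ * 1 := by
      rw [mul_one, ← smul_eq_mul, ← map_smul, hw]
    have h4 := (mul_cancel_left_mem_nonZeroDivisors hx₁).mp h3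
    exact htop ((Ideal.eq_top_iff_one _).mpr ⟨w, h4⟩)
  exact ⟨LinearEquiv.ofBijective D ⟨hinj, hsurj⟩⟩

end MacRae
section Torsion

variable (A : Type) [CommRing A] [IsLocalRing A]

/-- The submodule of elements killed by a power of the maximal ideal. -/
def Gam (M : Type) [AddCommGroup M] [Module A M] : Submodule A M where
  carrier := {m | ∃ t : ℕ, ∀ a ∈ maximalIdeal A ^ t, a • m = 0}
  add_mem' := by
    rintro x y ⟨s, hs⟩ ⟨t, ht⟩
    refine ⟨max s t, fun a ha => ?_⟩
    rw [smul_add, hs a (Ideal.pow_le_pow_right (le_max_left _ _) ha),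
      ht a (Ideal.pow_le_pow_right (le_max_right _ _) ha), add_zero]
  zero_mem' := ⟨0, by simp⟩
  smul_mem' := by
    rintro c x ⟨t, ht⟩
    exact ⟨t, fun a ha => by rw [smul_comm, ht a ha, smul_zero]⟩

/-- Modules all of whose elements are killed by a power of the maximal ideal. -/
def IsTor (M : Type) [AddCommGroup M] [Module A M] : Prop :=
  ∀ m : M, ∃ t : ℕ, ∀ a ∈ maximalIdeal A ^ t, a • m = 0

variable {A} {M N : Type} [AddCommGroup M] [Module A M] [AddCommGroup N] [Module A N]

theorem isTor_Gam : IsTor A (Gam A M) := by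
  rintro ⟨m, t, ht⟩
  exact ⟨t, fun a ha => Subtype.ext (ht a ha)⟩

theorem IsTor.of_injective (h : IsTor A N) (f : M →ₗ[A] N) (hf : Function.Injective f) :
    IsTor A M := fun m => by
  obtain ⟨t, ht⟩ := h (f m)
  exact ⟨t, fun a ha => hf (by rw [map_smul, ht a ha, map_zero])⟩

theorem IsTor.of_surjective (h : IsTor A M) (f : M →ₗ[A] N) (hf : Function.Surjective f) :
    IsTor A N := fun n => by
  obtain ⟨m, rfl⟩ := hf n
  obtain ⟨t, ht⟩ := h m
  exact ⟨t, fun a ha => by rw [← map_smul, ht a ha, map_zero]⟩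

theorem IsTor.finsupp_fun (h : IsTor A M) (n : ℕ) : IsTor A (Fin n → M) := fun m => by
  choose t ht using fun i => h (m i)
  refine ⟨∑ i, t i, fun a ha => funext fun i => ht i a (Ideal.pow_le_pow_right ?_ ha)⟩
  exact Finset.single_le_sum (fun _ _ => Nat.zero_le _) (Finset.mem_univ i)

/-- A nonzero torsion element has a nonzero multiple killed by the maximal ideal. -/
theorem exists_socle (h : IsTor A M) (m : M) (hm : m ≠ 0) :
    ∃ c : A, c • m ≠ 0 ∧ ∀ a ∈ maximalIdeal A, a • c • m = 0 := by
  classical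
  have ht := h m
  have h0 : Nat.find ht ≠ 0 := fun h0 => by
    have := Nat.find_spec ht
    rw [h0] at this
    exact hm (by simpa using this 1)
  obtain ⟨s, hs⟩ := Nat.exists_eq_succ_of_ne_zero h0
  have h1 := Nat.find_min ht (m := s) (by omega)
  push Not at h1
  obtain ⟨c, hc, hcm⟩ := h1
  refine ⟨c, hcm, fun a ha => ?_⟩
  rw [smul_smul]
  refine Nat.find_spec ht _ ?_
  rw [hs, pow_succ']
  exact Ideal.mul_mem_mul ha hc

omit [IsLocalRing A] in
theorem injective_of_retract {I : Type} [AddCommGroup I] [Module A I] [hI : Module.Injective A I]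
    (i : M →ₗ[A] I) (r : I →ₗ[A] M) (h : ∀ m, r (i m) = m) : Module.Injective A M where
  out X Y _ _ _ _ f hf g := by
    obtain ⟨e, he⟩ := hI.out f hf (i ∘ₗ g)
    exact ⟨r ∘ₗ e, fun x => by simp [he, h]⟩

omit [IsLocalRing A] in
theorem injective_congr (e : M ≃ₗ[A] N) [Module.Injective A N] : Module.Injective A M :=
  injective_of_retract e.toLinearMap e.symm.toLinearMap (by simp)

/-- Sections supported at the maximal ideal of an injective module form an injective module. -/
theorem injective_Gam [IsNoetherianRing A] (J : Type) [AddCommGroup J] [Module A J]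
    [hJ : Module.Injective A J] : Module.Injective A (Gam A J) := by
  refine Module.Baer.injective fun I g => ?_
  have h1 : ∃ t, ∀ x : I, ∀ a ∈ maximalIdeal A ^ t, a • g x = 0 := by
    obtain ⟨S, hS⟩ := (inferInstance : Module.Finite A I).fg_top
    choose t ht using fun x : I => isTor_Gam (g x)
    refine ⟨∑ x ∈ S, t x, fun x a ha => ?_⟩
    have hx : x ∈ Submodule.span A (S : Set I) := hS ▸ trivial
    induction hx using Submodule.span_induction with
    | mem x hx =>
      exact ht x a (Ideal.pow_le_pow_right (Finset.single_le_sum (fun _ _ => Nat.zero_le _) hx) ha)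
    | zero => simp
    | add x y _ _ h1 h2 => rw [map_add, smul_add, h1, h2, add_zero]
    | smul c x _ h => rw [map_smul, smul_comm, h, smul_zero]
  obtain ⟨t, ht⟩ := h1
  obtain ⟨k, hk⟩ := Ideal.exists_pow_inf_eq_pow_smul (maximalIdeal A) I
  let s := t + k
  let π : I →ₗ[A] A ⧸ maximalIdeal A ^ s := (Submodule.mkQ (maximalIdeal A ^ s)) ∘ₗ I.subtype
  have hker : LinearMap.ker π ≤ LinearMap.ker ((Gam A J).subtype ∘ₗ g) := by
    intro x hx
    have hx' : (x : A) ∈ maximalIdeal A ^ s := by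
      simpa [π, Ideal.Quotient.eq_zero_iff_mem] using hx
    have h2 := hk s (by omega)
    have h3 : (x : A) ∈ maximalIdeal A ^ (s - k) •
        (maximalIdeal A ^ k • ⊤ ⊓ I : Submodule A A) := by
      rw [← h2]
      exact ⟨by simpa using hx', x.2⟩
    rw [show s - k = t by omega] at h3
    have h4 : (x : A) ∈ maximalIdeal A ^ t • (I : Submodule A A) :=
      Submodule.smul_mono le_rfl inf_le_right h3
    have h5 : x ∈ maximalIdeal A ^ t • (⊤ : Submodule A I) := by
      have : (x : A) ∈ (maximalIdeal A ^ t • (⊤ : Submodule A I)).map (Submodule.subtype I) := by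
        rw [Submodule.map_smul'']
        simpa using h4
      obtain ⟨y, hy, hxy⟩ := this
      rwa [← Subtype.ext hxy]
    rw [LinearMap.mem_ker, LinearMap.comp_apply]
    suffices g x = 0 by rw [this, map_zero]
    clear hx hx' h3 h4
    induction h5 using Submodule.smul_induction_on' with
    | smul a ha y _ => rw [map_smul, ht y a ha]
    | add y _ z _ h1 h2 => rw [map_add, h1, h2, add_zero]
  obtain ⟨h, hh⟩ := hJ.out ((LinearMap.ker π).liftQ π le_rfl)
    (LinearMap.ker_eq_bot.mp (Submodule.ker_liftQ_eq_bot _ _ _ le_rfl))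
    ((LinearMap.ker π).liftQ _ hker)
  refine ⟨LinearMap.codRestrict _ (h ∘ₗ Submodule.mkQ _) fun a => ⟨s, fun b hb => ?_⟩,
    fun x hx => ?_⟩
  · rw [← map_smul, LinearMap.comp_apply, Submodule.mkQ_apply,
      (Submodule.Quotient.mk_eq_zero _).mpr, map_zero]
    exact Ideal.mul_mem_right _ _ hb
  · exact Subtype.ext (hh (Submodule.Quotient.mk ⟨x, hx⟩))

end Torsion
section Matlis

/-- `E` is an injective hull of the residue field: injective, torsion, with simple socle. -/
structure IsMatlis (A : Type) [CommRing A] [IsLocalRing A] (E : Type) [AddCommGroup E]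
    [Module A E] : Prop where
  inj : Module.Injective A E
  tor : IsTor A E
  soc : ∃ u : E, u ≠ 0 ∧ (∀ a ∈ maximalIdeal A, a • u = 0) ∧
    ∀ e : E, (∀ a ∈ maximalIdeal A, a • e = 0) → ∃ c : A, e = c • u

variable (A : Type) [CommRing A]

theorem exists_injective_embedding (M : Type) [AddCommGroup M] [Module A M] :
    ∃ (J : Type) (_ : AddCommGroup J) (_ : Module A J) (f : M →ₗ[A] J), Module.Injective A J ∧
      Function.Injective f := by
  let J := Injective.under (ModuleCat.of A M)
  have : Injective J := inferInstance
  refine ⟨J, inferInstance, inferInstance, (Injective.ι (ModuleCat.of A M)).hom, ?_, ?_⟩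
  · exact Module.injective_module_of_injective_object A J
  · exact (ModuleCat.mono_iff_injective _).mp inferInstance

variable [IsLocalRing A]

theorem exists_isMatlis [IsNoetherianRing A] :
    ∃ (E : Type) (_ : AddCommGroup E) (_ : Module A E), IsMatlis A E := by
  obtain ⟨J₀, _, _, f, hJ₀, hf⟩ := exists_injective_embedding A (A ⧸ maximalIdeal A)
  let J := Gam A J₀
  have hJ : Module.Injective A J := injective_Gam J₀
  have hu0 : (f 1) ≠ 0 := by
    rw [Ne, map_eq_zero_iff f hf]; exact one_ne_zero
  have hum (a) (ha : a ∈ maximalIdeal A) : a • f 1 = 0 := by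
    rw [← map_smul, ← map_zero f, Algebra.smul_def, mul_one, Ideal.Quotient.algebraMap_eq,
      Ideal.Quotient.eq_zero_iff_mem.mpr ha]
  let u : J := ⟨f 1, 1, by simpa using hum⟩
  have hu0 : u ≠ 0 := fun h => hu0 (congrArg Subtype.val h)
  have hum (a) (ha : a ∈ maximalIdeal A) : a • u = 0 := Subtype.ext (hum a ha)
  let P : Set (Submodule A J) := {N | ∀ y ∈ N, (∀ a ∈ maximalIdeal A, a • y = 0) →
    y ∈ Submodule.span A {u}}
  obtain ⟨E, huE, hE⟩ := zorn_le_nonempty₀ P (fun c hc hchain N hN => by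
    refine ⟨sSup c, ?_, fun N hN => le_sSup hN⟩
    intro y hy hm
    obtain ⟨N, hN, hyN⟩ := (Submodule.mem_sSup_of_directed ⟨N, hN⟩ hchain.directedOn).mp hy
    exact hc hN y hyN hm) (Submodule.span A {u}) (fun y hy _ => hy)
  obtain ⟨C, -, hC⟩ := zorn_le_nonempty₀ {C : Submodule A J | ∀ y ∈ C, y ∈ E → y = 0}
    (fun c hc hchain N hN => by
    refine ⟨sSup c, ?_, fun N hN => le_sSup hN⟩
    intro y hy hm
    obtain ⟨N, hN, hyN⟩ := (Submodule.mem_sSup_of_directed ⟨N, hN⟩ hchain.directedOn).mp hy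
    exact hc hN y hyN hm) ⊥ (fun y hy _ => by simpa using hy)
  have hq : Function.Injective (C.mkQ ∘ₗ E.subtype) := by
    rw [injective_iff_map_eq_zero]
    rintro ⟨y, hy⟩ h0
    exact Subtype.ext (hC.prop y (by simpa using h0) hy)
  obtain ⟨h, hh⟩ := hJ.out _ hq E.subtype
  have hinj : Function.Injective h := by
    rw [injective_iff_map_eq_zero]
    intro z hz
    obtain ⟨z, rfl⟩ := C.mkQ_surjective z
    have h1 : C ≤ LinearMap.ker (h ∘ₗ C.mkQ) := fun y hy => by
      rw [LinearMap.mem_ker, LinearMap.comp_apply, Submodule.mkQ_apply,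
        (Submodule.Quotient.mk_eq_zero _).mpr hy, map_zero]
    have h2 := hC.le_of_ge (y := LinearMap.ker (h ∘ₗ C.mkQ)) (fun y hy hyE => by
      rw [← LinearMap.mem_ker.mp hy]
      exact (hh ⟨y, hyE⟩).symm) h1
    simpa using h2 (x := z) hz
  have hrange : LinearMap.range h ≤ E := by
    refine hE.le_of_ge ?_ fun y hy => ⟨C.mkQ y, hh ⟨y, hy⟩⟩
    rintro _ ⟨z, rfl⟩ hz
    obtain ⟨z, rfl⟩ := C.mkQ_surjective z
    have hz' (a) (ha : a ∈ maximalIdeal A) : a • C.mkQ z = 0 :=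
      hinj (by rw [map_smul, hz a ha, map_zero])
    by_cases hzC : z ∈ C
    · simp [(Submodule.Quotient.mk_eq_zero C).mpr hzC]
    have h1 : ¬ C ⊔ Submodule.span A {z} ≤ C := fun hle =>
      hzC (hle (Submodule.mem_sup_right (Submodule.mem_span_singleton_self z)))
    have h2 : ∃ y ∈ C ⊔ Submodule.span A {z}, y ∈ E ∧ y ≠ 0 := by
      by_contra! h
      exact h1 (hC.le_of_ge (fun y hy hyE => h y hy hyE) le_sup_left)
    obtain ⟨y, hy, hyE, hy0⟩ := h2
    obtain ⟨c, hc, w, hw, rfl⟩ := Submodule.mem_sup.mp hy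
    obtain ⟨a, rfl⟩ := Submodule.mem_span_singleton.mp hw
    have h3 : C.mkQ (c + a • z) = a • C.mkQ z := by
      rw [map_add, map_smul, Submodule.mkQ_apply, (Submodule.Quotient.mk_eq_zero _).mpr hc,
        zero_add]
    have h4 : h (C.mkQ (c + a • z)) = c + a • z := hh ⟨_, hyE⟩
    by_cases ha : a ∈ maximalIdeal A
    · rw [h3, hz' a ha, map_zero] at h4
      exact absurd h4.symm hy0
    · obtain ⟨b, hb⟩ := (IsLocalRing.notMem_maximalIdeal.mp ha).exists_left_inv
      have h5 : h (C.mkQ z) = b • (c + a • z) := by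
        rw [← h4, h3, map_smul, smul_smul, hb, one_smul]
      refine hE.prop _ ?_ hz
      rw [h5]
      exact E.smul_mem _ hyE
  refine ⟨E, inferInstance, inferInstance, ?_, ?_, ?_⟩
  · refine injective_of_retract E.subtype
      (LinearMap.codRestrict E (h ∘ₗ C.mkQ) fun y => hrange ⟨_, rfl⟩) fun e => ?_
    exact Subtype.ext (hh e)
  · exact isTor_Gam.of_injective E.subtype E.injective_subtype
  · refine ⟨⟨u, huE (Submodule.mem_span_singleton_self u)⟩, fun h => hu0 (congrArg Subtype.val h),
      fun a ha => Subtype.ext (hum a ha), fun e he => ?_⟩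
    obtain ⟨c, hc⟩ := Submodule.mem_span_singleton.mp
      (hE.prop e e.2 fun a ha => congrArg Subtype.val (he a ha))
    exact ⟨c, Subtype.ext hc.symm⟩

end Matlis
theorem isFiniteLength_quotient_pow (A : Type) [CommRing A] [IsLocalRing A] [IsNoetherianRing A]
    (n : ℕ) : IsFiniteLength A (A ⧸ maximalIdeal A ^ n) := by
  rw [isFiniteLength_iff_isNoetherian_isArtinian]
  refine ⟨inferInstance, ?_⟩
  rcases eq_or_ne n 0 with rfl | hn
  · have : Subsingleton (A ⧸ maximalIdeal A ^ 0) :=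
      Ideal.Quotient.subsingleton_iff.mpr (by simp)
    infer_instance
  have hle : maximalIdeal A ^ n ≤ maximalIdeal A := Ideal.pow_le_self hn
  have : Nontrivial (A ⧸ maximalIdeal A ^ n) := Ideal.Quotient.nontrivial_iff.mpr
    (ne_top_of_le_ne_top (Ideal.IsPrime.ne_top inferInstance) hle)
  have : IsLocalRing (A ⧸ maximalIdeal A ^ n) :=
    IsLocalRing.of_surjective' _ Ideal.Quotient.mk_surjective
  have : IsArtinianRing (A ⧸ maximalIdeal A ^ n) := by
    rw [isArtinianRing_iff_isNilpotent_maximalIdeal]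
    refine ⟨n, ?_⟩
    rw [← map_maximalIdeal_of_surjective _ Ideal.Quotient.mk_surjective, ← Ideal.map_pow,
      Ideal.map_quotient_self, Ideal.zero_eq_bot]
  exact isArtinian_of_surjective_algebraMap
    (R := A ⧸ maximalIdeal A ^ n) Ideal.Quotient.mk_surjective

section Duality

variable {A : Type} [CommRing A] {E : Type} [AddCommGroup E] [Module A E]
  {M N P : Type} [AddCommGroup M] [Module A M] [AddCommGroup N] [Module A N]
  [AddCommGroup P] [Module A P]

theorem lcomp_surjective (hE : Module.Injective A E) (f : M →ₗ[A] N)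
    (hf : Function.Injective f) : Function.Surjective (LinearMap.lcomp A E f) := fun φ => by
  obtain ⟨ψ, hψ⟩ := hE.out f hf φ
  exact ⟨ψ, LinearMap.ext hψ⟩

theorem lcomp_injective (f : M →ₗ[A] N)
    (hf : Function.Surjective f) : Function.Injective (LinearMap.lcomp A E f) := fun φ ψ h =>
  LinearMap.ext fun n => by
    obtain ⟨m, rfl⟩ := hf n
    exact LinearMap.congr_fun h m

theorem lcomp_exact (hE : Module.Injective A E) (f : M →ₗ[A] N) (g : N →ₗ[A] P)
    (h : Function.Exact f g) :
    Function.Exact (LinearMap.lcomp A E g) (LinearMap.lcomp A E f) := fun φ => by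
  constructor
  · intro h0
    have hle : LinearMap.ker g ≤ LinearMap.ker φ := fun x hx => by
      obtain ⟨y, rfl⟩ := (h x).mp hx
      exact LinearMap.congr_fun h0 y
    obtain ⟨ψ, hψ⟩ := hE.out ((LinearMap.ker g).liftQ g le_rfl)
      (LinearMap.ker_eq_bot.mp (Submodule.ker_liftQ_eq_bot _ _ _ le_rfl))
      ((LinearMap.ker g).liftQ φ hle)
    exact ⟨ψ, LinearMap.ext fun x => by simpa using hψ (Submodule.Quotient.mk x)⟩
  · rintro ⟨ψ, rfl⟩
    refine LinearMap.ext fun x => ?_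
    change ψ (g (f x)) = 0
    rw [h.apply_apply_eq_zero, map_zero]

variable [IsLocalRing A] (hE : IsMatlis A E)
include hE

theorem IsMatlis.exists_hom_ne_zero (n : N) (hn : n ≠ 0) : ∃ φ : N →ₗ[A] E, φ n ≠ 0 := by
  obtain ⟨u, hu0, hu, -⟩ := hE.soc
  let f := LinearMap.toSpanSingleton A N n
  have hker : LinearMap.ker f ≤ maximalIdeal A := by
    refine le_maximalIdeal fun h => hn ?_
    have : (1 : A) ∈ LinearMap.ker f := h ▸ Submodule.mem_top
    simpa [f] using this
  obtain ⟨φ, hφ⟩ := hE.inj.out ((LinearMap.ker f).liftQ f le_rfl)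
      (LinearMap.ker_eq_bot.mp (Submodule.ker_liftQ_eq_bot _ _ _ le_rfl))
      ((LinearMap.ker f).liftQ (LinearMap.toSpanSingleton A E u) fun a ha => by
        simpa using hu a (hker ha))
  refine ⟨φ, ?_⟩
  have := hφ (Submodule.Quotient.mk 1)
  simp only [Submodule.liftQ_apply, f, LinearMap.toSpanSingleton_apply_one] at this
  rwa [this]

theorem IsMatlis.length_dual_simple_le [IsSimpleModule A N] :
    Module.length A (N →ₗ[A] E) ≤ 1 := by
  obtain ⟨u, hu0, hu, hsoc⟩ := hE.soc
  have : Nontrivial N := IsSimpleModule.nontrivial A N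
  obtain ⟨s, hs⟩ := exists_ne (0 : N)
  have hms (a) (ha : a ∈ maximalIdeal A) : a • s = 0 := by
    have h1 : Module.annihilator A N = maximalIdeal A :=
      eq_maximalIdeal IsSimpleModule.annihilator_isMaximal
    exact Module.mem_annihilator.mp (h1 ▸ ha) s
  let ev : (N →ₗ[A] E) →ₗ[A] Submodule.span A {u} :=
    LinearMap.codRestrict _ (LinearMap.applyₗ s) fun φ => by
      obtain ⟨c, hc⟩ := hsoc (φ s) fun a ha => by rw [← map_smul, hms a ha, map_zero]
      exact Submodule.mem_span_singleton.mpr ⟨c, hc.symm⟩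
  have hev : Function.Injective ev := by
    rw [injective_iff_map_eq_zero]
    intro φ hφ
    have h0 : φ s = 0 := congrArg Subtype.val hφ
    rcases LinearMap.injective_or_eq_zero φ with h | h
    · exact absurd (h (h0.trans (map_zero φ).symm)) hs
    · exact h
  have hsp : Module.length A (A ⧸ maximalIdeal A) = 1 := Module.length_eq_one_iff.mpr
    (isSimpleModule_iff_isCoatom.mpr (maximalIdeal.isMaximal A).out)
  refine (Module.length_le_of_injective ev hev).trans (hsp ▸ ?_)
  refine Module.length_le_of_surjective ((maximalIdeal A).liftQ
    (LinearMap.codRestrict _ (LinearMap.toSpanSingleton A E u) fun a =>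
      Submodule.mem_span_singleton.mpr ⟨a, rfl⟩) fun a ha => Subtype.ext (hu a ha)) ?_
  rintro ⟨y, hy⟩
  obtain ⟨a, rfl⟩ := Submodule.mem_span_singleton.mp hy
  exact ⟨Submodule.Quotient.mk a, rfl⟩

theorem IsMatlis.length_dual_le (hN : IsFiniteLength A N) :
    Module.length A (N →ₗ[A] E) ≤ Module.length A N := by
  induction hN with
  | of_subsingleton => simp
  | @of_simple_quotient M _ _ N _ _ ih =>
    let r := LinearMap.lcomp A E N.subtype
    let s := LinearMap.lcomp A E N.mkQ
    have h1 := Module.length_eq_add_of_exact r.ker.subtype r.rangeRestrict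
      (Subtype.val_injective) (LinearMap.surjective_rangeRestrict r) (by
        rw [LinearMap.exact_iff]; simp)
    have h2 := Module.length_eq_add_of_exact N.subtype N.mkQ
      (Subtype.val_injective) N.mkQ_surjective (by
        rw [LinearMap.exact_iff]; simp)
    have h3 : Module.length A (M ⧸ N) = 1 := Module.length_eq_one_iff.mpr inferInstance
    have h4 : Module.length A r.ker ≤ 1 := by
      have hex := lcomp_exact hE.inj N.subtype N.mkQ (by rw [LinearMap.exact_iff]; simp)
      refine (Module.length_le_of_surjective (LinearMap.codRestrict r.ker s fun φ =>
        (hex _).mpr ⟨φ, rfl⟩) ?_).trans hE.length_dual_simple_le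
      rintro ⟨φ, hφ⟩
      obtain ⟨ψ, hψ⟩ := (hex φ).mp hφ
      exact ⟨ψ, Subtype.ext hψ⟩
    have h5 : Module.length A r.range ≤ Module.length A (N →ₗ[A] E) :=
      Module.length_le_of_injective _ r.range.injective_subtype
    rw [h1, h2, h3, add_comm]
    gcongr
    exact h5.trans ih

theorem IsMatlis.eval_surjective (hN : IsFiniteLength A N) (Θ : (N →ₗ[A] E) →ₗ[A] E) :
    ∃ n : N, ∀ φ : N →ₗ[A] E, Θ φ = φ n := by
  let ev : N →ₗ[A] ((N →ₗ[A] E) →ₗ[A] E) := LinearMap.applyₗ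
  have hev : Function.Injective ev := by
    rw [injective_iff_map_eq_zero]
    intro n hn
    by_contra h
    obtain ⟨φ, hφ⟩ := hE.exists_hom_ne_zero n h
    exact hφ (LinearMap.congr_fun hn φ)
  have hfin : IsFiniteLength A (N →ₗ[A] E) := by
    rw [← Module.length_ne_top_iff] at hN ⊢
    exact ne_top_of_le_ne_top hN (hE.length_dual_le (Module.length_ne_top_iff.mp hN))
  have h1 := (hE.length_dual_le hfin).trans (hE.length_dual_le hN)
  have h2 := Module.length_eq_add_of_exact ev ev.range.mkQ hev ev.range.mkQ_surjective (by
    rw [LinearMap.exact_iff]; simp)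
  have h3 : Module.length A (((N →ₗ[A] E) →ₗ[A] E) ⧸ ev.range) = 0 := by
    have h4 := Module.length_ne_top_iff.mpr hN
    rw [h2] at h1
    exact nonpos_iff_eq_zero.mp ((ENat.add_le_add_iff_left h4).mp (by simpa using h1))
  have h5 := Module.length_eq_zero_iff.mp h3
  obtain ⟨n, hn⟩ := LinearMap.range_eq_top.mp (Submodule.Quotient.subsingleton_iff.mp h5) Θ
  exact ⟨n, fun φ => by rw [← hn]; rfl⟩

theorem IsMatlis.mem_pow (n : ℕ) (a : A)
    (h : ∀ e : E, (∀ b ∈ maximalIdeal A ^ n, b • e = 0) → a • e = 0) :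
    a ∈ maximalIdeal A ^ n := by
  by_contra ha
  obtain ⟨φ, hφ⟩ := hE.exists_hom_ne_zero (Ideal.Quotient.mk (maximalIdeal A ^ n) a)
    (by rwa [Ne, Ideal.Quotient.eq_zero_iff_mem])
  have key (b : A) : φ (Ideal.Quotient.mk (maximalIdeal A ^ n) b) = b • φ 1 := by
    rw [← map_smul, Algebra.smul_def, mul_one, Ideal.Quotient.algebraMap_eq]
  exact hφ (by
    rw [key]
    refine h _ fun b hb => ?_
    rw [← key, Ideal.Quotient.eq_zero_iff_mem.mpr hb, map_zero])

variable [IsNoetherianRing A]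

theorem IsMatlis.eq_zero (a : A) (h : ∀ e : E, a • e = 0) : a = 0 := by
  have h1 : a ∈ ⨅ n, maximalIdeal A ^ n := by
    rw [Submodule.mem_iInf]
    exact fun n => hE.mem_pow n a fun e _ => h e
  rwa [Ideal.iInf_pow_eq_bot_of_isLocalRing _ (Ideal.IsPrime.ne_top inferInstance)] at h1

/-- Over a complete local ring, every endomorphism of `E` is multiplication by a scalar. -/
theorem IsMatlis.exists_eq_smul [IsAdicComplete (maximalIdeal A) A] (θ : E →ₗ[A] E) :
    ∃ a : A, ∀ e, θ e = a • e := by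
  have key (n : ℕ) : ∃ a : A, ∀ e : E, (∀ b ∈ maximalIdeal A ^ n, b • e = 0) → θ e = a • e := by
    obtain ⟨y, hy⟩ := hE.eval_surjective (isFiniteLength_quotient_pow A n)
      (θ ∘ₗ LinearMap.applyₗ 1)
    obtain ⟨a, rfl⟩ := Ideal.Quotient.mk_surjective y
    refine ⟨a, fun e he => ?_⟩
    have := hy ((maximalIdeal A ^ n).liftQ (LinearMap.toSpanSingleton A E e) he)
    have h1 : (maximalIdeal A ^ n).liftQ (LinearMap.toSpanSingleton A E e) he 1 = e := by
      change LinearMap.toSpanSingleton A E e 1 = e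
      simp
    change θ ((maximalIdeal A ^ n).liftQ (LinearMap.toSpanSingleton A E e) he 1) = a • e at this
    rwa [h1] at this
  choose a ha using key
  obtain ⟨L, hL⟩ := IsPrecomplete.prec (I := maximalIdeal A) inferInstance (f := a)
    (fun {m n} hmn => by
    rw [SModEq.sub_mem, smul_eq_mul, Ideal.mul_top]
    refine hE.mem_pow m _ fun e he => ?_
    rw [sub_smul, ← ha m e he, ← ha n e fun b hb => he b (Ideal.pow_le_pow_right hmn hb), sub_self])
  refine ⟨L, fun e => ?_⟩
  obtain ⟨t, ht⟩ := hE.tor e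
  have := hL t
  rw [SModEq.sub_mem, smul_eq_mul, Ideal.mul_top] at this
  rw [ha t e ht, ← sub_eq_zero, ← sub_smul, ht _ this]

end Duality
section Cohomology

variable (A : Type) [CommRing A] [IsLocalRing A]

/-- The quotient of `A` by a power of its maximal ideal, as an object of the category. -/
abbrev Qt (t : ℕ) : ModuleCat.{0} A := ModuleCat.of A (A ⧸ maximalIdeal A ^ t)

/-- The projection between two such quotients. -/
def Qπ (s t : ℕ) (h : s ≤ t) : Qt A t ⟶ Qt A s :=
  ModuleCat.ofHom (Submodule.factor (Ideal.pow_le_pow_right h))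

theorem Qπ_self (s : ℕ) : Qπ A s s le_rfl = 𝟙 _ := by
  ext; rfl

theorem Qπ_comp (s t u : ℕ) (h : s ≤ t) (h' : t ≤ u) :
    Qπ A t u h' ≫ Qπ A s t h = Qπ A s u (h.trans h') := by
  ext; rfl

/-- Local cohomology as a direct limit of `Ext` modules. -/
abbrev LH (i : ℕ) (M : ModuleCat.{0} A) : Type :=
  Module.DirectLimit (fun t : ℕ => Abelian.Ext (Qt A t) M i) fun s t h =>
    (Abelian.Ext.mk₀ (Qπ A s t h)).precompOfLinear A M (zero_add i)

instance (i : ℕ) (M : ModuleCat.{0} A) : DirectedSystem (fun t : ℕ => Abelian.Ext (Qt A t) M i)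
    fun s t h => (Abelian.Ext.mk₀ (Qπ A s t h)).precompOfLinear A M (zero_add i) where
  map_self t x := by
    simp [Qπ_self]
  map_map s t u h h' x := by
    simp only [Abelian.Ext.bilinearCompOfLinear_apply_apply]
    rw [Abelian.Ext.mk₀_comp_mk₀_assoc, Qπ_comp]

variable {A}

namespace LH

variable {M N P : ModuleCat.{0} A}

/-- The class of an element of `Ext (A ⧸ 𝔪 ^ t) M i`. -/
noncomputable def of {i : ℕ} (t : ℕ) (x : Abelian.Ext (Qt A t) M i) : LH A i M :=
  Module.DirectLimit.of A ℕ _ _ t x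

theorem exists_of {i : ℕ} (z : LH A i M) : ∃ t x, of t x = z :=
  Module.DirectLimit.exists_of z

theorem of_comp {i s t : ℕ} (h : s ≤ t) (x : Abelian.Ext (Qt A s) M i) :
    of t ((Abelian.Ext.mk₀ (Qπ A s t h)).comp x (zero_add i)) = of s x :=
  Module.DirectLimit.of_f (hij := h)

theorem exists_comp_eq_zero {i t : ℕ} (x : Abelian.Ext (Qt A t) M i) (h : of t x = 0) :
    ∃ (u : ℕ) (h : t ≤ u), (Abelian.Ext.mk₀ (Qπ A t u h)).comp x (zero_add i) = 0 :=
  Module.DirectLimit.of.zero_exact h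

@[simp]
theorem of_zero {i : ℕ} (t : ℕ) : of t (0 : Abelian.Ext (Qt A t) M i) = 0 := map_zero _

/-- The map induced by composition with an extension class. -/
noncomputable def post {i n j : ℕ} (β : Abelian.Ext M N n) (h : i + n = j) :
    LH A i M →ₗ[A] LH A j N :=
  Module.DirectLimit.map (fun t => β.postcompOfLinear A (Qt A t) h) fun s t hst => by
    ext x
    simp only [LinearMap.comp_apply, LinearMap.flip_apply,
      Abelian.Ext.bilinearCompOfLinear_apply_apply]
    rw [Abelian.Ext.comp_assoc]
    lia

@[simp]
theorem post_of {i n j : ℕ} (β : Abelian.Ext M N n) (h : i + n = j) (t : ℕ)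
    (x : Abelian.Ext (Qt A t) M i) : post β h (of t x) = of t (x.comp β h) :=
  Module.DirectLimit.map_apply_of _ _ _

/-- The map induced by a linear map. -/
noncomputable def map (i : ℕ) (f : M ⟶ N) : LH A i M →ₗ[A] LH A i N :=
  post (Abelian.Ext.mk₀ f) (add_zero i)

@[simp]
theorem map_of {i t : ℕ} (f : M ⟶ N) (x : Abelian.Ext (Qt A t) M i) :
    map i f (of t x) = of t (x.comp (Abelian.Ext.mk₀ f) (add_zero i)) := post_of _ _ _ _

theorem map_comp (i : ℕ) (f : M ⟶ N) (g : N ⟶ P) (z : LH A i M) :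
    map i (f ≫ g) z = map i g (map i f z) := by
  obtain ⟨t, x, rfl⟩ := exists_of z
  simp

theorem map_id (i : ℕ) (z : LH A i M) : map i (𝟙 M) z = z := by
  obtain ⟨t, x, rfl⟩ := exists_of z
  simp

theorem map_zero_hom (i : ℕ) (z : LH A i M) : map i (0 : M ⟶ N) z = 0 := by
  obtain ⟨t, x, rfl⟩ := exists_of z
  simp

theorem map_smul_hom (i : ℕ) (a : A) (f : M ⟶ N) (z : LH A i M) :
    map i (a • f) z = a • map i f z := by
  obtain ⟨t, x, rfl⟩ := exists_of z
  simp only [map_of, Abelian.Ext.mk₀_smul, Abelian.Ext.comp_smul]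
  exact LinearMap.map_smul _ _ _

variable {S : ShortComplex (ModuleCat.{0} A)} (hS : S.ShortExact)

/-- The connecting map. -/
noncomputable def δ (i : ℕ) : LH A i S.X₃ →ₗ[A] LH A (i + 1) S.X₁ := post hS.extClass rfl

include hS in
theorem exact₂ (i : ℕ) : Function.Exact (map i S.f) (map i S.g) := fun z => by
  constructor
  · intro h
    obtain ⟨t, x, rfl⟩ := exists_of z
    rw [map_of] at h
    obtain ⟨u, hu, h⟩ := exists_comp_eq_zero _ h
    obtain ⟨y, hy⟩ := Abelian.Ext.covariant_sequence_exact₂ _ hS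
      ((Abelian.Ext.mk₀ (Qπ A t u hu)).comp x (zero_add i)) (by
        rw [← h, Abelian.Ext.comp_assoc]; lia)
    exact ⟨of u y, by rw [map_of, hy, of_comp]⟩
  · rintro ⟨y, rfl⟩
    rw [← map_comp, S.zero, map_zero_hom]

theorem exact₃ (i : ℕ) : Function.Exact (map i S.g) (δ hS i) := fun z => by
  constructor
  · intro h
    obtain ⟨t, x, rfl⟩ := exists_of z
    rw [δ, post_of] at h
    obtain ⟨u, hu, h⟩ := exists_comp_eq_zero _ h
    obtain ⟨y, hy⟩ := Abelian.Ext.covariant_sequence_exact₃ _ hS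
      ((Abelian.Ext.mk₀ (Qπ A t u hu)).comp x (zero_add i)) rfl (by
        rw [← h, Abelian.Ext.comp_assoc]; lia)
    exact ⟨of u y, by rw [map_of, hy, of_comp]⟩
  · rintro ⟨y, rfl⟩
    obtain ⟨t, x, rfl⟩ := exists_of y
    simp [δ]

theorem exact₁ (i : ℕ) : Function.Exact (δ hS i) (map (i + 1) S.f) := fun z => by
  constructor
  · intro h
    obtain ⟨t, x, rfl⟩ := exists_of z
    rw [map_of] at h
    obtain ⟨u, hu, h⟩ := exists_comp_eq_zero _ h
    obtain ⟨y, hy⟩ := Abelian.Ext.covariant_sequence_exact₁ _ hS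
      ((Abelian.Ext.mk₀ (Qπ A t u hu)).comp x (zero_add _)) (by
        rw [← h, Abelian.Ext.comp_assoc]; lia) rfl
    exact ⟨of u y, by rw [δ, post_of, hy, of_comp]⟩
  · rintro ⟨y, rfl⟩
    obtain ⟨t, x, rfl⟩ := exists_of y
    simp [δ]

theorem isTor (i : ℕ) : IsTor A (LH A i M) := fun z => by
  obtain ⟨t, x, rfl⟩ := exists_of z
  refine ⟨t, fun a ha => ?_⟩
  have h0 : a • 𝟙 (Qt A t) = 0 := by
    ext1
    refine LinearMap.ext fun y => ?_
    obtain ⟨b, rfl⟩ := Ideal.Quotient.mk_surjective y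
    change a • Ideal.Quotient.mk (maximalIdeal A ^ t) b = 0
    rw [← Ideal.Quotient.mk_eq_mk, ← Submodule.Quotient.mk_smul, Ideal.Quotient.mk_eq_mk,
      Ideal.Quotient.eq_zero_iff_mem, smul_eq_mul]
    exact Ideal.mul_mem_right _ _ ha
  have h1 : a • x = 0 := by
    rw [← Abelian.Ext.mk₀_id_comp x, ← Abelian.Ext.smul_comp, ← Abelian.Ext.mk₀_smul, h0,
      Abelian.Ext.mk₀_zero, Abelian.Ext.zero_comp]
  rw [of, ← LinearMap.map_smul, h1, LinearMap.map_zero]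

theorem subsingleton_of_injective (i : ℕ) [Injective M] : Subsingleton (LH A (i + 1) M) :=
  subsingleton_of_forall_eq 0 fun z => by
    obtain ⟨t, x, rfl⟩ := exists_of z
    rw [Abelian.Ext.eq_zero_of_injective x, of_zero]

end LH

end Cohomology
section CohomologyModules

variable {A : Type} [CommRing A] [IsLocalRing A]
  {M N P : Type} [AddCommGroup M] [Module A M] [AddCommGroup N] [Module A N]
  [AddCommGroup P] [Module A P]

variable (A) in
/-- Local cohomology of an unbundled module. -/
abbrev Hm (i : ℕ) (M : Type) [AddCommGroup M] [Module A M] : Type := LH A i (ModuleCat.of A M)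

/-- The map on local cohomology induced by a linear map. -/
noncomputable abbrev hmap (i : ℕ) (f : M →ₗ[A] N) : Hm A i M →ₗ[A] Hm A i N :=
  LH.map i (ModuleCat.ofHom f)

theorem hmap_comp (i : ℕ) (f : M →ₗ[A] N) (g : N →ₗ[A] P) :
    hmap i (g ∘ₗ f) = hmap i g ∘ₗ hmap i f :=
  LinearMap.ext fun z => by
    rw [hmap, ModuleCat.ofHom_comp, LH.map_comp]; rfl

theorem hmap_id (i : ℕ) : hmap i (LinearMap.id : M →ₗ[A] M) = LinearMap.id :=
  LinearMap.ext fun z => LH.map_id i z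

theorem hmap_lsmul (i : ℕ) (a : A) : hmap i (LinearMap.lsmul A M a) = LinearMap.lsmul A _ a :=
  LinearMap.ext fun z => by
    have := LH.map_smul_hom i a (𝟙 (ModuleCat.of A M)) z
    rw [LH.map_id] at this
    exact this

/-- Linear equivalences induce linear equivalences. -/
noncomputable def hcongr (i : ℕ) (e : M ≃ₗ[A] N) : Hm A i M ≃ₗ[A] Hm A i N :=
  LinearEquiv.ofLinearMap (hmap i e.toLinearMap) (hmap i e.symm.toLinearMap)
    (by rw [← hmap_comp]; simp [hmap_id]) (by rw [← hmap_comp]; simp [hmap_id])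

omit [IsLocalRing A] in
theorem shortExact_mk (f : M →ₗ[A] N) (g : N →ₗ[A] P) (hf : Function.Injective f)
    (hg : Function.Surjective g) (h : Function.Exact f g) :
    (ShortComplex.mk (ModuleCat.ofHom f) (ModuleCat.ofHom g) (by
      ext x; exact h.apply_apply_eq_zero x)).ShortExact where
  exact := by
    rw [ShortComplex.moduleCat_exact_iff]
    exact fun x hx => (h x).mp hx
  mono_f := (ModuleCat.mono_iff_injective _).mpr hf
  epi_g := (ModuleCat.epi_iff_surjective _).mpr hg

theorem hmap_exact (f : M →ₗ[A] N) (g : N →ₗ[A] P) (hf : Function.Injective f)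
    (hg : Function.Surjective g) (h : Function.Exact f g) (i : ℕ) :
    Function.Exact (hmap i f) (hmap i g) :=
  LH.exact₂ (shortExact_mk f g hf hg h) i

theorem exists_δ (f : M →ₗ[A] N) (g : N →ₗ[A] P) (hf : Function.Injective f)
    (hg : Function.Surjective g) (h : Function.Exact f g) (i : ℕ) :
    ∃ δ : Hm A i P →ₗ[A] Hm A (i + 1) M, Function.Exact (hmap i g) δ ∧
      Function.Exact δ (hmap (i + 1) f) := by
  have hS := shortExact_mk f g hf hg h
  have h₃ := LH.exact₃ hS i
  have h₁ := LH.exact₁ hS i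
  generalize LH.δ hS i = δ at h₃ h₁
  dsimp only at δ h₃ h₁
  refine ⟨δ, ?_, ?_⟩
  · exact h₃
  · exact h₁

variable (A M) in
/-- The embedding of degree zero local cohomology. -/
noncomputable def hzero : Hm A 0 M →ₗ[A] M :=
  Module.DirectLimit.lift A ℕ _ _ (fun t =>
    LinearMap.applyₗ (Ideal.Quotient.mk (maximalIdeal A ^ t) 1) ∘ₗ
      (ModuleCat.homLinearEquiv (S := A)).toLinearMap ∘ₗ
      (Abelian.Ext.linearEquiv₀ (R := A)).toLinearMap) fun s t h x => by
    obtain ⟨f, rfl⟩ := (Abelian.Ext.mk₀_bijective _ _).2 x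
    rw [Abelian.Ext.bilinearCompOfLinear_apply_apply, Abelian.Ext.mk₀_comp_mk₀]
    simp only [LinearMap.comp_apply, LinearEquiv.coe_coe,
      ← Abelian.Ext.linearEquiv₀_symm_apply (R := A), LinearEquiv.apply_symm_apply]
    rfl

theorem hzero_of {t : ℕ} (f : Qt A t ⟶ ModuleCat.of A M) :
    hzero A M (LH.of t (Abelian.Ext.mk₀ f)) = f.hom (Ideal.Quotient.mk (maximalIdeal A ^ t) 1) := by
  rw [hzero, LH.of, Module.DirectLimit.lift_of]
  simp only [LinearMap.comp_apply, LinearEquiv.coe_coe,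
      ← Abelian.Ext.linearEquiv₀_symm_apply (R := A), LinearEquiv.apply_symm_apply]
  rfl

end CohomologyModules
section Vanishing

variable {A : Type} [CommRing A] [IsLocalRing A]
  {M N P : Type} [AddCommGroup M] [Module A M] [AddCommGroup N] [Module A N]
  [AddCommGroup P] [Module A P]

theorem exists_of_mk₀ (z : Hm A 0 M) :
    ∃ (t : ℕ) (f : Qt A t ⟶ ModuleCat.of A M), LH.of t (Abelian.Ext.mk₀ f) = z := by
  obtain ⟨t, x, rfl⟩ := LH.exists_of z
  obtain ⟨f, rfl⟩ := (Abelian.Ext.mk₀_bijective _ _).2 x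
  exact ⟨t, f, rfl⟩

theorem hzero_hmap (f : M →ₗ[A] N) (z : Hm A 0 M) :
    hzero A N (hmap 0 f z) = f (hzero A M z) := by
  obtain ⟨t, g, rfl⟩ := exists_of_mk₀ z
  rw [hmap, LH.map_of, Abelian.Ext.mk₀_comp_mk₀, hzero_of, hzero_of]
  rfl

theorem hzero_injective : Function.Injective (hzero A M) := by
  rw [injective_iff_map_eq_zero]
  intro z hz
  obtain ⟨t, g, rfl⟩ := exists_of_mk₀ z
  rw [hzero_of] at hz
  have : g = 0 := by
    ext1
    refine LinearMap.ext fun y => ?_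
    obtain ⟨b, rfl⟩ := Ideal.Quotient.mk_surjective y
    have : Ideal.Quotient.mk (maximalIdeal A ^ t) b =
        b • Ideal.Quotient.mk (maximalIdeal A ^ t) 1 := by
      rw [map_one, Algebra.smul_def, mul_one, Ideal.Quotient.algebraMap_eq]
    rw [this, LinearMap.map_smul, hz, smul_zero]
    rfl
  rw [this, Abelian.Ext.mk₀_zero, LH.of_zero]

theorem mem_range_hzero {m : M} (hm : m ∈ Gam A M) : ∃ z, hzero A M z = m := by
  obtain ⟨t, ht⟩ := hm
  refine ⟨LH.of t (Abelian.Ext.mk₀ (ModuleCat.ofHom ((maximalIdeal A ^ t).liftQ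
    (LinearMap.toSpanSingleton A M m) ht))), ?_⟩
  rw [hzero_of]
  change LinearMap.toSpanSingleton A M m 1 = m
  simp

theorem hzero_mem_Gam (z : Hm A 0 M) : hzero A M z ∈ Gam A M := by
  obtain ⟨t, ht⟩ := LH.isTor 0 z
  exact ⟨t, fun a ha => by rw [← map_smul, ht a ha, map_zero]⟩

theorem hzero_subsingleton (h : Gam A M = ⊥) : Subsingleton (Hm A 0 M) :=
  subsingleton_of_forall_eq 0 fun z => hzero_injective (by
    have := hzero_mem_Gam z
    rw [h, Submodule.mem_bot] at this
    rw [this, map_zero])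

theorem IsTor.hzero_surjective (h : IsTor A M) : Function.Surjective (hzero A M) := fun m =>
  mem_range_hzero (h m)

theorem IsTor.hmap_zero_surjective (h : IsTor A N) (f : N →ₗ[A] P) (hf : Function.Surjective f) :
    Function.Surjective (hmap 0 f) := fun z => by
  obtain ⟨n, hn⟩ := hf (hzero A P z)
  obtain ⟨w, rfl⟩ := h.hzero_surjective n
  exact ⟨w, hzero_injective (by rw [hzero_hmap, hn])⟩

omit [IsLocalRing A] in
theorem subsingleton_of_exact {f : M →ₗ[A] N} {g : N →ₗ[A] P} (h : Function.Exact f g)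
    [Subsingleton M] [Subsingleton P] : Subsingleton N :=
  subsingleton_of_forall_eq 0 fun n => by
    obtain ⟨m, rfl⟩ := (h n).mp (Subsingleton.elim _ _)
    rw [Subsingleton.elim m 0, map_zero]

theorem hm_subsingleton_of_injective (i : ℕ) [Module.Injective A M] :
    Subsingleton (Hm A (i + 1) M) := by
  have : Injective (ModuleCat.of A M) := Module.injective_object_of_injective_module A M
  exact LH.subsingleton_of_injective i

variable [IsNoetherianRing A]

theorem IsTor.hm_subsingleton (i : ℕ) : ∀ {M : Type} [AddCommGroup M] [Module A M],
    IsTor A M → Subsingleton (Hm A (i + 1) M) := by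
  induction i with
  | zero =>
    intro M _ _ h
    obtain ⟨J, _, _, f, hJ, hf⟩ := exists_injective_embedding A M
    have hG := injective_Gam (A := A) J
    let g : M →ₗ[A] Gam A J := LinearMap.codRestrict _ f fun m => by
      obtain ⟨t, ht⟩ := h m
      exact ⟨t, fun a ha => by rw [← map_smul, ht a ha, map_zero]⟩
    have hg : Function.Injective g := fun x y hxy => hf (congrArg Subtype.val hxy)
    obtain ⟨δ, h₃, h₁⟩ := exists_δ g g.range.mkQ hg g.range.mkQ_surjective
      (by rw [LinearMap.exact_iff]; simp) 0
    have := hm_subsingleton_of_injective (A := A) (M := Gam A J) 0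
    refine subsingleton_of_forall_eq 0 fun z => ?_
    obtain ⟨y, rfl⟩ := (h₁ z).mp (Subsingleton.elim _ _)
    exact (h₃ y).mpr (isTor_Gam.hmap_zero_surjective _ g.range.mkQ_surjective y)
  | succ i ih =>
    intro M _ _ h
    obtain ⟨J, _, _, f, hJ, hf⟩ := exists_injective_embedding A M
    have hG := injective_Gam (A := A) J
    let g : M →ₗ[A] Gam A J := LinearMap.codRestrict _ f fun m => by
      obtain ⟨t, ht⟩ := h m
      exact ⟨t, fun a ha => by rw [← map_smul, ht a ha, map_zero]⟩
    have hg : Function.Injective g := fun x y hxy => hf (congrArg Subtype.val hxy)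
    obtain ⟨δ, h₃, h₁⟩ := exists_δ g g.range.mkQ hg g.range.mkQ_surjective
      (by rw [LinearMap.exact_iff]; simp) (i + 1)
    have := hm_subsingleton_of_injective (A := A) (M := Gam A J) (i + 1)
    have := ih (isTor_Gam.of_surjective _ g.range.mkQ_surjective)
    exact subsingleton_of_exact h₁

omit [IsNoetherianRing A] in
theorem IsTor.exists_pow (h : IsTor A M) [Module.Finite A M] :
    ∃ t : ℕ, ∀ a ∈ maximalIdeal A ^ t, ∀ m : M, a • m = 0 := by
  obtain ⟨s, hs⟩ := Module.Finite.fg_top (R := A) (M := M)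
  choose t ht using h
  refine ⟨∑ m ∈ s, t m, fun a ha m => ?_⟩
  have hm : m ∈ Submodule.span A (s : Set M) := hs ▸ Submodule.mem_top
  induction hm using Submodule.span_induction with
  | mem x hx => exact ht x a (Ideal.pow_le_pow_right
      (Finset.single_le_sum (f := t) (fun _ _ => Nat.zero_le _) hx) ha)
  | zero => exact smul_zero a
  | add x y _ _ hx hy => rw [smul_add, hx, hy, add_zero]
  | smul c x _ hx => rw [smul_comm, hx, smul_zero]

theorem Gam_quotient : Gam A (M ⧸ Gam A M) = ⊥ := by
  rw [eq_bot_iff]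
  rintro y ⟨t, ht⟩
  obtain ⟨m, rfl⟩ := Submodule.mkQ_surjective _ y
  let L := (maximalIdeal A ^ t) • Submodule.span A {m}
  have hL : L ≤ Gam A M := Submodule.smul_le.mpr fun a ha n hn => by
    obtain ⟨c, rfl⟩ := Submodule.mem_span_singleton.mp hn
    have := ht a ha
    rw [← map_smul, Submodule.mkQ_apply, Submodule.Quotient.mk_eq_zero] at this
    rw [smul_comm]
    exact Submodule.smul_mem _ _ this
  have : Module.Finite A L := Module.Finite.iff_fg.mpr
    (Submodule.FG.smul (IsNoetherian.noetherian _) (Submodule.fg_span_singleton m))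
  obtain ⟨s, hs⟩ := (isTor_Gam.of_injective (Submodule.inclusion hL)
    (Submodule.inclusion_injective hL)).exists_pow
  rw [Submodule.mem_bot, Submodule.mkQ_apply, Submodule.Quotient.mk_eq_zero]
  refine ⟨s + t, fun a ha => ?_⟩
  rw [pow_add] at ha
  refine Submodule.mul_induction_on ha (fun b hb c hc => ?_) fun b c hb hc => ?_
  · have := hs b hb ⟨c • m, Submodule.smul_mem_smul hc (Submodule.mem_span_singleton_self m)⟩
    rw [mul_smul]
    exact congrArg Subtype.val this
  · rw [add_smul, hb, hc, add_zero]

/-- Killing the torsion does not change higher local cohomology. -/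
theorem hmap_mkQ_injective (i : ℕ) : Function.Injective (hmap (i + 1) (Gam A M).mkQ) := by
  have hex := hmap_exact (Gam A M).subtype (Gam A M).mkQ (Submodule.injective_subtype _)
    (Submodule.mkQ_surjective _) (by rw [LinearMap.exact_iff]; simp) (i + 1)
  have := (isTor_Gam (A := A) (M := M)).hm_subsingleton i
  rw [injective_iff_map_eq_zero]
  intro z hz
  obtain ⟨y, rfl⟩ := (hex z).mp hz
  rw [Subsingleton.elim y 0, map_zero]

omit [IsLocalRing A] [IsNoetherianRing A] in
theorem exact_mkQ_quotSMulTop (x : A) : Function.Exact (LinearMap.lsmul A M x)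
    (Submodule.mkQ (x • (⊤ : Submodule A M))) := fun m => by
  rw [Submodule.mkQ_apply, Submodule.Quotient.mk_eq_zero, Submodule.mem_smul_pointwise_iff_exists]
  simp [Set.mem_range]

omit [IsNoetherianRing A] in
/-- Multiplication by a regular element gives an exact sequence in local cohomology. -/
theorem exists_δ_quotSMulTop (x : A) (hx : IsSMulRegular M x) (i : ℕ) :
    ∃ δ : Hm A i (QuotSMulTop x M) →ₗ[A] Hm A (i + 1) M,
      Function.Exact (hmap i (Submodule.mkQ (x • (⊤ : Submodule A M)))) δ ∧
      Function.Exact δ (LinearMap.lsmul A (Hm A (i + 1) M) x) := by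
  obtain ⟨δ, h₃, h₁⟩ := exists_δ (LinearMap.lsmul A M x) (Submodule.mkQ (x • (⊤ : Submodule A M)))
    hx (Submodule.mkQ_surjective _) (exact_mkQ_quotSMulTop x) i
  rw [hmap_lsmul] at h₁
  exact ⟨δ, h₃, h₁⟩

omit [IsNoetherianRing A] in
theorem IsTor.subsingleton_of_regular (h : IsTor A M) (x : A) (hx : x ∈ maximalIdeal A)
    (hreg : IsSMulRegular M x) : Subsingleton M :=
  subsingleton_of_forall_eq 0 fun m => by
    obtain ⟨t, ht⟩ := h m
    exact (hreg.pow t) (by simp [ht _ (Ideal.pow_mem_pow hx t)])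

end Vanishing
section Dimension

variable {A : Type} [CommRing A]
  {M N : Type} [AddCommGroup M] [Module A M] [AddCommGroup N] [Module A N]

/-- The dimension of the support of `M` is at most `e`. -/
def DimLE (A : Type) [CommRing A] (M : Type) [AddCommGroup M] [Module A M] (e : ℕ) : Prop :=
  ∀ p : PrimeSpectrum A, Module.annihilator A M ≤ p.asIdeal → Order.coheight p ≤ e

theorem DimLE.of_le {e : ℕ} (h : DimLE A M e)
    (hMN : Module.annihilator A M ≤ Module.annihilator A N) : DimLE A N e :=
  fun p hp => h p (hMN.trans hp)

theorem DimLE.of_surjective {e : ℕ} (h : DimLE A M e) (f : M →ₗ[A] N)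
    (hf : Function.Surjective f) : DimLE A N e :=
  h.of_le (f.annihilator_le_of_surjective hf)

theorem DimLE.of_injective {e : ℕ} (h : DimLE A M e) (f : N →ₗ[A] M)
    (hf : Function.Injective f) : DimLE A N e :=
  h.of_le (f.annihilator_le_of_injective hf)

theorem DimLE.quotSMulTop' {e : ℕ} (h : DimLE A M (e + 1)) (x : A)
    (hx : ∀ p : PrimeSpectrum A, Module.annihilator A M ≤ p.asIdeal →
      Order.coheight p = (e + 1 : ℕ) → x ∉ p.asIdeal) :
    DimLE A (QuotSMulTop x M) e := fun p hp => by
  have hxp : x ∈ p.asIdeal := hp (Module.mem_annihilator.mpr fun y => by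
    obtain ⟨m, rfl⟩ := Submodule.mkQ_surjective _ y
    rw [← map_smul, Submodule.mkQ_apply, Submodule.Quotient.mk_eq_zero]
    exact Submodule.smul_mem_pointwise_smul _ _ _ trivial)
  have hMp := (LinearMap.annihilator_le_of_surjective _
    (Submodule.mkQ_surjective (x • (⊤ : Submodule A M)))).trans hp
  have h1 := h p hMp
  have h2 : Order.coheight p ≠ (e + 1 : ℕ) := fun h' => hx p hMp h' hxp
  exact Order.le_of_lt_add_one (lt_of_le_of_ne h1 h2)

theorem mem_minimalPrimes_of_coheight {I : Ideal A} {e : ℕ}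
    (h : ∀ p : PrimeSpectrum A, I ≤ p.asIdeal → Order.coheight p ≤ e) (p : PrimeSpectrum A)
    (hp : I ≤ p.asIdeal) (hpe : Order.coheight p = e) : p.asIdeal ∈ I.minimalPrimes := by
  refine ⟨⟨p.2, hp⟩, fun q ⟨hq, hIq⟩ hqp => ?_⟩
  by_contra hne
  have h1 : (⟨q, hq⟩ : PrimeSpectrum A) < p := lt_of_le_not_ge hqp hne
  have h2 := Order.coheight_add_one_le h1
  have h3 := h2.trans (h ⟨q, hq⟩ hIq)
  rw [hpe] at h3
  exact absurd (by exact_mod_cast h3 : e + 1 ≤ e) (by omega)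

variable [IsNoetherianRing A]

theorem DimLE.quotSMulTop [Module.Finite A M] {e : ℕ} (h : DimLE A M (e + 1)) (x : A)
    (hx : ∀ p, IsAssociatedPrime p M → x ∉ p) : DimLE A (QuotSMulTop x M) e :=
  h.quotSMulTop' x fun p hp hpe => hx _
    (Module.associatedPrimes.minimalPrimes_annihilator_subset_associatedPrimes A M
      (mem_minimalPrimes_of_coheight h p hp hpe))

variable [IsLocalRing A]

theorem DimLE.isTor [Module.Finite A M] (h : DimLE A M 0) : IsTor A M := by
  have h1 : maximalIdeal A ≤ (Module.annihilator A M).radical := by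
    rw [Ideal.radical_eq_sInf]
    refine le_sInf fun p ⟨hp, hpp⟩ => ?_
    have h2 : IsMax (⟨p, hpp⟩ : PrimeSpectrum A) :=
      Order.coheight_eq_zero.mp (nonpos_iff_eq_zero.mp (by exact_mod_cast h ⟨p, hpp⟩ hp))
    exact h2 (b := ⟨maximalIdeal A, inferInstance⟩) (le_maximalIdeal hpp.ne_top)
  obtain ⟨t, ht⟩ := Ideal.exists_pow_le_of_le_radical_of_fg h1 (IsNoetherian.noetherian _)
  exact fun m => ⟨t, fun a ha => Module.mem_annihilator.mp (ht ha) m⟩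

theorem exists_regular [Module.Finite A M] (h : Gam A M = ⊥) (S : Set (Ideal A)) (hS : S.Finite)
    (hp : ∀ p ∈ S, p.IsPrime) (hSm : ∀ p ∈ S, ¬ maximalIdeal A ≤ p) :
    ∃ x ∈ maximalIdeal A, IsSMulRegular M x ∧ (∀ p, IsAssociatedPrime p M → x ∉ p) ∧
      ∀ p ∈ S, x ∉ p := by
  obtain ⟨x, hx, hxS⟩ := exists_mem_notMem_of_finite (maximalIdeal A) (S ∪ associatedPrimes A M)
    (hS.union (associatedPrimes.finite A M)) (fun p hpS => hpS.elim (hp p) fun h => h.isPrime)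
    (fun p hpS => hpS.elim (hSm p) fun hass hle => by
      obtain ⟨hpp, m, hm⟩ := isAssociatedPrime_iff.mp hass
      have hm0 : m ∈ Gam A M := ⟨1, fun a ha => by
        rw [pow_one] at ha
        have := hle ha
        rwa [hm, Submodule.mem_colon_singleton, Submodule.mem_bot] at this⟩
      rw [h, Submodule.mem_bot] at hm0
      refine hpp.ne_top ((Ideal.eq_top_iff_one _).mpr ?_)
      rw [hm, Submodule.mem_colon_singleton, hm0]
      simp)
  refine ⟨x, hx, ?_, fun p hp => hxS p (Or.inr hp), fun p hp => hxS p (Or.inl hp)⟩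
  exact IsSMulRegular.of_right_eq_zero_of_smul fun m hm =>
    eq_zero_of_smul_eq_zero (fun p hp => hxS p (Or.inr hp)) hm

/-- Grothendieck vanishing above the dimension. -/
theorem DimLE.hm_subsingleton (e : ℕ) : ∀ {M : Type} [AddCommGroup M] [Module A M]
    [Module.Finite A M], DimLE A M e → ∀ i, e < i → Subsingleton (Hm A i M) := by
  induction e with
  | zero =>
    intro M _ _ _ h i hi
    obtain ⟨i, rfl⟩ := Nat.exists_eq_succ_of_ne_zero hi.ne'
    exact h.isTor.hm_subsingleton i
  | succ e ih =>
    intro M _ _ _ h i hi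
    obtain ⟨i, rfl⟩ := Nat.exists_eq_succ_of_ne_zero (Nat.ne_zero_of_lt hi)
    have h' : DimLE A (M ⧸ Gam A M) (e + 1) := h.of_surjective _ (Submodule.mkQ_surjective _)
    obtain ⟨x, hx, hreg, hass, -⟩ := exists_regular (Gam_quotient (A := A) (M := M)) ∅
      Set.finite_empty (by simp) (by simp)
    have hq := ih (h'.quotSMulTop x hass) i (by omega)
    obtain ⟨δ, -, h₁⟩ := exists_δ_quotSMulTop x hreg i
    have : Subsingleton (Hm A (i + 1) (M ⧸ Gam A M)) :=
      (LH.isTor _).subsingleton_of_regular x hx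
        (IsSMulRegular.of_right_eq_zero_of_smul fun m hm => by
          obtain ⟨y, rfl⟩ := (h₁ m).mp hm
          rw [Subsingleton.elim y 0, map_zero])
    exact (hmap_mkQ_injective i).subsingleton

end Dimension
section Finiteness

variable {A : Type} [CommRing A]

theorem mem_smul_top_pi {r : ℕ} (J : Ideal A) (f : Fin r → A) :
    f ∈ J • (⊤ : Submodule A (Fin r → A)) ↔ ∀ i, f i ∈ J := by
  constructor
  · intro h i
    have h1 := Submodule.mem_map_of_mem (f := LinearMap.proj (R := A) (φ := fun _ : Fin r => A) i) h
    rw [Submodule.map_smul''] at h1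
    have h2 := Submodule.smul_mono (le_refl J) le_top h1
    rwa [smul_eq_mul, Ideal.mul_top] at h2
  · intro h
    rw [pi_eq_sum_univ' f]
    exact Submodule.sum_mem _ fun i _ => Submodule.smul_mem_smul (h i) trivial

theorem isPrecomplete_pi (J : Ideal A) [IsPrecomplete J A] (r : ℕ) :
    IsPrecomplete J (Fin r → A) where
  prec' f hf := by
    have key (i : Fin r) : ∃ L, ∀ n, f n i ≡ L [SMOD (J ^ n • ⊤ : Submodule A A)] :=
      IsPrecomplete.prec (I := J) inferInstance fun {m n} hmn => by
        have := hf hmn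
        rw [SModEq.sub_mem, mem_smul_top_pi] at this
        rw [SModEq.sub_mem, smul_eq_mul, Ideal.mul_top]
        exact this i
    choose L hL using key
    refine ⟨L, fun n => ?_⟩
    rw [SModEq.sub_mem, mem_smul_top_pi]
    intro i
    have := hL i n
    rwa [SModEq.sub_mem, smul_eq_mul, Ideal.mul_top] at this

theorem smul_top_le {M : Type} [AddCommGroup M] [Module A M] {J : Ideal A} {x : A} (hx : x ∈ J) :
    x • (⊤ : Submodule A M) ≤ J • ⊤ := fun y hy => by
  obtain ⟨z, -, rfl⟩ := (Submodule.mem_smul_pointwise_iff_exists _ _ _).mp hy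
  exact Submodule.smul_mem_smul hx trivial

variable [IsLocalRing A] {E : Type} [AddCommGroup E] [Module A E]
  {M N P : Type} [AddCommGroup M] [Module A M] [AddCommGroup N] [Module A N]
  [AddCommGroup P] [Module A P]

theorem IsTor.isHausdorff_dual (hN : IsTor A N) :
    IsHausdorff (maximalIdeal A) (N →ₗ[A] E) where
  haus' φ hφ := LinearMap.ext fun n => by
    obtain ⟨t, ht⟩ := hN n
    have := hφ t
    rw [SModEq.zero] at this
    refine Submodule.smul_induction_on this (fun a ha ψ _ => ?_) fun ψ χ h₁ h₂ => ?_
    · rw [LinearMap.smul_apply, ← map_smul, ht a ha, map_zero]; rfl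
    · rw [LinearMap.add_apply, h₁, h₂, LinearMap.zero_apply, add_zero]

/-- Completeness: a dual generated modulo the maximal ideal is finitely generated. -/
theorem IsTor.finite_dual [IsPrecomplete (maximalIdeal A) A] (hN : IsTor A N)
    (G : Submodule A (N →ₗ[A] E)) (hG : G.FG) (h : ⊤ ≤ G ⊔ maximalIdeal A • ⊤) :
    Module.Finite A (N →ₗ[A] E) := by
  have := hN.isHausdorff_dual (E := E)
  obtain ⟨r, s, hs⟩ := Submodule.fg_iff_exists_fin_generating_family.mp hG
  have := isPrecomplete_pi (maximalIdeal A) r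
  refine Module.Finite.of_surjective (Fintype.linearCombination A s)
    (surjective_of_mkQ_comp_surjective (I := maximalIdeal A) fun y => ?_)
  obtain ⟨φ, rfl⟩ := Submodule.mkQ_surjective _ y
  obtain ⟨g, hg, ψ, hψ, rfl⟩ := Submodule.mem_sup.mp (h (show φ ∈ ⊤ from trivial))
  rw [← hs, ← Fintype.range_linearCombination] at hg
  obtain ⟨a, rfl⟩ := hg
  refine ⟨a, ?_⟩
  rw [LinearMap.comp_apply, map_add, Submodule.mkQ_apply _ ψ,
    (Submodule.Quotient.mk_eq_zero _).mpr hψ, add_zero]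

/-- The dual of the connecting map: `K ^ (i + 1) / x` embeds in the dual of `H ^ i (M / x)`. -/
theorem exists_dual_δ (hE : Module.Injective A E) (x : A) (hx : IsSMulRegular M x) (i : ℕ) :
    ∃ ψ : (Hm A (i + 1) M →ₗ[A] E) →ₗ[A] (Hm A i (QuotSMulTop x M) →ₗ[A] E),
      LinearMap.ker ψ = x • ⊤ := by
  obtain ⟨δ, -, h₁⟩ := exists_δ_quotSMulTop x hx i
  refine ⟨LinearMap.lcomp A E δ, ?_⟩
  have := lcomp_exact hE _ _ h₁
  rw [LinearMap.exact_iff] at this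
  rw [this]
  ext φ
  rw [Submodule.mem_smul_pointwise_iff_exists]
  constructor
  · rintro ⟨χ, rfl⟩
    exact ⟨χ, trivial, LinearMap.ext fun z => (map_smul χ x z).symm⟩
  · rintro ⟨χ, -, rfl⟩
    exact ⟨χ, LinearMap.ext fun z => map_smul χ x z⟩

variable [IsNoetherianRing A]

theorem IsTor.isFiniteLength [Module.Finite A N] (h : IsTor A N) : IsFiniteLength A N := by
  obtain ⟨t, ht⟩ := h.exists_pow
  obtain ⟨r, s, hs⟩ := Module.Finite.exists_fin (R := A) (M := N)
  have := (isFiniteLength_iff_isNoetherian_isArtinian.mp (isFiniteLength_quotient_pow A t)).2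
  rw [isFiniteLength_iff_isNoetherian_isArtinian]
  refine ⟨inferInstance, ?_⟩
  let f : (Fin r → A ⧸ maximalIdeal A ^ t) →ₗ[A] N := LinearMap.lsum A _ A fun i =>
    (maximalIdeal A ^ t).liftQ (LinearMap.toSpanSingleton A N (s i)) fun a ha => ht a ha _
  refine isArtinian_of_surjective _ f ?_
  rw [← LinearMap.range_eq_top, eq_top_iff, ← hs, Submodule.span_le]
  rintro _ ⟨i, rfl⟩
  refine ⟨Pi.single i (Ideal.Quotient.mk _ 1), ?_⟩
  simp only [f, LinearMap.lsum_piSingle]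
  change LinearMap.toSpanSingleton A N (s i) 1 = _
  simp

theorem IsMatlis.finite_dual_of_finite (hE : IsMatlis A E) [Module.Finite A N] (h : IsTor A N) :
    Module.Finite A (N →ₗ[A] E) := by
  have h1 : IsFiniteLength A (N →ₗ[A] E) := by
    have h2 := h.isFiniteLength
    rw [← Module.length_ne_top_iff] at h2 ⊢
    exact ne_top_of_le_ne_top h2 (hE.length_dual_le (Module.length_ne_top_iff.mp h2))
  have := (isFiniteLength_iff_isNoetherian_isArtinian.mp h1).1
  infer_instance

theorem IsMatlis.finite_dual_hm [IsPrecomplete (maximalIdeal A) A] (hE : IsMatlis A E) (i : ℕ) :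
    ∀ (M : Type) [AddCommGroup M] [Module A M] [Module.Finite A M],
    Module.Finite A (Hm A i M →ₗ[A] E) := by
  induction i with
  | zero =>
    intro M _ _ _
    have : Module.Finite A (Hm A 0 M) := Module.Finite.of_injective (hzero A M) hzero_injective
    exact hE.finite_dual_of_finite (LH.isTor 0)
  | succ i ih =>
    intro M _ _ _
    obtain ⟨x, hx, hreg, -, -⟩ := exists_regular (Gam_quotient (A := A) (M := M)) ∅
      Set.finite_empty (by simp) (by simp)
    obtain ⟨ψ, hψ⟩ := exists_dual_δ hE.inj x hreg i
    have := ih (QuotSMulTop x (M ⧸ Gam A M))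
    obtain ⟨r, s, hs⟩ := Submodule.fg_iff_exists_fin_generating_family.mp
      (IsNoetherian.noetherian (LinearMap.range ψ))
    have hs' (j : Fin r) : s j ∈ LinearMap.range ψ := hs ▸ Submodule.subset_span ⟨j, rfl⟩
    choose t ht using hs'
    have : Module.Finite A (Hm A (i + 1) (M ⧸ Gam A M) →ₗ[A] E) := by
      refine (LH.isTor _).finite_dual (Submodule.span A (Set.range t))
        (Submodule.fg_span (Set.finite_range t)) fun φ _ => ?_
      have h1 : ψ φ ∈ (Submodule.span A (Set.range t)).map ψ := by
        rw [Submodule.map_span, ← Set.range_comp, show ψ ∘ t = s from funext ht, hs]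
        exact ⟨φ, rfl⟩
      obtain ⟨g, hg, hgφ⟩ := h1
      refine Submodule.mem_sup.mpr ⟨g, hg, φ - g, smul_top_le hx ?_, by module⟩
      rw [← hψ, LinearMap.mem_ker, map_sub, hgφ, sub_self]
    exact Module.Finite.of_surjective _
      (lcomp_surjective hE.inj _ (hmap_mkQ_injective (A := A) (M := M) i))

end Finiteness
section TopDegree

variable {A : Type} [CommRing A] [IsLocalRing A]
  {M N : Type} [AddCommGroup M] [Module A M] [AddCommGroup N] [Module A N]

theorem hmap_add (i : ℕ) (f g : M →ₗ[A] N) : hmap i (f + g) = hmap i f + hmap i g :=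
  LinearMap.ext fun z => by
    rw [hmap, hmap, hmap, ModuleCat.ofHom_add, LinearMap.add_apply]
    obtain ⟨t, x, rfl⟩ := LH.exists_of z
    simp only [LH.map_of, Abelian.Ext.mk₀_add, Abelian.Ext.comp_add]
    exact LinearMap.map_add _ _ _

theorem hmap_zero (i : ℕ) : hmap i (0 : M →ₗ[A] N) = 0 :=
  LinearMap.ext fun z => LH.map_zero_hom i z

theorem hmap_sum {ι : Type*} (s : Finset ι) (i : ℕ) (f : ι → M →ₗ[A] N) :
    hmap i (∑ j ∈ s, f j) = ∑ j ∈ s, hmap i (f j) := by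
  classical
  induction s using Finset.induction_on with
  | empty => simpa using hmap_zero i
  | insert a s has ih => rw [Finset.sum_insert has, Finset.sum_insert has, hmap_add, ih]

theorem smul_hm_eq_zero {a : A} (ha : ∀ m : M, a • m = 0) (i : ℕ) (z : Hm A i M) : a • z = 0 := by
  have h : LinearMap.lsmul A M a = 0 := LinearMap.ext ha
  have h1 := hmap_lsmul (A := A) (M := M) i a
  rw [h, hmap_zero] at h1
  exact (LinearMap.congr_fun h1 z).symm

variable [IsNoetherianRing A]

theorem DimLE.hmap_surjective [Module.Finite A M] {e : ℕ} (h : DimLE A M e) (f : M →ₗ[A] N)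
    (hf : Function.Surjective f) : Function.Surjective (hmap e f) := fun z => by
  obtain ⟨δ, h₁, -⟩ := exists_δ (LinearMap.ker f).subtype f (Submodule.injective_subtype _) hf
    (by rw [LinearMap.exact_iff]; simp) e
  have : Subsingleton (Hm A (e + 1) (LinearMap.ker f)) :=
    (h.of_injective _ (Submodule.injective_subtype _)).hm_subsingleton e _ (by omega)
  exact (h₁ z).mp (Subsingleton.elim _ _)

/-- If the top local cohomology of `M / J M` vanishes then no nonzero functional on the top local
cohomology of `M` is killed by `J`. -/
theorem DimLE.dual_eq_zero [Module.Finite A M] {e : ℕ} (h : DimLE A M e) (J : Ideal A)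
    (hJ : Subsingleton (Hm A e (M ⧸ (J • ⊤ : Submodule A M)))) {E : Type} [AddCommGroup E]
    [Module A E] (φ : Hm A e M →ₗ[A] E) (hφ : ∀ a ∈ J, a • φ = 0) : φ = 0 := by
  obtain ⟨n, a, ha⟩ := Submodule.fg_iff_exists_fin_generating_family.mp (IsNoetherian.noetherian J)
  have haJ (i : Fin n) : a i ∈ J := ha ▸ Submodule.subset_span ⟨i, rfl⟩
  let f : (Fin n → M) →ₗ[A] M := ∑ i, LinearMap.lsmul A M (a i) ∘ₗ LinearMap.proj i
  have hf (v : Fin n → M) : f v = ∑ i, a i • v i := by simp [f, LinearMap.sum_apply]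
  have hrange : LinearMap.range f = J • ⊤ := by
    apply le_antisymm
    · rintro _ ⟨v, rfl⟩
      rw [hf]
      exact Submodule.sum_mem _ fun i _ => Submodule.smul_mem_smul (haJ i) trivial
    · refine Submodule.smul_le.mpr fun b hb m _ => ?_
      rw [← ha, ← Fintype.range_linearCombination] at hb
      obtain ⟨c, rfl⟩ := hb
      refine ⟨fun i => c i • m, ?_⟩
      rw [hf, Fintype.linearCombination_apply, Finset.sum_smul]
      exact Finset.sum_congr rfl fun i _ => by rw [smul_comm, smul_assoc]
  have hd : DimLE A (Fin n → M) e := h.of_le fun b hb => Module.mem_annihilator.mpr fun v =>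
    funext fun i => Module.mem_annihilator.mp hb (v i)
  have h1 := hd.hmap_surjective f.rangeRestrict f.surjective_rangeRestrict
  have hex := hmap_exact (LinearMap.range f).subtype (LinearMap.range f).mkQ
    (Submodule.injective_subtype _) (Submodule.mkQ_surjective _)
    (by rw [LinearMap.exact_iff]; simp) e
  rw [← hrange] at hJ
  have hcomp : hmap e f = hmap e (LinearMap.range f).subtype ∘ₗ hmap e f.rangeRestrict := by
    rw [← hmap_comp]; rfl
  refine LinearMap.ext fun z => ?_
  obtain ⟨y, rfl⟩ := (hex z).mp (Subsingleton.elim _ _)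
  obtain ⟨w, rfl⟩ := h1 y
  rw [← LinearMap.comp_apply (f := hmap e (LinearMap.range f).subtype), ← hcomp, hmap_sum,
    LinearMap.sum_apply, map_sum]
  refine Finset.sum_eq_zero fun i _ => ?_
  rw [hmap_comp, hmap_lsmul]
  change φ (a i • _) = 0
  rw [map_smul, ← LinearMap.smul_apply, hφ _ (haJ i)]
  rfl

theorem annihilator_le_of_isAssociatedPrime_dual {e : ℕ} {E : Type} [AddCommGroup E] [Module A E]
    {p : Ideal A} (hp : IsAssociatedPrime p (Hm A e M →ₗ[A] E)) : Module.annihilator A M ≤ p := by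
  obtain ⟨-, φ, hφ⟩ := isAssociatedPrime_iff.mp hp
  intro a ha
  rw [hφ, Submodule.mem_colon_singleton, Submodule.mem_bot]
  refine LinearMap.ext fun z => ?_
  rw [LinearMap.smul_apply, ← map_smul, smul_hm_eq_zero (Module.mem_annihilator.mp ha)]
  simp

/-- Associated primes of the dual of top local cohomology have top dimension. -/
theorem DimLE.coheight_eq [Module.Finite A M] {e : ℕ} (h : DimLE A M e) {E : Type} [AddCommGroup E]
    [Module A E] (p : PrimeSpectrum A) (hp : IsAssociatedPrime p.asIdeal (Hm A e M →ₗ[A] E)) :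
    Order.coheight p = e := by
  have hann := annihilator_le_of_isAssociatedPrime_dual hp
  obtain ⟨hpp, φ, hφ⟩ := isAssociatedPrime_iff.mp hp
  refine (h p hann).antisymm (not_lt.mp fun hlt => ?_)
  obtain ⟨k, hk⟩ := ENat.ne_top_iff_exists.mp hlt.ne_top
  rw [← hk, Nat.cast_lt] at hlt
  have hd : DimLE A (M ⧸ (p.asIdeal • ⊤ : Submodule A M)) k := fun q hq => by
    have h1 : p.asIdeal ≤ Module.annihilator A (M ⧸ (p.asIdeal • ⊤ : Submodule A M)) :=
      fun a ha => Module.mem_annihilator.mpr fun y => by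
        obtain ⟨m, rfl⟩ := Submodule.mkQ_surjective _ y
        rw [← map_smul, Submodule.mkQ_apply, Submodule.Quotient.mk_eq_zero]
        exact Submodule.smul_mem_smul ha trivial
    have : p ≤ q := h1.trans hq
    rw [hk]
    exact Order.coheight_anti this
  have h0 := h.dual_eq_zero p.asIdeal (hd.hm_subsingleton k e hlt) φ fun a ha => by
    rwa [hφ, Submodule.mem_colon_singleton, Submodule.mem_bot] at ha
  refine hpp.ne_top ((Ideal.eq_top_iff_one _).mpr ?_)
  rw [hφ, Submodule.mem_colon_singleton, h0]
  simp

omit [IsLocalRing A] [IsNoetherianRing A] in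
theorem dimLE_quotient (q : PrimeSpectrum A) {e : ℕ} (hq : Order.coheight q = e) :
    DimLE A (A ⧸ q.asIdeal) e := fun p hp => by
  rw [Ideal.annihilator_quotient] at hp
  exact hq ▸ Order.coheight_anti hp

theorem exists_coheight_of_mem (q : PrimeSpectrum A) {e : ℕ} (hq : Order.coheight q = (e + 1 : ℕ))
    {x : A} (hx : x ∈ maximalIdeal A) : ∃ p, q < p ∧ x ∈ p.asIdeal ∧ Order.coheight p = e := by
  obtain ⟨s, hs, hl⟩ := Order.exists_series_of_coheight_eq_coe q hq
  have hlast : IsMax s.last := by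
    intro b hb
    by_contra hbs
    have h1 := Order.length_le_coheight_head (p := s.snoc b (lt_of_le_not_ge hb hbs))
    rw [RelSeries.head_snoc, hs, hq, RelSeries.snoc_length, hl] at h1
    exact absurd (by exact_mod_cast h1 : e + 1 + 1 ≤ e + 1) (by omega)
  have hxl : x ∈ s.last.asIdeal := hlast (b := ⟨maximalIdeal A, inferInstance⟩)
    (le_maximalIdeal s.last.2.ne_top) hx
  obtain ⟨t, ht, htl, hth, -⟩ := PrimeSpectrum.exist_ltSeries_mem_one_of_mem_last s hxl
  have hqt : q < t 1 := by
    rw [← hs, hth]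
    refine t.strictMono (Fin.lt_def.mpr ?_)
    rw [Fin.val_one', Nat.mod_eq_of_lt (by omega)]
    simp
  refine ⟨t 1, hqt, ht, le_antisymm ?_ ?_⟩
  · have := (Order.coheight_add_one_le hqt).trans hq.le
    push_cast at this
    exact (ENat.add_le_add_iff_right (by simp)).mp this
  · refine le_trans ?_ (Order.rev_index_le_coheight t 1)
    rw [Fin.val_rev, Fin.val_one', Nat.mod_eq_of_lt (by omega), Nat.cast_le]
    omega

end TopDegree
section Nonvanishing

variable {A : Type} [CommRing A] [IsLocalRing A] [IsNoetherianRing A]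
  {M N : Type} [AddCommGroup M] [Module A M] [AddCommGroup N] [Module A N]

omit [IsLocalRing A] [IsNoetherianRing A] in
variable (M) in
/-- The projection `M → M / x M`. -/
noncomputable def qmk (x : A) : M →ₗ[A] QuotSMulTop x M := Submodule.mkQ _

omit [IsNoetherianRing A] in
theorem exists_δ_qmk (x : A) (hx : IsSMulRegular M x) (i : ℕ) :
    ∃ δ : Hm A i (QuotSMulTop x M) →ₗ[A] Hm A (i + 1) M,
      Function.Exact (hmap i (qmk M x)) δ ∧
        Function.Exact δ (LinearMap.lsmul A (Hm A (i + 1) M) x) :=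
  exists_δ_quotSMulTop x hx i

omit [IsLocalRing A] [IsNoetherianRing A] in
theorem isSMulRegular_quotient_prime {q : Ideal A} (hq : q.IsPrime) {x : A} (hx : x ∉ q) :
    IsSMulRegular (A ⧸ q) x := IsSMulRegular.of_right_eq_zero_of_smul fun m hm => by
  obtain ⟨b, rfl⟩ := Ideal.Quotient.mk_surjective m
  rw [← Ideal.Quotient.mk_eq_mk, ← Submodule.Quotient.mk_smul, Submodule.Quotient.mk_eq_zero,
    smul_eq_mul] at hm
  exact Ideal.Quotient.eq_zero_iff_mem.mpr ((hq.mem_or_mem hm).resolve_left hx)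

omit [IsNoetherianRing A] in
theorem Gam_quotient_prime {q : Ideal A} (hq : q.IsPrime) {x : A} (hx : x ∉ q)
    (hxm : x ∈ maximalIdeal A) : Gam A (A ⧸ q) = ⊥ := by
  rw [eq_bot_iff]
  rintro m ⟨t, ht⟩
  exact (isSMulRegular_quotient_prime hq hx).pow t
    (by simp [ht _ (Ideal.pow_mem_pow hxm t)])

omit [IsLocalRing A] [IsNoetherianRing A] in
theorem DimLE.quotSMulTop_quotient {q : PrimeSpectrum A} {e : ℕ}
    (hq : Order.coheight q = (e + 1 : ℕ)) {x : A} (hx : x ∉ q.asIdeal) :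
    DimLE A (QuotSMulTop x (A ⧸ q.asIdeal)) e :=
  (dimLE_quotient q hq).quotSMulTop' x fun p hp hpe hxp => by
    rw [Ideal.annihilator_quotient] at hp
    have : ¬ q < p := fun hlt => by
      have := Order.coheight_add_one_le hlt
      rw [hpe, hq] at this
      exact absurd (by exact_mod_cast this : e + 1 + 1 ≤ e + 1) (by omega)
    have hqp : q = p := by
      by_contra hne
      exact this (lt_of_le_of_ne hp hne)
    exact hx (hqp ▸ hxp)

omit [IsLocalRing A] [IsNoetherianRing A] in
/-- The quotient `A / (q, x)` maps onto `A / p` when `p` contains `q` and `x`. -/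
theorem exists_surjective_quotSMulTop_quotient {q p : Ideal A} (h : q ≤ p) {x : A} (hx : x ∈ p) :
    ∃ f : QuotSMulTop x (A ⧸ q) →ₗ[A] A ⧸ p, Function.Surjective f := by
  refine ⟨Submodule.liftQ _ (Submodule.factor h) fun y hy => ?_, fun y => ?_⟩
  · obtain ⟨z, -, rfl⟩ := (Submodule.mem_smul_pointwise_iff_exists _ _ _).mp hy
    obtain ⟨b, rfl⟩ := Submodule.mkQ_surjective _ z
    rw [LinearMap.mem_ker, map_smul, Submodule.factor_mk, ← map_smul, Submodule.mkQ_apply,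
      Submodule.Quotient.mk_eq_zero]
    exact p.mul_mem_right b hx
  · obtain ⟨b, rfl⟩ := Submodule.mkQ_surjective _ y
    exact ⟨Submodule.Quotient.mk (Submodule.Quotient.mk b), rfl⟩

omit [IsNoetherianRing A] in
theorem ne_zero_of_isAssociatedPrime_dual (h : Gam A M = ⊥) {e : ℕ} {p : Ideal A}
    (hp : IsAssociatedPrime p (Hm A e M →ₗ[A] N)) : e ≠ 0 := by
  rintro rfl
  have := hzero_subsingleton h
  have h1 : Subsingleton (Hm A 0 M →ₗ[A] N) :=
    subsingleton_of_forall_eq 0 fun φ => LinearMap.ext fun z => by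
      rw [Subsingleton.elim z 0, map_zero, map_zero]
  exact not_isAssociatedPrime_of_subsingleton hp

theorem exists_isAssociatedPrime_dual [IsPrecomplete (maximalIdeal A) A] {E : Type}
    [AddCommGroup E] [Module A E] (hE : IsMatlis A E) {q : PrimeSpectrum A} {e : ℕ}
    (hq : Order.coheight q = (e + 1 : ℕ)) {x : A} (hx : x ∉ q.asIdeal)
    (hsurj : Function.Surjective
      (hmap e (qmk (A ⧸ q.asIdeal) x)))
    (hne : ¬ Subsingleton (Hm A e (QuotSMulTop x (A ⧸ q.asIdeal)))) :
    ∃ p : PrimeSpectrum A, IsAssociatedPrime p.asIdeal (Hm A e (A ⧸ q.asIdeal) →ₗ[A] E) ∧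
      x ∈ p.asIdeal ∧ Order.coheight p = e := by
  have h1 : Nontrivial (Hm A e (QuotSMulTop x (A ⧸ q.asIdeal)) →ₗ[A] E) := by
    obtain ⟨z, hz⟩ := not_forall.mp fun h => hne (subsingleton_of_forall_eq 0 h)
    obtain ⟨φ, hφ⟩ := hE.exists_hom_ne_zero z hz
    exact ⟨φ, 0, fun h => hφ (by rw [h, LinearMap.zero_apply])⟩
  have := hE.finite_dual_hm e (QuotSMulTop x (A ⧸ q.asIdeal))
  obtain ⟨p, hp⟩ := associatedPrimes.nonempty A
    (Hm A e (QuotSMulTop x (A ⧸ q.asIdeal)) →ₗ[A] E)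
  have hp : IsAssociatedPrime p _ := hp
  refine ⟨⟨p, hp.isPrime⟩, hp.map_of_injective _ (lcomp_injective _ hsurj),
    annihilator_le_of_isAssociatedPrime_dual hp (Module.mem_annihilator.mpr fun y => ?_),
    (DimLE.quotSMulTop_quotient hq hx).coheight_eq ⟨p, hp.isPrime⟩ hp⟩
  obtain ⟨m, rfl⟩ := Submodule.mkQ_surjective _ y
  rw [← map_smul, Submodule.mkQ_apply, Submodule.Quotient.mk_eq_zero]
  exact Submodule.smul_mem_pointwise_smul _ _ _ trivial

/-- Nonvanishing of top local cohomology. -/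
theorem not_subsingleton_hm_quotient [IsPrecomplete (maximalIdeal A) A] (e : ℕ) :
    ∀ q : PrimeSpectrum A, Order.coheight q = e → ¬ Subsingleton (Hm A e (A ⧸ q.asIdeal)) := by
  obtain ⟨E, _, _, hE⟩ := exists_isMatlis A
  induction e with
  | zero =>
    intro q hq hs
    have := q.2
    have htor : IsTor A (A ⧸ q.asIdeal) := (dimLE_quotient q hq).isTor
    exact not_subsingleton (A ⧸ q.asIdeal) (htor.hzero_surjective.subsingleton)
  | succ e ih =>
    intro q hq hs
    have hq2 := q.2
    have hmax (p : PrimeSpectrum A) (k : ℕ) (hk : k ≠ 0) (hp : Order.coheight p = k) :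
        ¬ maximalIdeal A ≤ p.asIdeal := fun hle => by
      have : IsMax p := fun r hr => (le_maximalIdeal r.2.ne_top).trans hle
      rw [Order.coheight_eq_zero.mpr this] at hp
      exact hk (by exact_mod_cast hp.symm)
    have key (x : A) (hx : x ∈ maximalIdeal A) (hxq : x ∉ q.asIdeal) :
        Function.Surjective (hmap e (qmk (A ⧸ q.asIdeal) x)) ∧
        ¬ Subsingleton (Hm A e (QuotSMulTop x (A ⧸ q.asIdeal))) := by
      obtain ⟨δ, h₁, -⟩ := exists_δ_qmk x (isSMulRegular_quotient_prime hq2 hxq) e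
      refine ⟨fun z => (h₁ z).mp (Subsingleton.elim _ _), fun hs' => ?_⟩
      obtain ⟨p, hqp, hxp, hp⟩ := exists_coheight_of_mem q hq hx
      obtain ⟨f, hf⟩ := exists_surjective_quotSMulTop_quotient hqp.le hxp
      exact ih p hp ((DimLE.quotSMulTop_quotient hq hxq).hmap_surjective f hf).subsingleton
    have := hE.finite_dual_hm e (A ⧸ q.asIdeal)
    have hfin := associatedPrimes.finite A (Hm A e (A ⧸ q.asIdeal) →ₗ[A] E)
    obtain ⟨x, hx, hxS⟩ := exists_mem_notMem_of_finite (maximalIdeal A)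
      ({p ∈ associatedPrimes A (Hm A e (A ⧸ q.asIdeal) →ₗ[A] E) | ¬ maximalIdeal A ≤ p} ∪
        {q.asIdeal}) ((hfin.subset (Set.sep_subset _ _)).union (Set.finite_singleton _))
      (fun p hp => hp.elim (fun h => h.1.isPrime) fun h => h ▸ hq2)
      (fun p hp => hp.elim (fun h => h.2) fun h => h ▸ hmax q (e + 1) (by omega) hq)
    have hxq : x ∉ q.asIdeal := hxS _ (Or.inr rfl)
    have h1 := (key x hx hxq).1
    have h2 := (key x hx hxq).2
    clear key hs
    obtain ⟨p, hp, hxp, hco⟩ := exists_isAssociatedPrime_dual hE hq hxq h1 h2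
    have he : e ≠ 0 := ne_zero_of_isAssociatedPrime_dual (Gam_quotient_prime hq2 hxq hx) hp
    exact hxS _ (Or.inl ⟨hp, hmax p e he hco⟩) hxp

omit [IsLocalRing A] [IsNoetherianRing A] in
theorem dimLE_self {d : ℕ} (hd : ringKrullDim A = d) (M : Type) [AddCommGroup M] [Module A M] :
    DimLE A M d := fun p _ => by
  have := Order.coheight_le_krullDim p
  rw [ringKrullDim] at hd
  rw [hd] at this
  exact_mod_cast this

theorem not_subsingleton_hm [IsPrecomplete (maximalIdeal A) A] {d : ℕ}
    (hd : ringKrullDim A = d) : ¬ Subsingleton (Hm A d A) := fun hs => by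
  have : ∃ q : PrimeSpectrum A, Order.coheight q = d := by
    have h1 : Order.krullDim (PrimeSpectrum A) = d := hd
    obtain ⟨s, hs⟩ := Order.le_krullDim_iff.mp h1.ge
    refine ⟨s.head, le_antisymm (dimLE_self hd (A ⧸ s.head.asIdeal) s.head ?_) ?_⟩
    · rw [Ideal.annihilator_quotient]
    · rw [← hs]; exact Order.length_le_coheight_head
  obtain ⟨q, hq⟩ := this
  exact not_subsingleton_hm_quotient d q hq
    ((dimLE_self hd A).hmap_surjective q.asIdeal.mkQ (Submodule.mkQ_surjective _)).subsingleton

end Nonvanishing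
section LocalLength

variable {A : Type} [CommRing A] (q : PrimeSpectrum A)
  {M N P : Type} [AddCommGroup M] [Module A M] [AddCommGroup N] [Module A N] [AddCommGroup P]
  [Module A P]

variable (M) in
/-- The length of the localization of `M` at the prime `q`. -/
noncomputable def lp : ℕ∞ :=
  Module.length (Localization.AtPrime q.asIdeal) (LocalizedModule q.asIdeal.primeCompl M)

/-- Localization of a linear map at a prime. -/
noncomputable def lmap (f : M →ₗ[A] N) :
    LocalizedModule q.asIdeal.primeCompl M →ₗ[Localization.AtPrime q.asIdeal]
      LocalizedModule q.asIdeal.primeCompl N :=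
  LocalizedModule.map q.asIdeal.primeCompl f

theorem lmap_injective (f : M →ₗ[A] N) (hf : Function.Injective f) :
    Function.Injective (lmap q f) :=
  LocalizedModule.map_injective _ f hf

theorem lmap_surjective (f : M →ₗ[A] N) (hf : Function.Surjective f) :
    Function.Surjective (lmap q f) :=
  LocalizedModule.map_surjective _ f hf

theorem lmap_exact (f : M →ₗ[A] N) (g : N →ₗ[A] P) (h : Function.Exact f g) :
    Function.Exact (lmap q f) (lmap q g) :=
  LocalizedModule.map_exact q.asIdeal.primeCompl f g h

theorem lp_le_of_injective (f : M →ₗ[A] N) (hf : Function.Injective f) : lp q M ≤ lp q N :=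
  Module.length_le_of_injective (lmap q f) (lmap_injective q f hf)

theorem lp_le_of_surjective (f : M →ₗ[A] N) (hf : Function.Surjective f) : lp q N ≤ lp q M :=
  Module.length_le_of_surjective (lmap q f) (lmap_surjective q f hf)

theorem lp_congr (f : M ≃ₗ[A] N) : lp q M = lp q N :=
  (lp_le_of_injective q f.toLinearMap f.injective).antisymm
    (lp_le_of_surjective q f.toLinearMap f.surjective)

theorem lp_exact (f : M →ₗ[A] N) (g : N →ₗ[A] P) (hf : Function.Injective f)
    (hg : Function.Surjective g) (h : Function.Exact f g) : lp q N = lp q M + lp q P :=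
  Module.length_eq_add_of_exact (lmap q f) (lmap q g) (lmap_injective q f hf)
    (lmap_surjective q g hg) (lmap_exact q f g h)

theorem lp_le_of_exact (f : M →ₗ[A] N) (g : N →ₗ[A] P) (h : Function.Exact f g) :
    lp q N ≤ lp q M + lp q P := by
  rw [lp_exact q (LinearMap.ker g).subtype g.rangeRestrict (Submodule.injective_subtype _)
    g.surjective_rangeRestrict (by rw [LinearMap.exact_iff]; simp)]
  refine add_le_add ?_ (lp_le_of_injective q _ (Submodule.injective_subtype _))
  rw [LinearMap.exact_iff.mp h]
  exact lp_le_of_surjective q _ f.surjective_rangeRestrict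

theorem lp_eq_zero_iff : lp q M = 0 ↔ ∀ m : M, ∃ s ∉ q.asIdeal, s • m = 0 := by
  rw [lp, Module.length_eq_zero_iff, LocalizedModule.subsingleton_iff]
  rfl

theorem lp_eq_zero_of_notMem {a : A} (ha : a ∉ q.asIdeal) (h : ∀ m : M, a • m = 0) : lp q M = 0 :=
  (lp_eq_zero_iff q).mpr fun m => ⟨a, ha, h m⟩

theorem lp_le_one (m : M) (hm : ∀ y : M, ∃ a : A, y = a • m)
    (hq : ∀ a ∈ q.asIdeal, a • m = 0) : lp q M ≤ 1 := by
  rcases subsingleton_or_nontrivial (LocalizedModule q.asIdeal.primeCompl M) with h | h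
  · rw [lp, Module.length_eq_zero]
    exact zero_le_one
  refine (Module.length_eq_one_iff.mpr
    (isSimpleModule_iff_toSpanSingleton_surjective.mpr ⟨h, fun v hv w => ?_⟩)).le
  obtain ⟨⟨v, s⟩, rfl⟩ := IsLocalizedModule.mk'_surjective q.asIdeal.primeCompl
    (LocalizedModule.mkLinearMap q.asIdeal.primeCompl M) v
  obtain ⟨⟨w, t⟩, rfl⟩ := IsLocalizedModule.mk'_surjective q.asIdeal.primeCompl
    (LocalizedModule.mkLinearMap q.asIdeal.primeCompl M) w
  obtain ⟨a, rfl⟩ := hm v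
  obtain ⟨b, rfl⟩ := hm w
  have ha : a ∉ q.asIdeal := fun ha => hv (by simp [hq a ha])
  refine ⟨IsLocalization.mk' _ (b * s) (⟨a, ha⟩ * t), ?_⟩
  rw [LinearMap.toSpanSingleton_apply, Function.uncurry_apply_pair, Function.uncurry_apply_pair,
    IsLocalizedModule.mk'_smul_mk', IsLocalizedModule.mk'_eq_mk'_iff]
  refine ⟨1, ?_⟩
  simp only [Submonoid.smul_def, Submonoid.coe_mul, ← mul_smul, Submonoid.coe_one]
  congr 1
  ring

theorem lp_quotient_self : lp q (A ⧸ q.asIdeal) = 1 := by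
  refine le_antisymm (lp_le_one q (Submodule.Quotient.mk 1) (fun y => ?_) fun a ha => ?_) ?_
  · obtain ⟨a, rfl⟩ := Submodule.mkQ_surjective _ y
    exact ⟨a, by rw [← Submodule.Quotient.mk_smul, smul_eq_mul, mul_one]; rfl⟩
  · rw [← Submodule.Quotient.mk_smul, smul_eq_mul, mul_one, Submodule.Quotient.mk_eq_zero]
    exact ha
  · refine Order.one_le_iff_pos.mpr (pos_iff_ne_zero.mpr fun h => ?_)
    obtain ⟨s, hs, h⟩ := (lp_eq_zero_iff q).mp h (Submodule.Quotient.mk 1)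
    rw [← Submodule.Quotient.mk_smul, smul_eq_mul, mul_one, Submodule.Quotient.mk_eq_zero] at h
    exact hs h

theorem exists_mem_notMem_of_dimLE {e : ℕ} {q : PrimeSpectrum A} (hq : Order.coheight q = e)
    {p : PrimeSpectrum A} (hp : Order.coheight p ≤ e) (hne : p ≠ q) :
    ∃ a ∈ p.asIdeal, a ∉ q.asIdeal := by
  by_contra! h
  have hlt : p < q := lt_of_le_of_ne h hne
  have := (Order.coheight_add_one_le hlt).trans hp
  rw [hq] at this
  exact absurd (by exact_mod_cast this : e + 1 ≤ e) (by omega)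

theorem lp_lt_top [IsNoetherianRing A] [hM : Module.Finite A M] {e : ℕ}
    (hq : Order.coheight q = e) (h : DimLE A M e) : lp q M < ⊤ := by
  induction hM using IsNoetherianRing.induction_on_isQuotientEquivQuotientPrime A with
  | subsingleton N =>
    rw [lp_eq_zero_of_notMem (M := N) q (a := 1) (fun h => q.2.ne_top
      ((Ideal.eq_top_iff_one _).mpr h)) fun m => Subsingleton.elim _ _]
    simp
  | quotient N p f =>
    rw [lp_congr q f]
    by_cases hpq : p = q
    · subst hpq
      rw [lp_quotient_self]
      exact ENat.one_lt_top
    · obtain ⟨a, ha, haq⟩ := exists_mem_notMem_of_dimLE hq (h p (by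
        rw [f.annihilator_eq, Ideal.annihilator_quotient])) hpq
      rw [lp_eq_zero_of_notMem q haq fun m => ?_]
      · simp
      · obtain ⟨b, rfl⟩ := Submodule.mkQ_surjective _ m
        rw [← map_smul, Submodule.mkQ_apply, Submodule.Quotient.mk_eq_zero]
        exact Ideal.mul_mem_right _ _ ha
  | exact N₁ N₂ N₃ f g hf hg hfg h₁ h₃ =>
    rw [lp_exact q f g hf hg hfg]
    exact ENat.add_lt_top.mpr ⟨h₁ (h.of_injective f hf), h₃ (h.of_surjective g hg)⟩

end LocalLength
section Rank

variable {A : Type} [CommRing A] {U : Type} [AddCommGroup U] [Module A U]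

/-- Comparison of the local lengths of `U / x U` and `F / x F` for a submodule `F` of `U`. -/
theorem lp_quotSMulTop_eq (q : PrimeSpectrum A) (F : Submodule A U) {x : A}
    (hx : IsSMulRegular U x) (h : lp q (U ⧸ F) < ⊤) :
    lp q (QuotSMulTop x U) = lp q (QuotSMulTop x F) := by
  have hle : x • F ≤ F := Submodule.smul_le_self_of_tower x F
  have hle' : x • F ≤ x • ⊤ := by
    rintro _ hy
    obtain ⟨y, -, rfl⟩ := (Submodule.mem_smul_pointwise_iff_exists _ _ _).mp hy
    exact Submodule.smul_mem_pointwise_smul _ _ _ trivial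
  have hc : x • (⊤ : Submodule A F) ≤ Submodule.comap F.subtype (x • F) := by
    rintro _ hy
    obtain ⟨y, -, rfl⟩ := (Submodule.mem_smul_pointwise_iff_exists _ _ _).mp hy
    exact Submodule.mem_comap.mpr (Submodule.smul_mem_pointwise_smul _ _ _ y.2)
  have hc' : F ≤ Submodule.comap (LinearMap.lsmul A U x) (x • F) :=
    fun y hy => Submodule.mem_comap.mpr (Submodule.smul_mem_pointwise_smul _ _ _ hy)
  have h1 : lp q (U ⧸ (x • F)) = lp q (QuotSMulTop x F) + lp q (U ⧸ F) := by
    refine lp_exact q (Submodule.mapQ (x • (⊤ : Submodule A F)) (x • F) F.subtype hc)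
      (Submodule.factor hle) ?_ (Submodule.factor_surjective hle) ?_
    · rw [injective_iff_map_eq_zero]
      intro y hy
      obtain ⟨y, rfl⟩ := Submodule.mkQ_surjective _ y
      have hy : Submodule.Quotient.mk (y : U) = 0 := hy
      rw [Submodule.Quotient.mk_eq_zero] at hy
      obtain ⟨z, hz, h⟩ := (Submodule.mem_smul_pointwise_iff_exists _ _ _).mp hy
      rw [Submodule.mkQ_apply, Submodule.Quotient.mk_eq_zero]
      exact (Submodule.mem_smul_pointwise_iff_exists _ _ _).mpr ⟨⟨z, hz⟩, trivial, Subtype.ext h⟩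
    · intro y
      obtain ⟨y, rfl⟩ := Submodule.mkQ_surjective _ y
      change Submodule.Quotient.mk y = 0 ↔ _
      rw [Submodule.Quotient.mk_eq_zero]
      refine ⟨fun h => ⟨Submodule.Quotient.mk ⟨y, h⟩, rfl⟩, ?_⟩
      rintro ⟨z, hz⟩
      obtain ⟨z, rfl⟩ := Submodule.mkQ_surjective _ z
      have hz : Submodule.Quotient.mk (z : U) = Submodule.Quotient.mk y := hz
      rw [Submodule.Quotient.eq] at hz
      have := F.sub_mem z.2 (hle hz)
      simpa using this
  have h2 : lp q (U ⧸ (x • F)) = lp q (U ⧸ F) + lp q (QuotSMulTop x U) := by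
    refine lp_exact q (Submodule.mapQ F (x • F) (LinearMap.lsmul A U x) hc')
      (Submodule.factor hle') ?_ (Submodule.factor_surjective hle') ?_
    · rw [injective_iff_map_eq_zero]
      intro y hy
      obtain ⟨y, rfl⟩ := Submodule.mkQ_surjective _ y
      have hy : Submodule.Quotient.mk (x • y) = 0 := hy
      rw [Submodule.Quotient.mk_eq_zero] at hy
      obtain ⟨z, hz, h⟩ := (Submodule.mem_smul_pointwise_iff_exists _ _ _).mp hy
      rw [Submodule.mkQ_apply, Submodule.Quotient.mk_eq_zero]
      rwa [← hx h]
    · intro y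
      obtain ⟨y, rfl⟩ := Submodule.mkQ_surjective _ y
      change Submodule.Quotient.mk y = 0 ↔ _
      rw [Submodule.Quotient.mk_eq_zero]
      refine ⟨fun h => ?_, ?_⟩
      · obtain ⟨z, -, rfl⟩ := (Submodule.mem_smul_pointwise_iff_exists _ _ _).mp h
        exact ⟨Submodule.Quotient.mk z, rfl⟩
      · rintro ⟨z, hz⟩
        obtain ⟨z, rfl⟩ := Submodule.mkQ_surjective _ z
        have hz : Submodule.Quotient.mk (x • z) = Submodule.Quotient.mk y := hz
        rw [Submodule.Quotient.eq] at hz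
        have := Submodule.sub_mem _ (Submodule.smul_mem_pointwise_smul z x ⊤ trivial) (hle' hz)
        simpa using this
  rw [h1, add_comm] at h2
  exact (WithTop.add_left_cancel h.ne h2).symm

/-- For short exact sequences with regular last term, local length modulo `x` is additive. -/
theorem lp_quotSMulTop_add (q : PrimeSpectrum A) (S : Submodule A U) {x : A}
    (hx : IsSMulRegular (U ⧸ S) x) :
    lp q (QuotSMulTop x U) = lp q (QuotSMulTop x S) + lp q (QuotSMulTop x (U ⧸ S)) := by
  refine lp_exact q (QuotSMulTop.map x S.subtype) (QuotSMulTop.map x S.mkQ) ?_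
    (QuotSMulTop.map_surjective x (Submodule.mkQ_surjective _))
    (QuotSMulTop.map_exact x (by rw [LinearMap.exact_iff]; simp) (Submodule.mkQ_surjective _))
  rw [injective_iff_map_eq_zero]
  intro y hy
  obtain ⟨y, rfl⟩ := Submodule.mkQ_surjective _ y
  rw [Submodule.mkQ_apply] at hy ⊢
  have hy : (Submodule.Quotient.mk (y : U) : QuotSMulTop x U) = 0 := hy
  rw [Submodule.Quotient.mk_eq_zero] at hy ⊢
  obtain ⟨z, -, hz⟩ := (Submodule.mem_smul_pointwise_iff_exists _ _ _).mp hy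
  have hzS : z ∈ S := by
    rw [← Submodule.Quotient.mk_eq_zero]
    refine hx ?_
    simp only [smul_zero]
    rw [← Submodule.Quotient.mk_smul, hz, Submodule.Quotient.mk_eq_zero]
    exact y.2
  exact (Submodule.mem_smul_pointwise_iff_exists _ _ _).mpr ⟨⟨z, hzS⟩, trivial, Subtype.ext hz⟩

/-- `U` is a torsion-free module over `A / q`. -/
def TorFree (q : Ideal A) (U : Type) [AddCommGroup U] [Module A U] : Prop :=
  ∀ u : U, u ≠ 0 → ∀ a : A, a • u = 0 ↔ a ∈ q

theorem TorFree.isSMulRegular {q : Ideal A} (h : TorFree q U) {x : A} (hx : x ∉ q) :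
    IsSMulRegular U x := IsSMulRegular.of_right_eq_zero_of_smul fun u hu => by
  by_contra hne
  exact hx ((h u hne x).mp hu)

theorem TorFree.submodule {q : Ideal A} (h : TorFree q U) (S : Submodule A U) : TorFree q S :=
  fun u hu a => by
    rw [← h u (fun h => hu (Subtype.ext h)) a, ← Submodule.coe_smul, Submodule.coe_eq_zero]

/-- The saturation of the line through `u`. -/
def saturation (q : PrimeSpectrum A) (u : U) : Submodule A U where
  carrier := {w | ∃ s ∉ q.asIdeal, s • w ∈ Submodule.span A {u}}
  add_mem' := by
    rintro a b ⟨s, hs, ha⟩ ⟨t, ht, hb⟩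
    refine ⟨s * t, fun h => (q.2.mem_or_mem h).elim hs ht, ?_⟩
    rw [show (s * t) • (a + b) = t • (s • a) + s • (t • b) by module]
    exact Submodule.add_mem _ (Submodule.smul_mem _ _ ha) (Submodule.smul_mem _ _ hb)
  zero_mem' := ⟨1, fun h => q.2.ne_top ((Ideal.eq_top_iff_one _).mpr h), by simp⟩
  smul_mem' := by
    rintro c a ⟨s, hs, ha⟩
    exact ⟨s, hs, by rw [smul_comm]; exact Submodule.smul_mem _ _ ha⟩

theorem TorFree.quotient_saturation {q : PrimeSpectrum A} (h : TorFree q.asIdeal U) (u : U) :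
    TorFree q.asIdeal (U ⧸ saturation q u) := fun w hw a => by
  obtain ⟨w, rfl⟩ := Submodule.mkQ_surjective _ w
  rw [Submodule.mkQ_apply] at hw ⊢
  rw [Ne, Submodule.Quotient.mk_eq_zero] at hw
  have hw0 : w ≠ 0 := fun h => hw (h ▸ Submodule.zero_mem _)
  rw [← Submodule.Quotient.mk_smul, Submodule.Quotient.mk_eq_zero]
  refine ⟨?_, fun ha => by rw [(h w hw0 a).mpr ha]; exact Submodule.zero_mem _⟩
  rintro ⟨s, hs, ha⟩
  by_contra haq
  exact hw ⟨s * a, fun h => (q.2.mem_or_mem h).elim hs haq, by rwa [mul_smul]⟩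

variable [IsNoetherianRing A]

omit [IsNoetherianRing A] in
/-- A finite module whose elements are killed by elements outside `q`, and which is killed by `q`,
has smaller dimension than `A / q`. -/
theorem dimLE_of_torsion [Module.Finite A U] {q : PrimeSpectrum A} {e : ℕ}
    (hq : Order.coheight q = (e + 1 : ℕ)) (hk : ∀ a ∈ q.asIdeal, ∀ u : U, a • u = 0)
    (ht : ∀ u : U, ∃ s ∉ q.asIdeal, s • u = 0) : DimLE A U e := fun p hp => by
  have hqp : q ≤ p := fun a ha => hp (Module.mem_annihilator.mpr (hk a ha))
  have hne : q ≠ p := by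
    rintro rfl
    have hs : ∃ s ∉ q.asIdeal, ∀ u : U, s • u = 0 := by
      obtain ⟨n, g, hg⟩ := Module.Finite.exists_fin (R := A) (M := U)
      choose s hs h using fun i => ht (g i)
      refine ⟨∏ i, s i, fun h => ?_, fun u => ?_⟩
      · obtain ⟨i, -, hi⟩ := (Ideal.IsPrime.prod_mem_iff (p := q.asIdeal)).mp h
        exact hs i hi
      · have hu : u ∈ Submodule.span A (Set.range g) := hg ▸ trivial
        refine Submodule.span_induction ?_ (smul_zero _) (fun a b _ _ ha hb => ?_)
          (fun c a _ ha => ?_) hu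
        · rintro _ ⟨i, rfl⟩
          rw [← Finset.prod_erase_mul _ _ (Finset.mem_univ i), mul_smul, h, smul_zero]
        · rw [smul_add, ha, hb, add_zero]
        · rw [smul_comm, ha, smul_zero]
    obtain ⟨s, hs, h⟩ := hs
    exact hs (hp (Module.mem_annihilator.mpr h))
  have := Order.coheight_add_one_le (lt_of_le_of_ne hqp hne)
  rw [hq] at this
  push_cast at this
  exact (ENat.add_le_add_iff_right (by simp)).mp this

omit [IsNoetherianRing A] in
/-- The line through a nonzero element of a torsion-free module. -/
theorem TorFree.span_equiv {q : Ideal A} (h : TorFree q U) {u : U} (hu : u ≠ 0) :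
    Nonempty ((A ⧸ q) ≃ₗ[A] Submodule.span A {u}) := by
  have h1 : LinearMap.ker (LinearMap.toSpanSingleton A U u) = q := by
    ext a
    rw [LinearMap.mem_ker, LinearMap.toSpanSingleton_apply, h u hu]
  have h2 : LinearMap.range (LinearMap.toSpanSingleton A U u) = Submodule.span A {u} :=
    LinearMap.range_toSpanSingleton u
  exact ⟨(Submodule.quotEquivOfEq _ _ h1.symm).trans
    ((LinearMap.toSpanSingleton A U u).quotKerEquivRange.trans (LinearEquiv.ofEq _ _ h2))⟩

omit [IsNoetherianRing A] in
theorem lp_quotSMulTop_congr {V : Type} [AddCommGroup V] [Module A V] (q : PrimeSpectrum A) (x : A)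
    (e : U ≃ₗ[A] V) : lp q (QuotSMulTop x U) = lp q (QuotSMulTop x V) :=
  lp_congr q (QuotSMulTop.congr x e)

variable {q q' : PrimeSpectrum A} {e : ℕ} {x : A}

theorem TorFree.lp_eq [Module.Finite A U] (h : TorFree q.asIdeal U)
    (hq : Order.coheight q = (e + 1 : ℕ)) (hq' : Order.coheight q' = e) (hx : x ∉ q.asIdeal)
    {u : U} (hu : u ≠ 0) : lp q' (QuotSMulTop x U) =
      lp q' (QuotSMulTop x (A ⧸ q.asIdeal)) + lp q' (QuotSMulTop x (U ⧸ saturation q u)) := by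
  rw [lp_quotSMulTop_add q' (saturation q u) ((h.quotient_saturation u).isSMulRegular hx)]
  congr 1
  have huS : u ∈ saturation q u := ⟨1, fun h => q.2.ne_top ((Ideal.eq_top_iff_one _).mpr h), by
    rw [one_smul]; exact Submodule.mem_span_singleton_self u⟩
  have hS := h.submodule (saturation q u)
  have hne : (⟨u, huS⟩ : saturation q u) ≠ 0 := fun h => hu (congrArg Subtype.val h)
  obtain ⟨φ⟩ := hS.span_equiv hne
  rw [lp_quotSMulTop_congr q' x φ]
  refine lp_quotSMulTop_eq q' _ (hS.isSMulRegular hx)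
    (lp_lt_top q' hq' (dimLE_of_torsion hq (fun a ha w => ?_) fun w => ?_))
  · obtain ⟨w, rfl⟩ := Submodule.mkQ_surjective _ w
    rw [← map_smul]
    by_cases hw : w = 0
    · rw [hw, smul_zero, map_zero]
    · rw [(hS w hw a).mpr ha, map_zero]
  · obtain ⟨w, rfl⟩ := Submodule.mkQ_surjective _ w
    obtain ⟨s, hs, hw⟩ := w.2
    refine ⟨s, hs, ?_⟩
    rw [← map_smul, Submodule.mkQ_apply, Submodule.Quotient.mk_eq_zero]
    obtain ⟨c, hc⟩ := Submodule.mem_span_singleton.mp hw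
    exact Submodule.mem_span_singleton.mpr ⟨c, Subtype.ext hc⟩

/-- A torsion-free module over `A / q` whose reduction modulo `x` is not longer than that of
`A / q` has rank at most one. -/
theorem TorFree.lp_le_one [Module.Finite A U] (h : TorFree q.asIdeal U)
    (hq : Order.coheight q = (e + 1 : ℕ)) (hq' : Order.coheight q' = e) (hx : x ∉ q.asIdeal)
    (h0 : lp q' (QuotSMulTop x (A ⧸ q.asIdeal)) ≠ 0)
    (hle : lp q' (QuotSMulTop x U) ≤ lp q' (QuotSMulTop x (A ⧸ q.asIdeal))) : lp q U ≤ 1 := by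
  have hfin : lp q' (QuotSMulTop x (A ⧸ q.asIdeal)) < ⊤ :=
    lp_lt_top q' hq' (DimLE.quotSMulTop_quotient hq hx)
  by_cases hU : ∀ u : U, u = 0
  · rw [(lp_eq_zero_iff q).mpr fun u => ⟨1, fun h => q.2.ne_top ((Ideal.eq_top_iff_one _).mpr h),
      by rw [hU u, smul_zero]⟩]
    exact zero_le_one
  push Not at hU
  obtain ⟨u, hu⟩ := hU
  have hS : ∀ w, w ∈ saturation q u := by
    by_contra! hw
    obtain ⟨w, hw⟩ := hw
    rw [h.lp_eq hq hq' hx hu, (h.quotient_saturation u).lp_eq hq hq' hx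
      (u := Submodule.Quotient.mk w) (by rwa [Ne, Submodule.Quotient.mk_eq_zero])] at hle
    obtain ⟨c, hc⟩ := ENat.ne_top_iff_exists.mp hfin.ne
    rw [← hc] at hle h0
    have h1 : (c : ℕ∞) + c ≤ c := le_trans (by gcongr; exact le_self_add) hle
    have h2 : c + c ≤ c := by exact_mod_cast h1
    exact h0 (by exact_mod_cast (by omega : c = 0))
  obtain ⟨φ⟩ := h.span_equiv hu
  have h1 := lp_exact q (Submodule.span A {u}).subtype (Submodule.span A {u}).mkQ
    (Submodule.injective_subtype _) (Submodule.mkQ_surjective _)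
    (by rw [LinearMap.exact_iff]; simp)
  rw [h1, ← lp_congr q φ, lp_quotient_self, (lp_eq_zero_iff q).mpr fun w => ?_, add_zero]
  obtain ⟨w, rfl⟩ := Submodule.mkQ_surjective _ w
  obtain ⟨s, hs, hw⟩ := hS w
  refine ⟨s, hs, ?_⟩
  rwa [← map_smul, Submodule.mkQ_apply, Submodule.Quotient.mk_eq_zero]

end Rank
section DualRank

variable {A : Type} [CommRing A] [IsLocalRing A] [IsNoetherianRing A]
  {M : Type} [AddCommGroup M] [Module A M] {E : Type} [AddCommGroup E] [Module A E]

omit [IsNoetherianRing A] in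
theorem lp_quotSMulTop_dual_le (hE : Module.Injective A E) (q : PrimeSpectrum A) {x : A}
    (hx : IsSMulRegular M x) (e : ℕ) : lp q (QuotSMulTop x (Hm A (e + 1) M →ₗ[A] E)) ≤
      lp q (Hm A e (QuotSMulTop x M) →ₗ[A] E) := by
  obtain ⟨ψ, hψ⟩ := exists_dual_δ hE x hx e
  exact lp_le_of_injective q (Submodule.liftQ _ ψ hψ.ge)
    (LinearMap.ker_eq_bot.mp (Submodule.ker_liftQ_eq_bot _ _ _ hψ.le))

omit [IsNoetherianRing A] in
theorem smul_dual_hm_eq_zero {a : A} (ha : ∀ m : M, a • m = 0) (e : ℕ) (φ : Hm A e M →ₗ[A] E) :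
    a • φ = 0 := LinearMap.ext fun z => by
  rw [LinearMap.smul_apply, ← map_smul, smul_hm_eq_zero ha, map_zero, LinearMap.zero_apply]

omit [IsNoetherianRing A] in
theorem lp_dual_congr {N : Type} [AddCommGroup N] [Module A N] (q : PrimeSpectrum A)
    (e : ℕ) (f : M ≃ₗ[A] N) : lp q (Hm A e M →ₗ[A] E) = lp q (Hm A e N →ₗ[A] E) :=
  lp_congr q ((hcongr e f).congrLeft E A)

theorem lp_dual_le_of_prime (hE : IsMatlis A E) {e : ℕ} {q : PrimeSpectrum A}
    (hq : Order.coheight q = e) (hcore : lp q (Hm A e (A ⧸ q.asIdeal) →ₗ[A] E) ≤ 1)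
    [hM : Module.Finite A M] (h : DimLE A M e) : lp q (Hm A e M →ₗ[A] E) ≤ lp q M := by
  induction hM using IsNoetherianRing.induction_on_isQuotientEquivQuotientPrime A with
  | subsingleton N =>
    rw [lp_eq_zero_of_notMem (M := Hm A e N →ₗ[A] E) q (a := 1) (fun h => q.2.ne_top
      ((Ideal.eq_top_iff_one _).mpr h)) (smul_dual_hm_eq_zero (fun m => Subsingleton.elim _ _) e)]
    exact zero_le
  | quotient N p f =>
    rw [lp_congr q f, lp_dual_congr q e f]
    by_cases hpq : p = q
    · subst hpq
      rwa [lp_quotient_self]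
    · obtain ⟨a, ha, haq⟩ := exists_mem_notMem_of_dimLE hq (h p (by
        rw [f.annihilator_eq, Ideal.annihilator_quotient])) hpq
      rw [lp_eq_zero_of_notMem (M := Hm A e (A ⧸ p.1) →ₗ[A] E) q haq
        (smul_dual_hm_eq_zero (fun m => ?_) e)]
      · exact zero_le
      · obtain ⟨b, rfl⟩ := Submodule.mkQ_surjective _ m
        rw [← map_smul, Submodule.mkQ_apply, Submodule.Quotient.mk_eq_zero]
        exact Ideal.mul_mem_right _ _ ha
  | exact N₁ N₂ N₃ f g hf hg hfg h₁ h₃ =>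
    rw [lp_exact q f g hf hg hfg, add_comm]
    exact (lp_le_of_exact q _ _ (lcomp_exact hE.inj _ _ (hmap_exact f g hf hg hfg e))).trans
      (add_le_add (h₃ (h.of_surjective g hg)) (h₁ (h.of_injective f hf)))

theorem lp_quotSMulTop_dual_le_of_prime (hE : IsMatlis A E) {e : ℕ} {q : PrimeSpectrum A}
    (hq : Order.coheight q = e) (hcore : lp q (Hm A e (A ⧸ q.asIdeal) →ₗ[A] E) ≤ 1)
    [Module.Finite A M] {x : A} (hx : IsSMulRegular M x) (h : DimLE A (QuotSMulTop x M) e) :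
    lp q (QuotSMulTop x (Hm A (e + 1) M →ₗ[A] E)) ≤ lp q (QuotSMulTop x M) :=
  (lp_quotSMulTop_dual_le hE.inj q hx e).trans (lp_dual_le_of_prime hE hq hcore h)

omit [IsNoetherianRing A] in
theorem lp_dual_hzero_le (hE : IsMatlis A E) {q : PrimeSpectrum A} (hM : IsTor A M) (m : M)
    (hm : ∀ y : M, ∃ a : A, y = a • m) (hk : ∀ a ∈ maximalIdeal A, ∀ y : M, a • y = 0)
    (hq : q.asIdeal ≤ maximalIdeal A) :
    lp q (Hm A 0 M →ₗ[A] E) ≤ 1 := by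
  obtain ⟨u, hu, hmu, hs⟩ := hE.soc
  obtain ⟨z, hz⟩ := hM.hzero_surjective m
  let f : (Hm A 0 M →ₗ[A] E) →ₗ[A] Submodule.span A {u} :=
    LinearMap.codRestrict _ (LinearMap.applyₗ z) fun φ => by
      obtain ⟨c, hc⟩ := hs (φ z) fun a ha => by
        rw [← map_smul, smul_hm_eq_zero (hk a ha), map_zero]
      exact Submodule.mem_span_singleton.mpr ⟨c, hc.symm⟩
  have hf : Function.Injective f := by
    rw [injective_iff_map_eq_zero]
    intro φ hφ
    refine LinearMap.ext fun y => ?_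
    obtain ⟨a, ha⟩ := hm (hzero A M y)
    have : y = a • z := hzero_injective (by rw [ha, map_smul, hz])
    have h0 : φ z = 0 := congrArg Subtype.val hφ
    rw [this, map_smul, h0, smul_zero, LinearMap.zero_apply]
  refine (lp_le_of_injective q f hf).trans (lp_le_one q ⟨u, Submodule.mem_span_singleton_self u⟩
    (fun y => ?_) fun a ha => Subtype.ext (hmu a (hq ha)))
  obtain ⟨c, hc⟩ := Submodule.mem_span_singleton.mp y.2
  exact ⟨c, Subtype.ext hc.symm⟩

omit [IsLocalRing A] in
theorem torFree_of_isAssociatedPrime {q : PrimeSpectrum A} {U : Type} [AddCommGroup U] [Module A U]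
    (hk : ∀ a ∈ q.asIdeal, ∀ u : U, a • u = 0)
    (hass : ∀ p, IsAssociatedPrime p U → p = q.asIdeal) : TorFree q.asIdeal U := fun u hu a => by
  refine ⟨fun h => ?_, fun h => hk a h u⟩
  by_contra ha
  exact hu (eq_zero_of_smul_eq_zero (fun p hp => by rwa [hass p hp]) h)

theorem lp_dual_quotient_le [IsPrecomplete (maximalIdeal A) A] (hE : IsMatlis A E) (e : ℕ) :
    ∀ q : PrimeSpectrum A, Order.coheight q = e →
      lp q (Hm A e (A ⧸ q.asIdeal) →ₗ[A] E) ≤ 1 := by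
  induction e with
  | zero =>
    intro q hq
    have hmax : q.asIdeal = maximalIdeal A :=
      le_antisymm (le_maximalIdeal q.2.ne_top) ((Order.coheight_eq_zero.mp hq)
        (b := ⟨maximalIdeal A, inferInstance⟩) (le_maximalIdeal q.2.ne_top))
    refine lp_dual_hzero_le hE (dimLE_quotient q hq).isTor (Submodule.Quotient.mk 1)
      (fun y => ?_) (fun a ha y => ?_) hmax.le
    · obtain ⟨a, rfl⟩ := Submodule.mkQ_surjective _ y
      exact ⟨a, by rw [← Submodule.Quotient.mk_smul, smul_eq_mul, mul_one]; rfl⟩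
    · obtain ⟨b, rfl⟩ := Submodule.mkQ_surjective _ y
      rw [← map_smul, Submodule.mkQ_apply, Submodule.Quotient.mk_eq_zero, hmax]
      exact Ideal.mul_mem_right _ _ ha
  | succ e ih =>
    intro q hq
    have hqm : ∃ x ∈ maximalIdeal A, x ∉ q.asIdeal := by
      by_contra! h
      have : IsMax q := fun r hr => (le_maximalIdeal r.2.ne_top).trans h
      rw [Order.coheight_eq_zero.mpr this] at hq
      exact absurd (by exact_mod_cast hq : 0 = e + 1) (by omega)
    obtain ⟨x, hxm, hx⟩ := hqm
    obtain ⟨q', hqq', hxq', hq'⟩ := exists_coheight_of_mem q hq hxm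
    have := hE.finite_dual_hm (e + 1) (A ⧸ q.asIdeal)
    have hk : ∀ a ∈ q.asIdeal, ∀ y : A ⧸ q.asIdeal, a • y = 0 := fun a ha y => by
      obtain ⟨b, rfl⟩ := Submodule.mkQ_surjective _ y
      rw [← map_smul, Submodule.mkQ_apply, Submodule.Quotient.mk_eq_zero]
      exact Ideal.mul_mem_right _ _ ha
    have htf : TorFree q.asIdeal (Hm A (e + 1) (A ⧸ q.asIdeal) →ₗ[A] E) := by
      refine torFree_of_isAssociatedPrime (fun a ha => smul_dual_hm_eq_zero (hk a ha) _)
        fun p hp => ?_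
      have hco := (dimLE_quotient q hq).coheight_eq ⟨p, hp.isPrime⟩ hp
      have hann := annihilator_le_of_isAssociatedPrime_dual hp
      rw [Ideal.annihilator_quotient] at hann
      by_contra hne
      obtain ⟨a, ha, hap⟩ := exists_mem_notMem_of_dimLE hco hq.le
        (fun h => hne (congrArg PrimeSpectrum.asIdeal h).symm)
      exact hap (hann ha)
    refine htf.lp_le_one hq hq' hx (fun h0 => ?_)
      (lp_quotSMulTop_dual_le_of_prime hE hq' (ih q' hq') (isSMulRegular_quotient_prime q.2 hx)
        (DimLE.quotSMulTop_quotient hq hx))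
    obtain ⟨f, hf⟩ := exists_surjective_quotSMulTop_quotient hqq'.le hxq'
    have := (lp_le_of_surjective q' f hf).trans h0.le
    rw [lp_quotient_self] at this
    exact absurd this (by simp)

/-- The dual of top local cohomology has rank at most that of the module. -/
theorem DimLE.lp_dual_le [IsPrecomplete (maximalIdeal A) A] (hE : IsMatlis A E) {e : ℕ}
    {q : PrimeSpectrum A} (hq : Order.coheight q = e) [Module.Finite A M] (h : DimLE A M e) :
    lp q (Hm A e M →ₗ[A] E) ≤ lp q M :=
  lp_dual_le_of_prime hE hq (lp_dual_quotient_le hE e q hq) h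

/-- The dual of the top local cohomology of `A` has rank at most one. -/
theorem rank_dual_le [IsPrecomplete (maximalIdeal A) A] (hE : IsMatlis A E) {d : ℕ}
    (hd : ringKrullDim A = d) {p : Ideal A} (hp : IsAssociatedPrime p (Hm A d A →ₗ[A] E))
    (r : ℕ) (m : Fin r → (Hm A d A →ₗ[A] E))
    (hm : ∀ a : Fin r → A, ∑ i, a i • m i = 0 → ∃ t ∉ p, ∀ i, t * a i = 0) : r ≤ 1 := by
  by_contra! hr
  have h0 : 0 < r := by omega
  have hne : (⟨0, h0⟩ : Fin r) ≠ ⟨1, hr⟩ := by simp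
  have hD := dimLE_self hd A
  let q : PrimeSpectrum A := ⟨p, hp.isPrime⟩
  have hq : Order.coheight q = d := hD.coheight_eq q hp
  have h1 := hD.lp_dual_le hE hq
  have hfin := lp_lt_top q hq hD
  let f : (A × A) →ₗ[A] (Hm A d A →ₗ[A] E) :=
    (LinearMap.toSpanSingleton A _ (m ⟨0, h0⟩)).coprod
      (LinearMap.toSpanSingleton A _ (m ⟨1, hr⟩))
  have hker : lp q (LinearMap.ker f) = 0 := by
    refine (lp_eq_zero_iff q).mpr fun y => ?_
    obtain ⟨⟨a, b⟩, h⟩ := y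
    obtain ⟨t, ht, h2⟩ := hm (Pi.single ⟨0, h0⟩ a + Pi.single ⟨1, hr⟩ b) (by
      simp only [Pi.add_apply, add_smul, Finset.sum_add_distrib, Pi.single_apply, ite_smul,
        zero_smul, Finset.sum_ite_eq', Finset.mem_univ, if_true]
      exact h)
    refine ⟨t, ht, Subtype.ext (Prod.ext ?_ ?_)⟩
    · simpa [Pi.single_apply, hne, hne.symm] using h2 ⟨0, h0⟩
    · simpa [Pi.single_apply, hne, hne.symm] using h2 ⟨1, hr⟩
  have h2 := lp_exact q (LinearMap.ker f).subtype f.rangeRestrict (Submodule.injective_subtype _)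
    f.surjective_rangeRestrict (by rw [LinearMap.exact_iff]; simp)
  have h3 := lp_exact q (LinearMap.inl A A A) (LinearMap.snd A A A) LinearMap.inl_injective
    LinearMap.snd_surjective (by rw [LinearMap.exact_iff, LinearMap.ker_snd])
  have h4 := lp_le_of_injective q (LinearMap.range f).subtype (Submodule.injective_subtype _)
  rw [hker, zero_add, h3] at h2
  rw [← h2] at h4
  have h5 := h4.trans h1
  obtain ⟨c, hc⟩ := ENat.ne_top_iff_exists.mp hfin.ne
  rw [← hc] at h5
  have h6 : c + c ≤ c := by exact_mod_cast h5
  have h7 : lp q A = 0 := by rw [← hc]; exact_mod_cast (by omega : c = 0)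
  obtain ⟨s, hs, h⟩ := (lp_eq_zero_iff q).mp h7 1
  rw [smul_eq_mul, mul_one] at h
  exact hs (h ▸ q.asIdeal.zero_mem)

end DualRank
section Dual

variable {A : Type} [CommRing A]

theorem FFR.congr {n : ℕ} : ∀ {M N : Type} [AddCommGroup M] [Module A M] [AddCommGroup N]
    [Module A N], (M ≃ₗ[A] N) → FFR A n M → FFR A n N := by
  induction n with
  | zero =>
    intro M N _ _ _ _ e h
    have := h.1
    have := h.2
    exact ⟨Module.Finite.equiv e, Module.Free.of_equiv e⟩
  | succ n ih =>
    intro M N _ _ _ _ e ⟨r, f, hf, h⟩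
    refine ⟨r, e.toLinearMap ∘ₗ f, e.surjective.comp hf, ih (LinearEquiv.ofEq _ _ ?_) h⟩
    ext x
    simp

/-- A finite module over a local ring has a generating family all of whose relations have
coefficients in the maximal ideal. -/
theorem exists_minimal_generators [IsLocalRing A] (M : Type) [AddCommGroup M] [Module A M]
    [Module.Finite A M] : ∃ (r : ℕ) (m : Fin r → M), Submodule.span A (Set.range m) = ⊤ ∧
      ∀ a : Fin r → A, ∑ i, a i • m i = 0 → ∀ i, a i ∈ maximalIdeal A := by
  classical
  have hex : ∃ (r : ℕ), ∃ (m : Fin r → M), Submodule.span A (Set.range m) = ⊤ :=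
    Submodule.fg_iff_exists_fin_generating_family.mp Module.Finite.fg_top
  obtain ⟨r, ⟨m, hm⟩, hmin⟩ : ∃ r : ℕ, (∃ m : Fin r → M, Submodule.span A (Set.range m) = ⊤) ∧
      ∀ s < r, ¬ ∃ m : Fin s → M, Submodule.span A (Set.range m) = ⊤ :=
    ⟨Nat.find hex, Nat.find_spec hex, fun s hs => Nat.find_min hex hs⟩
  refine ⟨r, m, hm, fun a ha i => ?_⟩
  by_contra hai
  rw [mem_maximalIdeal, mem_nonunits_iff, not_not] at hai
  obtain ⟨u, hu⟩ := hai
  obtain ⟨s, rfl⟩ : ∃ s, r = s + 1 := ⟨r - 1, by have := i.2; omega⟩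
  refine hmin s (Nat.lt_succ_self s) ⟨m ∘ i.succAbove, top_le_iff.mp ?_⟩
  rw [← hm, Submodule.span_le]
  rintro _ ⟨j, rfl⟩
  rcases Fin.eq_self_or_eq_succAbove i j with rfl | ⟨k, rfl⟩
  · rw [Fin.sum_univ_succAbove _ j, ← hu] at ha
    have : m j = -((u⁻¹ : Aˣ) : A) • ∑ k, a (j.succAbove k) • m (j.succAbove k) := by
      rw [← neg_eq_iff_add_eq_zero.mpr ha, smul_neg, neg_smul, neg_neg, smul_smul,
        Units.inv_mul, one_smul]
    rw [SetLike.mem_coe, this]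
    exact Submodule.smul_mem _ _ (Submodule.sum_mem _ fun k _ => Submodule.smul_mem _ _
      (Submodule.subset_span ⟨k, rfl⟩))
  · exact Submodule.subset_span ⟨k, rfl⟩

section Shift

variable {M J C : Type} [AddCommGroup M] [Module A M] [AddCommGroup J] [Module A J]
  [AddCommGroup C] [Module A C]

theorem subsingleton_ext_cokernel (X : ModuleCat A) (hJ : Module.Injective A J) (f : M →ₗ[A] J)
    (g : J →ₗ[A] C) (hf : Function.Injective f) (hg : Function.Surjective g)
    (h : Function.Exact f g) {j : ℕ} (hj : 0 < j)
    (hM : Subsingleton (Abelian.Ext X (ModuleCat.of A M) (j + 1))) :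
    Subsingleton (Abelian.Ext X (ModuleCat.of A C) j) := by
  have hS := shortExact_mk f g hf hg h
  have := Module.injective_object_of_injective_module A J
  refine subsingleton_of_forall_eq 0 fun x => ?_
  obtain ⟨y, rfl⟩ := Abelian.Ext.covariant_sequence_exact₃ X hS x rfl (hM.elim _ _)
  obtain ⟨j, rfl⟩ : ∃ i, j = i + 1 := ⟨j - 1, by omega⟩
  rw [Abelian.Ext.eq_zero_of_injective y, Abelian.Ext.zero_comp]

theorem exists_lift_of_subsingleton_ext {X : Type} [AddCommGroup X] [Module A X] (f : M →ₗ[A] J)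
    (g : J →ₗ[A] C) (hf : Function.Injective f) (hg : Function.Surjective g)
    (h : Function.Exact f g)
    (hM : Subsingleton (Abelian.Ext (ModuleCat.of A X) (ModuleCat.of A M) 1)) (φ : X →ₗ[A] C) :
    ∃ ψ : X →ₗ[A] J, g ∘ₗ ψ = φ := by
  have hS := shortExact_mk f g hf hg h
  obtain ⟨y, hy⟩ := Abelian.Ext.covariant_sequence_exact₃ (ModuleCat.of A X) hS
    (Abelian.Ext.mk₀ (ModuleCat.ofHom φ)) (zero_add 1) (hM.elim _ _)
  obtain ⟨ψ, rfl⟩ := (Abelian.Ext.mk₀_bijective _ _).2 y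
  rw [Abelian.Ext.mk₀_comp_mk₀] at hy
  have := (Abelian.Ext.mk₀_bijective _ _).1 hy
  exact ⟨ψ.hom, congrArg ModuleCat.Hom.hom this⟩

end Shift

variable [IsLocalRing A] [IsNoetherianRing A] {E : Type} [AddCommGroup E] [Module A E]
  {N : Type} [AddCommGroup N] [Module A N]

/-- Endomorphisms of `E` are homotheties, hence functionals on `E ^ r` are rows of scalars. -/
theorem IsMatlis.exists_eq_sum [IsAdicComplete (maximalIdeal A) A] (hE : IsMatlis A E) {r : ℕ}
    (θ : (Fin r → E) →ₗ[A] E) : ∃ a : Fin r → A, ∀ e, θ e = ∑ i, a i • e i := by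
  classical
  choose a ha using fun i => hE.exists_eq_smul (θ ∘ₗ LinearMap.single A (fun _ => E) i)
  refine ⟨a, fun e => ?_⟩
  conv_lhs => rw [← LinearMap.sum_single_apply (fun _ : Fin r => E) e, map_sum]
  exact Finset.sum_congr rfl fun i _ => ha i (e i)

theorem IsMatlis.eq_zero_of_sum [IsAdicComplete (maximalIdeal A) A] (hE : IsMatlis A E) {r : ℕ}
    (a : Fin r → A) (h : ∀ e : Fin r → E, ∑ i, a i • e i = 0) : a = 0 := by
  classical
  funext i
  refine hE.eq_zero _ fun e => ?_
  have := h (Pi.single i e)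
  rwa [Finset.sum_eq_single i (fun j _ hj => by rw [Pi.single_eq_of_ne hj, smul_zero])
    (fun h => absurd (Finset.mem_univ i) h), Pi.single_eq_same] at this

omit [IsNoetherianRing A] in
theorem IsMatlis.injective_pi (hE : IsMatlis A E) {r : ℕ} {φ : Fin r → (N →ₗ[A] E)}
    (hφ : Submodule.span A (Set.range φ) = ⊤) : Function.Injective (LinearMap.pi φ) := by
  rw [injective_iff_map_eq_zero]
  intro n hn
  by_contra h0
  obtain ⟨χ, hχ⟩ := hE.exists_hom_ne_zero n h0
  apply hχ
  clear hχ
  have : χ ∈ Submodule.span A (Set.range φ) := hφ ▸ Submodule.mem_top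
  induction this using Submodule.span_induction with
  | mem x hx => obtain ⟨i, rfl⟩ := hx; exact congrFun hn i
  | zero => rfl
  | add x y _ _ hx hy => rw [LinearMap.add_apply, hx, hy, add_zero]
  | smul a x _ hx => rw [LinearMap.smul_apply, hx, smul_zero]

/-- The first syzygy of the dual is the dual of the first cosyzygy. -/
theorem IsMatlis.nonempty_dual_cokernel_equiv [IsAdicComplete (maximalIdeal A) A]
    (hE : IsMatlis A E) {r : ℕ} (φ : Fin r → (N →ₗ[A] E)) :
    Nonempty ((((Fin r → E) ⧸ LinearMap.range (LinearMap.pi φ)) →ₗ[A] E) ≃ₗ[A]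
      LinearMap.ker (Fintype.linearCombination A φ)) := by
  let T : (Fin r → A) →ₗ[A] ((Fin r → E) →ₗ[A] E) :=
    Fintype.linearCombination A (fun i => LinearMap.proj i)
  have hTa (a : Fin r → A) (e : Fin r → E) : T a e = ∑ i, a i • e i := by
    simp [T, Fintype.linearCombination_apply]
  have hT : Function.Bijective T := by
    constructor
    · rw [injective_iff_map_eq_zero]
      intro a ha
      exact hE.eq_zero_of_sum a fun e => by rw [← hTa, ha, LinearMap.zero_apply]
    · intro θ
      obtain ⟨a, ha⟩ := hE.exists_eq_sum θ
      exact ⟨a, LinearMap.ext fun e => by rw [hTa, ha]⟩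
  let T' := LinearEquiv.ofBijective T hT
  let S := T'.symm.toLinearMap ∘ₗ LinearMap.lcomp A E (LinearMap.range (LinearMap.pi φ)).mkQ
  have hS : Function.Injective S :=
    T'.symm.injective.comp (lcomp_injective _ (Submodule.mkQ_surjective _))
  have hex := lcomp_exact hE.inj (LinearMap.pi φ) (LinearMap.range (LinearMap.pi φ)).mkQ
    (by rw [LinearMap.exact_iff]; simp)
  refine ⟨(LinearEquiv.ofInjective S hS).trans (LinearEquiv.ofEq _ _ ?_)⟩
  have hcomp : LinearMap.lcomp A E (LinearMap.pi φ) ∘ₗ T = Fintype.linearCombination A φ := by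
    refine LinearMap.ext fun a => LinearMap.ext fun n => ?_
    simp [hTa, Fintype.linearCombination_apply]
  ext a
  rw [LinearMap.mem_ker, ← hcomp, LinearMap.comp_apply, hex (T a)]
  constructor
  · rintro ⟨χ, rfl⟩
    exact ⟨χ, (T'.apply_symm_apply _).symm⟩
  · rintro ⟨χ, hχ⟩
    exact ⟨χ, T'.injective ((T'.apply_symm_apply _).trans hχ)⟩

omit [IsNoetherianRing A] in
theorem IsTor.pi_quotient (hE : IsMatlis A E) {r : ℕ} (K : Submodule A (Fin r → E)) :
    IsTor A ((Fin r → E) ⧸ K) :=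
  (hE.tor.finsupp_fun r).of_surjective K.mkQ (Submodule.mkQ_surjective _)

/-- Duals of torsion modules of finite injective dimension have finite free resolutions. -/
theorem IsMatlis.ffr_dual [IsAdicComplete (maximalIdeal A) A] (hE : IsMatlis A E) (n : ℕ) :
    ∀ (N : Type) [AddCommGroup N] [Module A N], Module.Finite A (N →ₗ[A] E) →
      (∀ j, n < j → Subsingleton (Abelian.Ext (ModuleCat.of A (A ⧸ maximalIdeal A))
        (ModuleCat.of A N) j)) → FFR A n (N →ₗ[A] E) := by
  have hpi (r : ℕ) : Module.Injective A (Fin r → E) := by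
    have := hE.inj
    infer_instance
  induction n with
  | zero =>
    intro N _ _ _ hN
    obtain ⟨r, φ, hφ, hmin⟩ := exists_minimal_generators (A := A) (N →ₗ[A] E)
    have hinj := hE.injective_pi hφ
    obtain ⟨e⟩ := hE.nonempty_dual_cokernel_equiv φ
    have hC : Subsingleton ((Fin r → E) ⧸ LinearMap.range (LinearMap.pi φ)) := by
      refine subsingleton_of_forall_eq 0 fun c₀ => ?_
      by_contra hc₀
      obtain ⟨b, hc, hkill⟩ := exists_socle (IsTor.pi_quotient hE _) c₀ hc₀
      generalize b • c₀ = c at hc hkill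
      let q : (A ⧸ maximalIdeal A) →ₗ[A] ((Fin r → E) ⧸ LinearMap.range (LinearMap.pi φ)) :=
        Submodule.liftQ _ (LinearMap.toSpanSingleton A _ c) hkill
      obtain ⟨ψ, hψ⟩ := exists_lift_of_subsingleton_ext (LinearMap.pi φ) _ hinj
        (Submodule.mkQ_surjective _) (by rw [LinearMap.exact_iff]; simp) (hN 1 one_pos) q
      obtain ⟨χ, hχ⟩ := hE.exists_hom_ne_zero c hc
      obtain ⟨a, ha⟩ := hE.exists_eq_sum
        (χ ∘ₗ (LinearMap.range (LinearMap.pi φ)).mkQ)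
      have hqc : q (Submodule.Quotient.mk 1) = c := one_smul A c
      have ham := hmin a <| LinearMap.ext fun y => by
        have h1 := ha (LinearMap.pi φ y)
        have h2 : (LinearMap.range (LinearMap.pi φ)).mkQ (LinearMap.pi φ y) = 0 :=
          (Submodule.Quotient.mk_eq_zero _).mpr ⟨y, rfl⟩
        rw [LinearMap.comp_apply, h2, map_zero] at h1
        simpa using h1.symm
      apply hχ
      have h3 := ha (ψ (Submodule.Quotient.mk 1))
      rw [← hqc, ← LinearMap.congr_fun hψ (Submodule.Quotient.mk 1)]
      refine h3.trans ?_
      refine Finset.sum_eq_zero fun i _ => ?_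
      rw [← Pi.smul_apply, ← map_smul, ← Submodule.Quotient.mk_smul,
        (Submodule.Quotient.mk_eq_zero _).mpr, map_zero, Pi.zero_apply]
      exact Ideal.mul_mem_right _ _ (ham i)
    have hker : LinearMap.ker (Fintype.linearCombination A φ) = ⊥ :=
      (Submodule.subsingleton_iff_eq_bot).mp e.symm.toEquiv.subsingleton
    have hsurj : Function.Surjective (Fintype.linearCombination A φ) := by
      rw [← LinearMap.range_eq_top, Fintype.range_linearCombination, hφ]
    exact ⟨inferInstance, Module.Free.of_equiv
      (LinearEquiv.ofBijective _ ⟨LinearMap.ker_eq_bot.mp hker, hsurj⟩)⟩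
  | succ n ih =>
    intro N _ _ _ hN
    obtain ⟨r, φ, hφ, -⟩ := exists_minimal_generators (A := A) (N →ₗ[A] E)
    have hinj := hE.injective_pi hφ
    obtain ⟨e⟩ := hE.nonempty_dual_cokernel_equiv φ
    have hsurj : Function.Surjective (Fintype.linearCombination A φ) := by
      rw [← LinearMap.range_eq_top, Fintype.range_linearCombination, hφ]
    refine ⟨r, _, hsurj, (ih _ (Module.Finite.equiv e.symm) fun j hj => ?_).congr e⟩
    exact subsingleton_ext_cokernel _ (hpi r) (LinearMap.pi φ) _ hinj
      (Submodule.mkQ_surjective _) (by rw [LinearMap.exact_iff]; simp) (by omega)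
      (hN (j + 1) (by omega))

end Dual

section Complete

variable {A : Type} [CommRing A] [IsLocalRing A] [IsNoetherianRing A]
  {E : Type} [AddCommGroup E] [Module A E] {M : Type} [AddCommGroup M] [Module A M]

theorem DimLE.isAssociatedPrime_of_dual [Module.Finite A M] {e : ℕ} (h : DimLE A M e)
    {p : Ideal A} (hp : IsAssociatedPrime p (Hm A e M →ₗ[A] E)) : IsAssociatedPrime p M :=
  Module.associatedPrimes.minimalPrimes_annihilator_subset_associatedPrimes A M
    (mem_minimalPrimes_of_coheight h ⟨p, hp.isPrime⟩
      (annihilator_le_of_isAssociatedPrime_dual hp) (h.coheight_eq ⟨p, hp.isPrime⟩ hp))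

omit [IsLocalRing A] in
theorem notMem_of_isAssociatedPrime {x : A} (hx : x ∈ nonZeroDivisors A) {p : Ideal A}
    (hp : IsAssociatedPrime p A) : x ∉ p := fun hxp => by
  have : x ∈ ((nonZeroDivisors A : Set A))ᶜ := by
    rw [← biUnion_associatedPrimes_eq_compl_nonZeroDivisors]
    exact Set.mem_biUnion hp hxp
  exact this hx

theorem isAssociatedPrime_quotSMulTop_dual (hE : Module.Injective A E) {d : ℕ}
    (hd : ringKrullDim A = d) {x : A} (hx : x ∈ nonZeroDivisors A) (hxm : x ∈ maximalIdeal A)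
    {p : Ideal A} (hp : IsAssociatedPrime p (QuotSMulTop x (Hm A d A →ₗ[A] E))) :
    IsAssociatedPrime p (A ⧸ Ideal.span {x}) := by
  cases d with
  | zero =>
    have h := dimLE_self hd A
    have hm : IsAssociatedPrime (maximalIdeal A) A :=
      Module.associatedPrimes.minimalPrimes_annihilator_subset_associatedPrimes A A
        (mem_minimalPrimes_of_coheight h ⟨maximalIdeal A, inferInstance⟩
          (by rw [Module.annihilator_eq_bot.mpr inferInstance]; exact bot_le)
          (Order.coheight_eq_zero.mpr fun q _ => le_maximalIdeal q.2.ne_top))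
    exact absurd hxm (notMem_of_isAssociatedPrime hx hm)
  | succ e =>
    have hreg : IsSMulRegular A x := fun a b hab =>
      mul_cancel_left_mem_nonZeroDivisors hx |>.mp hab
    obtain ⟨ψ, hψ⟩ := exists_dual_δ hE x hreg e
    have h1 : DimLE A (QuotSMulTop x A) e := (dimLE_self hd A).quotSMulTop x
      fun q hq => notMem_of_isAssociatedPrime hx hq
    have h2 := h1.isAssociatedPrime_of_dual (hp.map_of_injective (Submodule.liftQ _ ψ hψ.ge)
      (LinearMap.ker_eq_bot.mp (Submodule.ker_liftQ_eq_bot _ _ _ hψ.le)))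
    refine (LinearEquiv.isAssociatedPrime_iff (Submodule.quotEquivOfEq _ _ ?_)).mp h2
    ext a
    rw [Submodule.mem_smul_pointwise_iff_exists, Ideal.mem_span_singleton]
    exact ⟨fun ⟨b, _, hb⟩ => ⟨b, hb.symm⟩, fun ⟨b, hb⟩ => ⟨b, trivial, hb.symm⟩⟩

/-- If the Matlis dual of a torsion module is free of rank one, the module is `E`. -/
theorem IsMatlis.nonempty_equiv_of_dual (hE : IsMatlis A E) {H : Type} [AddCommGroup H]
    [Module A H] (e : (H →ₗ[A] E) ≃ₗ[A] A) [IsAdicComplete (maximalIdeal A) A] :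
    Nonempty (H ≃ₗ[A] E) := by
  let φ := e.symm 1
  have hφ (χ : H →ₗ[A] E) : χ = e χ • φ := by
    rw [← map_smul, smul_eq_mul, mul_one, e.symm_apply_apply]
  have hinj : Function.Injective φ := by
    rw [injective_iff_map_eq_zero]
    intro h hh
    by_contra h0
    obtain ⟨χ, hχ⟩ := hE.exists_hom_ne_zero h h0
    rw [hφ χ, LinearMap.smul_apply, hh, smul_zero] at hχ
    exact hχ rfl
  refine ⟨LinearEquiv.ofBijective φ ⟨hinj, fun y => ?_⟩⟩
  by_contra hy
  have hc : (LinearMap.range φ).mkQ y ≠ 0 := fun h => hy ((Submodule.Quotient.mk_eq_zero _).mp h)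
  obtain ⟨χ, hχ⟩ := hE.exists_hom_ne_zero _ hc
  obtain ⟨a, ha⟩ := hE.exists_eq_smul (χ ∘ₗ (LinearMap.range φ).mkQ)
  have h0 : a • φ = 0 := LinearMap.ext fun h => by
    have h2 : (LinearMap.range φ).mkQ (φ h) = 0 := (Submodule.Quotient.mk_eq_zero _).mpr ⟨h, rfl⟩
    have := ha (φ h)
    rw [LinearMap.comp_apply, h2, map_zero] at this
    exact this.symm
  rw [← map_smul, smul_eq_mul, mul_one, LinearEquiv.map_eq_zero_iff] at h0
  apply hχ
  rw [← LinearMap.comp_apply, ha, h0, zero_smul]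

theorem IsMatlis.nonempty_hm_equiv [IsAdicComplete (maximalIdeal A) A] (hE : IsMatlis A E) {d : ℕ}
    (hd : ringKrullDim A = d) (n : ℕ)
    (hn : ∀ j, n < j → Subsingleton (Abelian.Ext (ModuleCat.of A (A ⧸ maximalIdeal A))
      (ModuleCat.of A (Hm A d A)) j)) : Nonempty (Hm A d A ≃ₗ[A] E) := by
  have hfin := hE.finite_dual_hm d A
  have hnt : Nontrivial (Hm A d A →ₗ[A] E) := by
    have := not_subsingleton_iff_nontrivial.mp (not_subsingleton_hm hd)
    obtain ⟨z, hz⟩ := exists_ne (0 : Hm A d A)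
    obtain ⟨φ, hφ⟩ := hE.exists_hom_ne_zero z hz
    exact ⟨φ, 0, fun h => hφ (by rw [h]; rfl)⟩
  obtain ⟨p, hp⟩ := associatedPrimes.nonempty A (Hm A d A →ₗ[A] E)
  obtain ⟨e⟩ := linearEquiv_of_ffr n (hE.ffr_dual n _ hfin hn)
    (fun q hq => (dimLE_self hd A).isAssociatedPrime_of_dual hq)
    (fun x hx hxm q hq => isAssociatedPrime_quotSMulTop_dual hE.inj hd hx hxm hq) p hp
    (rank_dual_le hE hd hp)
  exact hE.nonempty_equiv_of_dual e

end Complete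

section OldExt

open Opposite

variable {R : Type} [CommRing R]

/-- Two surjections with the same kernel have isomorphic targets. -/
theorem exists_equiv_of_ker_eq {Z U V : Type} [AddCommGroup Z] [Module R Z] [AddCommGroup U]
    [Module R U] [AddCommGroup V] [Module R V] (c : Z →ₗ[R] U) (ψ : Z →ₗ[R] V)
    (hc : Function.Surjective c) (hψ : Function.Surjective ψ)
    (h : LinearMap.ker c = LinearMap.ker ψ) : ∃ e : U ≃ₗ[R] V, ∀ z, e (c z) = ψ z := by
  refine ⟨(c.quotKerEquivOfSurjective hc).symm.trans
    ((Submodule.quotEquivOfEq _ _ h).trans (ψ.quotKerEquivOfSurjective hψ)), fun z => ?_⟩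
  have : (c.quotKerEquivOfSurjective hc).symm (c z) = Submodule.Quotient.mk z := by
    rw [LinearEquiv.symm_apply_eq]; rfl
  rw [LinearEquiv.trans_apply, this]
  rfl

variable {X X' : ModuleCat.{0} R} (P : ProjectiveResolution X) (P' : ProjectiveResolution X')
  (Y : ModuleCat.{0} R) (n : ℕ)

theorem extMk_zero_eq_zero_iff (f : P.complex.X 0 ⟶ Y) (hf : P.complex.d 1 0 ≫ f = 0) :
    P.extMk f 1 rfl hf = 0 ↔ f = 0 := by
  constructor
  · intro h
    rw [← P.extEquivCohomologyClass.apply_eq_iff_eq, P.extEquivCohomologyClass_extMk,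
      P.extEquivCohomologyClass_zero, CochainComplex.HomComplex.CohomologyClass.mk_eq_zero_iff,
      CochainComplex.HomComplex.Cocycle.toSingleMk_mem_coboundaries_iff _ _ _ _ _ 1 (by lia)] at h
    obtain ⟨g, hg⟩ := h
    have h0 : Limits.IsZero (P.cochainComplex.X 1) :=
      HomologicalComplex.isZero_extend_X _ _ _ fun i hi => by
        simp at hi
        omega
    rw [h0.eq_of_src g 0, Limits.comp_zero] at hg
    rw [← cancel_epi (P.cochainComplexXIso (-(0 : ℕ)) 0 rfl).hom, ← hg, Limits.comp_zero]
  · rintro rfl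
    exact P.extMk_zero 1 rfl

/-- The complex computing the left derived functors of `Hom (-, Y)`. -/
noncomputable abbrev homComplex : ChainComplex (ModuleCat.{0} R)ᵒᵖ ℕ :=
  (((linearYoneda R (ModuleCat.{0} R)).obj Y).rightOp.mapHomologicalComplex _).obj P.complex

/-- The cocycles of degree `n`. -/
noncomputable abbrev Cocyc : ModuleCat.{0} R := ((homComplex P Y).opcycles n).unop

/-- A cocycle, as a morphism. -/
noncomputable def Cocyc.incl : Cocyc P Y n →ₗ[R] (P.complex.X n ⟶ Y) :=
  ((homComplex P Y).pOpcycles n).unop.hom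

/-- The class of a cocycle. -/
noncomputable def Cocyc.cls : Cocyc P Y n →ₗ[R]
    (((Ext R (ModuleCat.{0} R) n).obj (op X)).obj Y : Type) :=
  ((P.isoLeftDerivedObj ((linearYoneda R (ModuleCat.{0} R)).obj Y).rightOp n).hom ≫
    (homComplex P Y).homologyι n).unop.hom

theorem Cocyc.incl_injective : Function.Injective (Cocyc.incl P Y n) := by
  have : Mono ((homComplex P Y).pOpcycles n).unop := inferInstance
  exact (ModuleCat.mono_iff_injective _).mp this

theorem Cocyc.cls_surjective : Function.Surjective (Cocyc.cls P Y n) := by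
  have h1 : Mono ((homComplex P Y).homologyι n) := inferInstance
  have h2 : Mono ((P.isoLeftDerivedObj ((linearYoneda R (ModuleCat.{0} R)).obj Y).rightOp n).hom ≫
    (homComplex P Y).homologyι n) := mono_comp' inferInstance h1
  exact (ModuleCat.epi_iff_surjective _).mp (unop_epi_of_mono _)

theorem Cocyc.d_incl (z : Cocyc P Y n) (m : ℕ) : P.complex.d m n ≫ Cocyc.incl P Y n z = 0 := by
  have h := congrArg (fun f => f.unop.hom z) ((homComplex P Y).d_pOpcycles m n)
  exact h

theorem Cocyc.exists_incl (f : P.complex.X n ⟶ Y) (hf : P.complex.d (n + 1) n ≫ f = 0) :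
    ∃ z, Cocyc.incl P Y n z = f := by
  let k : (homComplex P Y).X n ⟶ op (ModuleCat.of R R) :=
    (ModuleCat.ofHom (LinearMap.toSpanSingleton R (P.complex.X n ⟶ Y) f)).op
  have hk : (homComplex P Y).d (n + 1) n ≫ k = 0 := by
    apply Quiver.Hom.unop_inj
    refine ModuleCat.hom_ext (LinearMap.ext_ring ?_)
    change P.complex.d (n + 1) n ≫ ((1 : R) • f) = 0
    rw [one_smul, hf]
  have h := (homComplex P Y).p_descOpcycles k (n + 1) (by simp) hk
  refine ⟨((homComplex P Y).descOpcycles k (n + 1) (by simp) hk).unop.hom (1 : R), ?_⟩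
  have h' := congrArg (fun f => f.unop.hom (1 : R)) h
  exact h'.trans (one_smul R f)

theorem Cocyc.cls_eq_zero_iff (z : Cocyc P Y n) : Cocyc.cls P Y n z = 0 ↔
    ∃ g : P.complex.X ((ComplexShape.down ℕ).next n) ⟶ Y,
      P.complex.d n ((ComplexShape.down ℕ).next n) ≫ g = Cocyc.incl P Y n z := by
  let K := homComplex P Y
  let m := (ComplexShape.down ℕ).next n
  have hex : (ShortComplex.mk (K.homologyι n) (K.fromOpcycles n m) (by simp)).Exact :=
    ShortComplex.exact_of_f_is_kernel _ (K.homologyIsKernel n m rfl)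
  have hex' := (ShortComplex.moduleCat_exact_iff _).mp hex.unop
  have hincl (g : P.complex.X m ⟶ Y) :
      Cocyc.incl P Y n ((K.fromOpcycles n m).unop.hom g) = P.complex.d n m ≫ g :=
    congrArg (fun f => f.unop.hom g) (K.p_fromOpcycles n m)
  have hi : Function.Injective
      (P.isoLeftDerivedObj ((linearYoneda R (ModuleCat.{0} R)).obj Y).rightOp n).hom.unop.hom :=
    (ModuleCat.mono_iff_injective _).mp inferInstance
  have h0 : Cocyc.cls P Y n z = 0 ↔ (K.homologyι n).unop.hom z = 0 :=
    ⟨fun h => hi (h.trans (map_zero _).symm), fun h => (congrArg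
      (P.isoLeftDerivedObj ((linearYoneda R (ModuleCat.{0} R)).obj Y).rightOp n).hom.unop.hom
      h).trans (map_zero _)⟩
  refine h0.trans ?_
  constructor
  · intro h
    obtain ⟨g, hg⟩ := hex' z h
    exact ⟨g, (hincl g).symm.trans (congrArg (Cocyc.incl P Y n) hg)⟩
  · rintro ⟨g, hg⟩
    have hz := Cocyc.incl_injective P Y n ((hincl g).trans hg)
    refine (congrArg _ hz.symm).trans (congrArg (fun f => f.unop.hom g)
      (show K.homologyι n ≫ K.fromOpcycles n m = 0 by simp))

/-- The class of a cocycle, in the `Ext`-group defined by the derived category. -/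
noncomputable def Cocyc.ext : Cocyc P Y n →ₗ[R] Abelian.Ext X Y n where
  toFun z := P.extMk (Cocyc.incl P Y n z) (n + 1) rfl (Cocyc.d_incl P Y n z (n + 1))
  map_add' z w := by
    rw [P.add_extMk]
    congr 1
    exact map_add _ z w
  map_smul' r z := by
    have h := P.extMk_comp_mk₀ (Cocyc.incl P Y n z) (n + 1) rfl (Cocyc.d_incl P Y n z (n + 1))
      (r • 𝟙 Y)
    rw [Abelian.Ext.mk₀_smul, Abelian.Ext.comp_smul, Abelian.Ext.comp_mk₀_id] at h
    rw [RingHom.id_apply, h]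
    congr 1
    rw [Linear.comp_smul, Category.comp_id]
    exact map_smul _ r z

theorem Cocyc.ext_surjective : Function.Surjective (Cocyc.ext P Y n) := by
  intro α
  obtain ⟨f, hf, h⟩ := P.extMk_surjective α (n + 1) rfl
  obtain ⟨z, hz⟩ := Cocyc.exists_incl P Y n f hf
  subst hz
  exact ⟨z, h⟩

theorem Cocyc.ext_eq_zero_iff (z : Cocyc P Y n) : Cocyc.ext P Y n z = 0 ↔
    ∃ g : P.complex.X ((ComplexShape.down ℕ).next n) ⟶ Y,
      P.complex.d n ((ComplexShape.down ℕ).next n) ≫ g = Cocyc.incl P Y n z := by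
  cases n with
  | zero =>
    refine (extMk_zero_eq_zero_iff P Y _ (Cocyc.d_incl P Y 0 z 1)).trans ?_
    have h0 : P.complex.d 0 ((ComplexShape.down ℕ).next 0) = 0 :=
      P.complex.shape _ _ (by simp)
    rw [h0]
    exact ⟨fun h => ⟨0, by rw [h, Limits.zero_comp]⟩, fun ⟨g, h⟩ => by rw [← h, Limits.zero_comp]⟩
  | succ m =>
    refine (P.extMk_eq_zero_iff _ (m + 1 + 1) rfl (Cocyc.d_incl P Y _ z _) m rfl).trans ?_
    rw [ChainComplex.next_nat_succ]

/-- The two versions of `Ext` agree. -/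
theorem exists_ext_equiv : ∃ e : (((Ext R (ModuleCat.{0} R) n).obj (op X)).obj Y : Type) ≃ₗ[R]
    Abelian.Ext X Y n, ∀ z, e (Cocyc.cls P Y n z) = Cocyc.ext P Y n z := by
  refine exists_equiv_of_ker_eq _ _ (Cocyc.cls_surjective P Y n) (Cocyc.ext_surjective P Y n) ?_
  ext z
  rw [LinearMap.mem_ker, LinearMap.mem_ker, Cocyc.cls_eq_zero_iff, Cocyc.ext_eq_zero_iff]

/-- The comparison of the two versions of `Ext`. -/
noncomputable def extEquiv : (((Ext R (ModuleCat.{0} R) n).obj (op X)).obj Y : Type) ≃ₗ[R]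
    Abelian.Ext X Y n := (exists_ext_equiv (projectiveResolution X) Y n).choose

theorem extEquiv_cls (z) : extEquiv Y n (Cocyc.cls (projectiveResolution X) Y n z) =
    Cocyc.ext (projectiveResolution X) Y n z :=
  (exists_ext_equiv (projectiveResolution X) Y n).choose_spec z

theorem exists_cls_naturality (g : X' ⟶ X) (φ : P'.complex ⟶ P.complex)
    (comm : φ.f 0 ≫ P.π.f 0 = P'.π.f 0 ≫ ((ChainComplex.single₀ _).map g).f 0)
    (z : Cocyc P Y n) : ∃ z' : Cocyc P' Y n,
      (((Ext R (ModuleCat.{0} R) n).map g.op).app Y).hom (Cocyc.cls P Y n z) =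
        Cocyc.cls P' Y n z' ∧ Cocyc.incl P' Y n z' = φ.f n ≫ Cocyc.incl P Y n z := by
  let F := ((linearYoneda R (ModuleCat.{0} R)).obj Y).rightOp
  let Φ : homComplex P' Y ⟶ homComplex P Y := (F.mapHomologicalComplex _).map φ
  refine ⟨(HomologicalComplex.opcyclesMap Φ n).unop.hom z, ?_, ?_⟩
  · have h1 := ProjectiveResolution.isoLeftDerivedObj_hom_naturality g P' P φ comm F n
    have h2 := HomologicalComplex.homologyι_naturality Φ n
    have h3 : (F.leftDerived n).map g ≫ ((P.isoLeftDerivedObj F n).hom ≫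
        (homComplex P Y).homologyι n) = ((P'.isoLeftDerivedObj F n).hom ≫
        (homComplex P' Y).homologyι n) ≫ HomologicalComplex.opcyclesMap Φ n :=
      (Category.assoc _ _ _).symm.trans ((congrArg (· ≫ (homComplex P Y).homologyι n) h1).trans
        ((Category.assoc _ _ _).trans ((congrArg ((P'.isoLeftDerivedObj F n).hom ≫ ·) h2).trans
          (Category.assoc _ _ _).symm)))
    exact congrArg (fun f => f.unop.hom z) h3
  · exact congrArg (fun f => f.unop.hom z) (HomologicalComplex.p_opcyclesMap Φ n)

theorem extEquiv_naturality (g : X' ⟶ X)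
    (x : (((Ext R (ModuleCat.{0} R) n).obj (op X)).obj Y : Type)) :
    extEquiv Y n ((((Ext R (ModuleCat.{0} R) n).map g.op).app Y).hom x) =
      (Abelian.Ext.mk₀ g).comp (extEquiv Y n x) (zero_add n) := by
  let P := projectiveResolution X
  let P' := projectiveResolution X'
  obtain ⟨z, rfl⟩ := Cocyc.cls_surjective P Y n x
  have comm : (ProjectiveResolution.lift g P' P).f 0 ≫ P.π.f 0 =
      P'.π.f 0 ≫ ((ChainComplex.single₀ _).map g).f 0 :=
    congrArg (fun f => f.f 0) (ProjectiveResolution.lift_commutes g P' P)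
  obtain ⟨z', h1, h2⟩ := exists_cls_naturality P P' Y n g _ comm z
  rw [h1, extEquiv_cls, extEquiv_cls]
  refine Eq.trans ?_ (P.mk₀_comp_extMk _ (n + 1) rfl (Cocyc.d_incl P Y n z (n + 1))
    (ProjectiveResolution.Hom.mk (ProjectiveResolution.lift g P' P) comm)).symm
  change P'.extMk (Cocyc.incl P' Y n z') (n + 1) rfl (Cocyc.d_incl P' Y n z' (n + 1)) = _
  congr 1

end OldExt

section Restrict

variable {R A : Type} [CommRing R] [CommRing A] [Algebra R A]

/-- Restriction of scalars. -/
noncomputable abbrev resF (R A : Type) [CommRing R] [CommRing A] [Algebra R A] :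
    ModuleCat.{0} A ⥤ ModuleCat.{0} R := ModuleCat.restrictScalars (algebraMap R A)

theorem injective_resF [Module.Flat R A] (X : ModuleCat.{0} A) [Injective X] :
    Injective ((resF R A).obj X) := by
  have hf : (algebraMap R A).Flat := (RingHom.flat_algebraMap_iff).mpr inferInstance
  have := ModuleCat.preservesFiniteLimits_extendScalars_of_flat hf
  exact Injective.injective_of_adjoint (ModuleCat.extendRestrictScalarsAdj (algebraMap R A)) X

variable (I : Ideal R) (hI : ∀ a : A, ∃ r : R, a - algebraMap R A r ∈ I.map (algebraMap R A))
include hI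

theorem bijective_map_resF (X Y : ModuleCat.{0} A)
    (hX : ∀ x : X, ∀ r ∈ I, algebraMap R A r • x = 0) :
    Function.Bijective ((resF R A).map (X := X) (Y := Y)) := by
  refine ⟨(resF R A).map_injective, fun f => ?_⟩
  have hX' (x : X) : ∀ b ∈ I.map (algebraMap R A), b • x = 0 := fun b hb => by
    have h : I.map (algebraMap R A) ≤ LinearMap.ker (LinearMap.toSpanSingleton A X x) :=
      Ideal.map_le_iff_le_comap.mpr fun r hr => hX x r hr
    exact h hb
  have hf (r : R) (x : X) : f.hom (algebraMap R A r • x : X) = (algebraMap R A r • f.hom x : Y) :=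
    LinearMap.map_smul f.hom r (show (resF R A).obj X from x)
  have hY (x : X) : ∀ b ∈ I.map (algebraMap R A), b • (f.hom x : Y) = 0 := fun b hb => by
    have h : I.map (algebraMap R A) ≤ LinearMap.ker (LinearMap.toSpanSingleton A Y (f.hom x)) :=
      Ideal.map_le_iff_le_comap.mpr fun r hr =>
        (hf r x).symm.trans ((congrArg f.hom (hX x r hr)).trans (map_zero f.hom))
    exact h hb
  refine ⟨ModuleCat.ofHom (X := X) (Y := Y)
    { toFun := fun x => f.hom x
      map_add' := fun x y => map_add f.hom x y
      map_smul' := fun a x => ?_ }, rfl⟩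
  obtain ⟨r, hr⟩ := hI a
  have h1 : a • x = algebraMap R A r • x := by
    rw [← sub_eq_zero, ← sub_smul]; exact hX' x _ hr
  have h2 : a • (f.hom x : Y) = algebraMap R A r • (f.hom x : Y) := by
    rw [← sub_eq_zero, ← sub_smul]; exact hY x _ hr
  exact (congrArg f.hom h1).trans ((hf r x).trans h2.symm)

open Abelian in
theorem bijective_mapExt_resF [Module.Flat R A] (X Y : ModuleCat.{0} A)
    (hX : ∀ x : X, ∀ r ∈ I, algebraMap R A r • x = 0) (n : ℕ) :
    Function.Bijective ((resF R A).mapExtAddHom X Y n) := by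
  induction n generalizing Y with
  | zero =>
    have := bijective_map_resF I hI X Y hX
    simpa [Ext.mapExactFunctor₀] using this
  | succ n hn =>
    let J : InjectivePresentation Y := Classical.arbitrary _
    let S := ShortComplex.mk _ _ (Limits.cokernel.condition J.f)
    have h1 : Injective S.X₂ := J.injective
    have h2 : Injective (S.map (resF R A)).X₂ := injective_resF _
    have hS : S.ShortExact := { exact := ShortComplex.exact_cokernel J.f }
    have := Ext.subsingleton_of_injective (X := X) (I := S.X₂) n
    have := Ext.subsingleton_of_injective (X := (resF R A).obj X) (I := (S.map (resF R A)).X₂) n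
    exact AddMonoidHom.bijective_of_surjective_of_bijective_of_right_exact _ _ _ _
      ((resF R A).mapExtAddHom X S.X₂ n) ((resF R A).mapExtAddHom X S.X₃ n)
      ((resF R A).mapExtAddHom X S.X₁ (n + 1))
      (by ext; simp [Ext.mapExactFunctor_comp, Ext.mapExactFunctor_mk₀]; rfl)
      (by ext; simp [Ext.mapExactFunctor_comp, Ext.mapExactFunctor_extClass]; rfl)
      ((ShortComplex.ab_exact_iff_function_exact _).mp
        (Ext.covariant_sequence_exact₃' X hS n (n + 1) rfl))
      ((ShortComplex.ab_exact_iff_function_exact _).mp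
        (Ext.covariant_sequence_exact₃' ((resF R A).obj X) (hS.map_of_exact (resF R A)) n (n + 1)
          rfl))
      (hn _).surjective (hn _)
      (fun x₁ ↦ Ext.covariant_sequence_exact₁ _ hS x₁ (by subsingleton) rfl)
      (fun y₁ ↦ Ext.covariant_sequence_exact₁ _ (hS.map_of_exact (resF R A)) y₁
        (by subsingleton) rfl)

omit hI in
theorem mapExt_resF_smul (X Y : ModuleCat.{0} A) (n : ℕ) (r : R) (e : Abelian.Ext X Y n) :
    (resF R A).mapExtAddHom X Y n (algebraMap R A r • e) =
      r • (resF R A).mapExtAddHom X Y n e := by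
  have h : algebraMap R A r • e =
      e.comp (Abelian.Ext.mk₀ (algebraMap R A r • 𝟙 Y)) (add_zero n) := by
    rw [Abelian.Ext.mk₀_smul, Abelian.Ext.comp_smul, Abelian.Ext.comp_mk₀_id]
  have h' : (resF R A).map (algebraMap R A r • 𝟙 Y) = r • 𝟙 _ := rfl
  rw [h, Functor.mapExtAddHom_apply, Functor.mapExtAddHom_apply,
    Abelian.Ext.mapExactFunctor_comp, Abelian.Ext.mapExactFunctor_mk₀, h',
    Abelian.Ext.mk₀_smul, Abelian.Ext.comp_smul, Abelian.Ext.comp_mk₀_id]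

end Restrict

section Pure

variable {R : Type} [CommRing R] {M : Type} [AddCommGroup M] [Module R M]

theorem flat_quotient_of_pure [Module.Flat R M] (u : R →ₗ[R] M)
    (hu : ∀ (J : Ideal R) (r : R), u r ∈ J • (⊤ : Submodule R M) → r ∈ J) :
    Module.Flat R (M ⧸ LinearMap.range u) := by
  rw [Module.Flat.iff_forall_isTrivialRelation]
  intro l f x hx
  choose m hm using fun i => (LinearMap.range u).mkQ_surjective (x i)
  have h1 : ∑ i, f i • m i ∈ LinearMap.range u := by
    rw [← (LinearMap.range u).ker_mkQ, LinearMap.mem_ker, map_sum, ← hx]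
    simp [hm]
  obtain ⟨r, hr⟩ := h1
  have h2 : r ∈ Ideal.span (Set.range f) := hu _ _ (by
    rw [hr]
    exact Submodule.sum_mem _ fun i _ => Submodule.smul_mem_smul
      (Ideal.subset_span ⟨i, rfl⟩) trivial)
  obtain ⟨s, hs⟩ := Ideal.mem_span_range_iff_exists_fun.mp h2
  have h3 : ∑ i, f i • (m i - u (s i)) = 0 := by
    simp only [smul_sub, Finset.sum_sub_distrib, ← hr, ← hs, map_sum, ← map_smul, smul_eq_mul,
      mul_comm, sub_self]
  obtain ⟨k, a, y, hy, ha⟩ := Module.Flat.isTrivialRelation_of_sum_smul_eq_zero h3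
  refine ⟨k, a, fun j => (LinearMap.range u).mkQ (y j), fun i => ?_, ha⟩
  have h4 : (LinearMap.range u).mkQ (u (s i)) = 0 := by simp
  rw [← hm i, ← sub_zero ((LinearMap.range u).mkQ (m i)), ← h4, ← map_sub, show m i - u (s i) = _ from hy i,
    map_sum]
  simp

variable {Q : Type} [AddCommGroup Q] [Module R Q]

theorem exists_ext_factorization [IsNoetherianRing R] [Module.Flat R Q] (i : ℕ) :
    ∀ (X : ModuleCat.{0} R) [Module.Finite R X] (e : Abelian.Ext X (ModuleCat.of R Q) i),
    ∃ (k : ℕ) (e' : Abelian.Ext X (ModuleCat.of R (Fin k → R)) i) (φ : (Fin k → R) →ₗ[R] Q),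
      e'.comp (Abelian.Ext.mk₀ (ModuleCat.ofHom φ)) (add_zero i) = e := by
  induction i with
  | zero =>
    intro X _ e
    obtain ⟨f, rfl⟩ := (Abelian.Ext.mk₀_bijective _ _).2 e
    have : Module.FinitePresentation R X := Module.finitePresentation_of_finite R X
    obtain ⟨k, h₂, h₃, h⟩ := Module.Flat.exists_factorization_of_finitePresentation f.hom
    let w := Finsupp.linearEquivFunOnFinite R R (Fin k)
    refine ⟨k, Abelian.Ext.mk₀ (ModuleCat.ofHom (w.toLinearMap ∘ₗ h₂)), h₃ ∘ₗ w.symm, ?_⟩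
    rw [Abelian.Ext.mk₀_comp_mk₀]
    congr 1
    refine ModuleCat.hom_ext ?_
    rw [h]
    ext x
    simp
  | succ i ih =>
    intro X _ e
    obtain ⟨n, g, hg⟩ := Module.Finite.exists_fin' R X
    have hS := shortExact_mk (LinearMap.ker g).subtype g Subtype.val_injective hg
      (LinearMap.exact_subtype_ker_map g)
    have hP : Projective (ModuleCat.of R (Fin n → R)) :=
      (IsProjective.iff_projective (Fin n → R)).mp inferInstance
    obtain ⟨e₁, rfl⟩ := Abelian.Ext.contravariant_sequence_exact₃ hS _ e
      (Abelian.Ext.eq_zero_of_projective _) (add_comm 1 i)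
    obtain ⟨k, e', φ, h⟩ := ih (ModuleCat.of R (LinearMap.ker g)) e₁
    refine ⟨k, hS.extClass.comp e' (add_comm 1 i), φ, ?_⟩
    rw [Abelian.Ext.comp_assoc _ _ _ (add_comm 1 i) (add_zero i) (by lia), h]

/-- `Ext (X, Q) = 0` when `Q` is flat, `I Q = Q` and `X` is finitely generated and killed by
`I`. -/
theorem subsingleton_ext_of_flat [IsNoetherianRing R] [Module.Flat R Q] (I : Ideal R)
    (hQ : I • (⊤ : Submodule R Q) = ⊤) (X : ModuleCat.{0} R) [Module.Finite R X]
    (hX : ∀ x : X, ∀ r ∈ I, r • x = 0) (i : ℕ) :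
    Subsingleton (Abelian.Ext X (ModuleCat.of R Q) i) := by
  refine subsingleton_of_forall_eq 0 fun e => ?_
  obtain ⟨k, e', φ, rfl⟩ := exists_ext_factorization i X e
  have key (r : R) (hr : r ∈ I) (ψ : (Fin k → R) →ₗ[R] Q) :
      e'.comp (Abelian.Ext.mk₀ (ModuleCat.ofHom (r • ψ))) (add_zero i) = 0 := by
    have h0 : r • 𝟙 X = 0 := by
      ext x
      exact hX x r hr
    have h1 : r • e' = 0 := by
      have : r • e' = (Abelian.Ext.mk₀ (r • 𝟙 X)).comp e' (zero_add i) := by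
        rw [Abelian.Ext.mk₀_smul, Abelian.Ext.smul_comp, Abelian.Ext.mk₀_id_comp]
      rw [this, h0, Abelian.Ext.mk₀_zero, Abelian.Ext.zero_comp]
    rw [show ModuleCat.ofHom (r • ψ) = r • ModuleCat.ofHom ψ from rfl, Abelian.Ext.mk₀_smul,
      Abelian.Ext.comp_smul, ← Abelian.Ext.smul_comp, h1, Abelian.Ext.zero_comp]
  have key' (j : Fin k) (q : Q) : e'.comp (Abelian.Ext.mk₀ (ModuleCat.ofHom
      ((LinearMap.proj j : (Fin k → R) →ₗ[R] R).smulRight q))) (add_zero i) = 0 := by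
    have hq : q ∈ I • (⊤ : Submodule R Q) := by rw [hQ]; trivial
    induction hq using Submodule.smul_induction_on' with
    | smul r hr q _ =>
      rw [show (LinearMap.proj j : (Fin k → R) →ₗ[R] R).smulRight (r • q) =
        r • (LinearMap.proj j : (Fin k → R) →ₗ[R] R).smulRight q by
          refine LinearMap.ext fun z => ?_
          simp [smul_comm r]]
      exact key r hr _
    | add x _ y _ hx hy =>
      rw [show (LinearMap.proj j : (Fin k → R) →ₗ[R] R).smulRight (x + y) =
        (LinearMap.proj j : (Fin k → R) →ₗ[R] R).smulRight x +
          (LinearMap.proj j : (Fin k → R) →ₗ[R] R).smulRight y by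
            refine LinearMap.ext fun z => ?_
            simp,
        ModuleCat.ofHom_add, Abelian.Ext.mk₀_add, Abelian.Ext.comp_add, hx, hy, add_zero]
  have hφ : φ = ∑ j, (LinearMap.proj j : (Fin k → R) →ₗ[R] R).smulRight
      (φ (Pi.single j 1)) := by
    refine LinearMap.pi_ext' fun j => LinearMap.ext_ring ?_
    simp [Pi.single_apply]
  have hsum (s : Finset (Fin k)) : e'.comp (Abelian.Ext.mk₀ (ModuleCat.ofHom (∑ j ∈ s,
      (LinearMap.proj j : (Fin k → R) →ₗ[R] R).smulRight (φ (Pi.single j 1))))) (add_zero i) =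
      0 := by
    induction s using Finset.induction_on with
    | empty => rw [Finset.sum_empty, ModuleCat.ofHom_zero, Abelian.Ext.mk₀_zero,
        Abelian.Ext.comp_zero]
    | insert j s hj ih => rw [Finset.sum_insert hj, ModuleCat.ofHom_add, Abelian.Ext.mk₀_add,
        Abelian.Ext.comp_add, key', ih, add_zero]
  rw [hφ]
  exact hsum _

theorem bijective_postcomp_of_pure [IsNoetherianRing R] [Module.Flat R M] (I : Ideal R)
    (u : R →ₗ[R] M) (hu : ∀ (J : Ideal R) (r : R), u r ∈ J • (⊤ : Submodule R M) → r ∈ J)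
    (hM : ∀ m, ∃ r, m - u r ∈ I • (⊤ : Submodule R M)) (X : ModuleCat.{0} R) [Module.Finite R X]
    (hX : ∀ x : X, ∀ r ∈ I, r • x = 0) (i : ℕ) :
    Function.Bijective fun e : Abelian.Ext X (ModuleCat.of R R) i =>
      e.comp (Abelian.Ext.mk₀ (ModuleCat.ofHom u)) (add_zero i) := by
  have hflat := flat_quotient_of_pure u hu
  have hQ : I • (⊤ : Submodule R (M ⧸ LinearMap.range u)) = ⊤ := by
    rw [eq_top_iff]
    rintro q -
    obtain ⟨m, rfl⟩ := (LinearMap.range u).mkQ_surjective q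
    obtain ⟨r, hr⟩ := hM m
    have h1 := Submodule.mem_map_of_mem (f := (LinearMap.range u).mkQ) hr
    rw [Submodule.map_smul'', map_sub, show (LinearMap.range u).mkQ (u r) = 0 by simp,
      sub_zero] at h1
    exact Submodule.smul_mono le_rfl le_top h1
  have hinj : Function.Injective u := by
    rw [injective_iff_map_eq_zero]
    intro r hr
    have := hu ⊥ r (by rw [hr]; exact zero_mem _)
    simpa using this
  have hS := shortExact_mk u (LinearMap.range u).mkQ hinj (Submodule.mkQ_surjective _)
    (by rw [LinearMap.exact_iff]; simp)
  have hsub := subsingleton_ext_of_flat I hQ X hX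
  refine ⟨?_, fun e => Abelian.Ext.covariant_sequence_exact₂ X hS e ((hsub i).elim _ _)⟩
  have : Function.Injective ((Abelian.Ext.mk₀ (ModuleCat.ofHom u)).postcomp X (add_zero i)) := by
    rw [injective_iff_map_eq_zero]
    intro e he
    cases i with
    | zero =>
      have := (ModuleCat.mono_iff_injective (ModuleCat.ofHom u)).mpr hinj
      exact Abelian.Ext.postcomp_mk₀_injective_of_mono X (ModuleCat.ofHom u)
        (he.trans (map_zero _).symm)
    | succ i =>
      obtain ⟨x, rfl⟩ := Abelian.Ext.covariant_sequence_exact₁ X hS e he rfl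
      rw [(hsub i).elim x 0, Abelian.Ext.zero_comp]
  exact this

end Pure

section Formal

variable (R A : Type) [CommRing R] [IsLocalRing R] [CommRing A] [IsLocalRing A] [Algebra R A]

/-- A flat extension of local rings with the same maximal ideal and the same residue field, such
as the completion. -/
class IsFormalExtension : Prop where
  flat : Module.Flat R A
  map_maximalIdeal : (maximalIdeal R).map (algebraMap R A) = maximalIdeal A
  exists_sub_mem (a : A) : ∃ r, a - algebraMap R A r ∈ maximalIdeal A

namespace IsFormalExtension

variable [IsFormalExtension R A]

instance : Module.Flat R A := IsFormalExtension.flat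

instance : IsLocalHom (algebraMap R A) := by
  have h : (maximalIdeal R).map (algebraMap R A) ≤ maximalIdeal A := (map_maximalIdeal).le
  exact ((IsLocalRing.local_hom_TFAE (algebraMap R A)).out 0 2).mpr h

instance : Module.FaithfullyFlat R A := Module.FaithfullyFlat.of_flat_of_isLocalHom

theorem map_pow (t : ℕ) :
    (maximalIdeal R ^ t).map (algebraMap R A) = maximalIdeal A ^ t := by
  rw [Ideal.map_pow, map_maximalIdeal]

theorem exists_sub_mem_pow (t : ℕ) (a : A) :
    ∃ r, a - algebraMap R A r ∈ maximalIdeal A ^ t := by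
  induction t with
  | zero => exact ⟨0, by simp⟩
  | succ t ih =>
    have key : ∀ b ∈ maximalIdeal A ^ t, ∃ s, b - algebraMap R A s ∈ maximalIdeal A ^ (t + 1) := by
      intro b hb
      rw [← map_pow R A, Ideal.map] at hb
      induction hb using Submodule.span_induction with
      | mem x hx =>
        obtain ⟨r, _, rfl⟩ := hx
        exact ⟨r, by simp⟩
      | zero => exact ⟨0, by simp⟩
      | add x y _ _ hx hy =>
        obtain ⟨s, hs⟩ := hx
        obtain ⟨s', hs'⟩ := hy
        exact ⟨s + s', by rw [map_add, add_sub_add_comm]; exact Ideal.add_mem _ hs hs'⟩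
      | smul c x hx' hx =>
        obtain ⟨s, hs⟩ := hx
        obtain ⟨c', hc'⟩ := exists_sub_mem (R := R) c
        have hx'' : x ∈ maximalIdeal A ^ t := by rw [← map_pow R A]; exact hx'
        refine ⟨c' * s, ?_⟩
        have : c • x - algebraMap R A (c' * s) =
            (c - algebraMap R A c') * x + algebraMap R A c' * (x - algebraMap R A s) := by
          rw [map_mul, smul_eq_mul]; ring
        rw [this]
        refine Ideal.add_mem _ ?_ (Ideal.mul_mem_left _ _ hs)
        rw [pow_succ']
        exact Ideal.mul_mem_mul hc' hx''
    obtain ⟨r, hr⟩ := ih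
    obtain ⟨s, hs⟩ := key _ hr
    exact ⟨r + s, by rw [map_add, ← sub_sub]; exact hs⟩

/-- The completed ring, as a module over the original one. -/
noncomputable def W : ModuleCat.{0} R := (resF R A).obj (ModuleCat.of A A)

omit [IsLocalRing R] [IsLocalRing A] [IsFormalExtension R A] in
/-- The two module structures agree. -/
def wEquiv : W R A ≃ₗ[R] A where
  toFun x := x
  invFun x := x
  map_add' _ _ := rfl
  map_smul' r x := (Algebra.smul_def r (show A from x)).symm
  left_inv _ := rfl
  right_inv _ := rfl

omit [IsLocalRing R] [IsLocalRing A] [IsFormalExtension R A] in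
theorem mem_smul_top_iff (J : Ideal R) (x : W R A) :
    x ∈ J • (⊤ : Submodule R (W R A)) ↔ wEquiv R A x ∈ J.map (algebraMap R A) := by
  have h : (J • (⊤ : Submodule R (W R A))).map (wEquiv R A).toLinearMap =
      (J.map (algebraMap R A)).restrictScalars R := by
    rw [Submodule.map_smul'', Submodule.map_top, LinearEquiv.range, Ideal.smul_top_eq_map]
  rw [← Submodule.restrictScalars_mem R (J.map (algebraMap R A)), ← h]
  refine ⟨fun hx => Submodule.mem_map_of_mem hx, fun hx => ?_⟩
  obtain ⟨y, hy, hxy⟩ := hx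
  rwa [← (wEquiv R A).injective hxy]

/-- The structure map. -/
noncomputable def unit : R →ₗ[R] W R A := LinearMap.toSpanSingleton R (W R A) (1 : A)

/-- The structure map, as a morphism. -/
noncomputable def unitHom : ModuleCat.of R R ⟶ W R A :=
  ModuleCat.ofHom (Y := W R A) (unit R A)

theorem bijective_unit [IsNoetherianRing R] (t : ℕ) (i : ℕ) :
    Function.Bijective fun e : Abelian.Ext (Qt R t) (ModuleCat.of R R) i =>
      e.comp (Abelian.Ext.mk₀ (unitHom R A)) (add_zero i) := by
  have : Module.Flat R (W R A) := Module.Flat.of_linearEquiv (wEquiv R A)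
  have hu (r : R) : wEquiv R A (unit R A r) = algebraMap R A r := mul_one (algebraMap R A r)
  refine bijective_postcomp_of_pure (maximalIdeal R ^ t) (unit R A) (fun J r h => ?_)
    (fun m => ?_) (Qt R t) (fun x r hr => ?_) i
  · rw [mem_smul_top_iff, hu] at h
    rwa [← Ideal.comap_map_eq_self_of_faithfullyFlat (B := A) J]
  · obtain ⟨r, hr⟩ := exists_sub_mem_pow R A t (wEquiv R A m)
    refine ⟨r, ?_⟩
    rw [mem_smul_top_iff, map_pow, map_sub, hu]
    exact hr
  · obtain ⟨y, rfl⟩ := Submodule.Quotient.mk_surjective _ x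
    rw [← Submodule.Quotient.mk_smul, Submodule.Quotient.mk_eq_zero, smul_eq_mul]
    exact Ideal.mul_mem_right _ _ hr

/-- The comparison of the quotients. -/
noncomputable def quot (t : ℕ) : Qt R t ⟶ (resF R A).obj (Qt A t) :=
  ModuleCat.ofHom (X := (R ⧸ maximalIdeal R ^ t)) (Y := (resF R A).obj (Qt A t))
    ((maximalIdeal R ^ t).liftQ
      (LinearMap.toSpanSingleton R ((resF R A).obj (Qt A t)) (Ideal.Quotient.mk _ (1 : A)))
      fun r hr => by
        change Ideal.Quotient.mk (maximalIdeal A ^ t) (algebraMap R A r * 1) = 0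
        rw [mul_one, Ideal.Quotient.eq_zero_iff_mem, ← map_pow R A]
        exact Ideal.mem_map_of_mem _ hr)

theorem quot_mk (t : ℕ) (r : R) : (quot R A t).hom (Ideal.Quotient.mk _ r) =
    Ideal.Quotient.mk (maximalIdeal A ^ t) (algebraMap R A r) :=
  congrArg (Ideal.Quotient.mk (maximalIdeal A ^ t)) (mul_one _)

instance isIso_quot (t : ℕ) : IsIso (quot R A t) := by
  have hb : Function.Bijective (quot R A t).hom := by
    constructor
    · rw [injective_iff_map_eq_zero]
      intro x hx
      obtain ⟨r, rfl⟩ := Ideal.Quotient.mk_surjective x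
      have h := (quot_mk R A t r).symm.trans hx
      have h' := Ideal.Quotient.eq_zero_iff_mem.mp h
      rw [← map_pow R A] at h'
      rw [Ideal.Quotient.eq_zero_iff_mem,
        ← Ideal.comap_map_eq_self_of_faithfullyFlat (B := A) (maximalIdeal R ^ t)]
      exact h'
    · intro y
      obtain ⟨a, rfl⟩ := Ideal.Quotient.mk_surjective (I := maximalIdeal A ^ t) y
      obtain ⟨r, hr⟩ := exists_sub_mem_pow R A t a
      refine ⟨Ideal.Quotient.mk _ r, (quot_mk R A t r).trans ?_⟩
      exact (Ideal.Quotient.eq.mpr hr).symm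
  exact (ConcreteCategory.isIso_iff_bijective _).mpr hb

theorem quot_naturality (s t : ℕ) (h : s ≤ t) :
    quot R A t ≫ (resF R A).map (Qπ A s t h) = Qπ R s t h ≫ quot R A s := by
  refine ModuleCat.hom_ext (LinearMap.ext fun x => ?_)
  obtain ⟨r, rfl⟩ := Ideal.Quotient.mk_surjective x
  exact (congrArg (Qπ A s t h).hom (quot_mk R A t r)).trans (quot_mk R A s r).symm

/-- The comparison of the `Ext` groups over the two rings. -/
noncomputable def comparison (t : ℕ) (Y : ModuleCat.{0} A) (i : ℕ) :
    Abelian.Ext (Qt A t) Y i →+ Abelian.Ext (Qt R t) ((resF R A).obj Y) i :=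
  ((Abelian.Ext.mk₀ (quot R A t)).precomp _ (zero_add i)).comp
    ((resF R A).mapExtAddHom (Qt A t) Y i)

theorem comparison_apply (t : ℕ) (Y : ModuleCat.{0} A) (i : ℕ) (e : Abelian.Ext (Qt A t) Y i) :
    comparison R A t Y i e = (Abelian.Ext.mk₀ (quot R A t)).comp
      ((resF R A).mapExtAddHom (Qt A t) Y i e) (zero_add i) := rfl

theorem bijective_comparison (t : ℕ) (Y : ModuleCat.{0} A) (i : ℕ) :
    Function.Bijective (comparison R A t Y i) := by
  have h1 := bijective_mapExt_resF (maximalIdeal R ^ t)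
    (by rw [map_pow R A]; exact exists_sub_mem_pow R A t) (Qt A t) Y (fun x r hr => by
      obtain ⟨y, rfl⟩ := Submodule.Quotient.mk_surjective _ x
      rw [← Submodule.Quotient.mk_smul, Submodule.Quotient.mk_eq_zero, smul_eq_mul,
        ← map_pow R A]
      exact Ideal.mul_mem_right _ _ (Ideal.mem_map_of_mem _ hr)) i
  refine Function.Bijective.comp (g := fun e =>
    (Abelian.Ext.mk₀ (quot R A t)).comp e (zero_add i)) ⟨fun e e' he => ?_, fun e => ?_⟩ h1
  · have := congrArg (fun x => (Abelian.Ext.mk₀ (inv (quot R A t))).comp x (zero_add i)) he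
    simpa using this
  · exact ⟨(Abelian.Ext.mk₀ (inv (quot R A t))).comp e (zero_add i), by simp⟩

theorem comparison_naturality (s t : ℕ) (h : s ≤ t) (Y : ModuleCat.{0} A) (i : ℕ)
    (e : Abelian.Ext (Qt A s) Y i) :
    comparison R A t Y i ((Abelian.Ext.mk₀ (Qπ A s t h)).comp e (zero_add i)) =
      (Abelian.Ext.mk₀ (Qπ R s t h)).comp (comparison R A s Y i e) (zero_add i) := by
  rw [comparison_apply, comparison_apply, Functor.mapExtAddHom_apply, Functor.mapExtAddHom_apply,
    Abelian.Ext.mapExactFunctor_comp, Abelian.Ext.mapExactFunctor_mk₀,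
    Abelian.Ext.mk₀_comp_mk₀_assoc, Abelian.Ext.mk₀_comp_mk₀_assoc, quot_naturality]

theorem comparison_smul (t : ℕ) (Y : ModuleCat.{0} A) (i : ℕ) (r : R)
    (e : Abelian.Ext (Qt A t) Y i) :
    comparison R A t Y i (algebraMap R A r • e) = r • comparison R A t Y i e := by
  rw [comparison_apply, comparison_apply, mapExt_resF_smul, Abelian.Ext.comp_smul]

end IsFormalExtension

end Formal

section LocalCohomology

open Limits Opposite IsFormalExtension

variable (R A : Type) [CommRing R] [IsLocalRing R] [IsNoetherianRing R] [CommRing A]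
  [IsLocalRing A] [Algebra R A] [IsFormalExtension R A] (d : ℕ)

/-- The diagram defining local cohomology. -/
noncomputable abbrev lcDiagram : (ℕᵒᵖ)ᵒᵖ ⥤ ModuleCat.{0} R :=
  localCohomology.diagram (localCohomology.idealPowersDiagram (maximalIdeal R)) d ⋙
    (evaluation _ _).obj (ModuleCat.of R R)

/-- The cocone defining local cohomology. -/
noncomputable abbrev lcCocone : Cocone (lcDiagram R d) :=
  ((evaluation _ _).obj (ModuleCat.of R R)).mapCocone (colimit.cocone
    (localCohomology.diagram (localCohomology.idealPowersDiagram (maximalIdeal R)) d))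

/-- The cocone defining local cohomology is a colimit. -/
noncomputable def isColimitLcCocone : IsColimit (lcCocone R d) :=
  isColimitOfPreserves ((evaluation _ _).obj (ModuleCat.of R R)) (colimit.isColimit _)

theorem exists_level_equiv (t : ℕ) :
    ∃ γ : (((Ext R (ModuleCat.{0} R) d).obj (op (Qt R t))).obj (ModuleCat.of R R) : Type) ≃
      Abelian.Ext (Qt A t) (ModuleCat.of A A) d,
      ∀ x, comparison R A t (ModuleCat.of A A) d (γ x) =
        (extEquiv (ModuleCat.of R R) d x).comp (Abelian.Ext.mk₀ (unitHom R A)) (add_zero d) := by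
  let c := Equiv.ofBijective _ (bijective_comparison R A t (ModuleCat.of A A) d)
  let u := Equiv.ofBijective _ (bijective_unit R A t d)
  let e := (extEquiv (X := Qt R t) (ModuleCat.of R R) d).toEquiv
  exact ⟨(e.trans u).trans c.symm, fun x => c.apply_symm_apply _⟩

/-- The comparison of the terms of the two direct systems. -/
noncomputable def levelEquiv (t : ℕ) :
    (((Ext R (ModuleCat.{0} R) d).obj (op (Qt R t))).obj (ModuleCat.of R R) : Type) ≃
      Abelian.Ext (Qt A t) (ModuleCat.of A A) d := (exists_level_equiv R A d t).choose

theorem comparison_levelEquiv (t : ℕ) (x) :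
    comparison R A t (ModuleCat.of A A) d (levelEquiv R A d t x) =
      (extEquiv (ModuleCat.of R R) d x).comp (Abelian.Ext.mk₀ (unitHom R A)) (add_zero d) :=
  (exists_level_equiv R A d t).choose_spec x

theorem levelEquiv_add (t : ℕ) (x y) : levelEquiv R A d t (x + y) =
    levelEquiv R A d t x + levelEquiv R A d t y := by
  apply (bijective_comparison R A t (ModuleCat.of A A) d).1
  refine Eq.trans ?_ (map_add (comparison R A t (ModuleCat.of A A) d) _ _).symm
  rw [comparison_levelEquiv, comparison_levelEquiv, comparison_levelEquiv,
    (extEquiv (ModuleCat.of R R) d).map_add x y, Abelian.Ext.add_comp]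
  rfl

theorem levelEquiv_smul (t : ℕ) (r : R) (x) : levelEquiv R A d t (r • x) =
    algebraMap R A r • levelEquiv R A d t x := by
  apply (bijective_comparison R A t (ModuleCat.of A A) d).1
  rw [comparison_smul, comparison_levelEquiv, comparison_levelEquiv, map_smul,
    Abelian.Ext.smul_comp]
  rfl

theorem levelEquiv_naturality (s t : ℕ) (h : s ≤ t) (x) :
    levelEquiv R A d t ((((Ext R (ModuleCat.{0} R) d).map (Qπ R s t h).op).app
      (ModuleCat.of R R)).hom x) =
      (Abelian.Ext.mk₀ (Qπ A s t h)).comp (levelEquiv R A d s x) (zero_add d) := by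
  apply (bijective_comparison R A t (ModuleCat.of A A) d).1
  rw [comparison_naturality, comparison_levelEquiv, comparison_levelEquiv, extEquiv_naturality,
    Abelian.Ext.comp_assoc _ _ _ (zero_add d) (add_zero d) (by lia)]
  rfl

/-- The local cohomology of the completion, over the original ring. -/
noncomputable def hmRes : ModuleCat.{0} R := (resF R A).obj (ModuleCat.of A (Hm A d A))

/-- The terms of the comparison cocone. -/
noncomputable def leg (t : ℕ) :
    (((Ext R (ModuleCat.{0} R) d).obj (op (Qt R t))).obj (ModuleCat.of R R) : Type) →ₗ[R]
      hmRes R A d where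
  toFun x := LH.of t (levelEquiv R A d t x)
  map_add' x y := (congrArg (LH.of t) (levelEquiv_add R A d t x y)).trans (map_add _ _ _)
  map_smul' r x := (congrArg (LH.of t) (levelEquiv_smul R A d t r x)).trans
    (LinearMap.map_smul _ _ _)

theorem leg_naturality (s t : ℕ) (h : s ≤ t) (x) :
    leg R A d t ((((Ext R (ModuleCat.{0} R) d).map (Qπ R s t h).op).app
      (ModuleCat.of R R)).hom x) = leg R A d s x :=
  (congrArg (LH.of t) (levelEquiv_naturality R A d s t h x)).trans (LH.of_comp h _)

/-- The comparison cocone. -/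
noncomputable def hmCocone : Cocone (lcDiagram R d) where
  pt := hmRes R A d
  ι :=
    { app := fun t => ModuleCat.ofHom (X := (lcDiagram R d).obj t) (Y := hmRes R A d)
        (leg R A d t.unop.unop)
      naturality := fun s t f => by
        refine ModuleCat.hom_ext (LinearMap.ext fun x => ?_)
        exact leg_naturality R A d s.unop.unop t.unop.unop f.unop.unop.le x }

theorem exists_lc_equiv :
    Nonempty (((localCohomology (maximalIdeal R) d).obj (ModuleCat.of R R) : Type) ≃ₗ[R]
      hmRes R A d) := by
  let F : (lcCocone R d).pt ⟶ hmRes R A d := (isColimitLcCocone R d).desc (hmCocone R A d)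
  have hF (t : (ℕᵒᵖ)ᵒᵖ) (x : (lcDiagram R d).obj t) :
      F.hom (((lcCocone R d).ι.app t).hom x) = leg R A d t.unop.unop x :=
    congrArg (fun f => f.hom x) ((isColimitLcCocone R d).fac (hmCocone R A d) t)
  have hinj : Function.Injective F.hom := by
    rw [injective_iff_map_eq_zero]
    intro z hz
    obtain ⟨t, x, rfl⟩ := Concrete.isColimit_exists_rep (lcDiagram R d) (isColimitLcCocone R d) z
    have h0 : LH.of t.unop.unop (levelEquiv R A d t.unop.unop x) = 0 := (hF t x).symm.trans hz
    obtain ⟨u, h, hu⟩ := LH.exists_comp_eq_zero _ h0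
    have h1 := (levelEquiv_naturality R A d t.unop.unop u h x).trans hu
    have h2 : levelEquiv R A d u 0 = 0 := by
      have := levelEquiv_smul R A d u 0 0
      rwa [zero_smul, (algebraMap R A).map_zero, zero_smul] at this
    have h3 := (levelEquiv R A d u).injective (h1.trans h2.symm)
    let f : t ⟶ op (op u) := (homOfLE h).op.op
    have h4 := congrArg (fun f => f.hom x) ((lcCocone R d).w f)
    refine h4.symm.trans ?_
    have h5 : ((lcDiagram R d).map f).hom x = 0 := h3
    exact (congrArg ((lcCocone R d).ι.app (op (op u))).hom h5).trans (map_zero _)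
  have hsurj : Function.Surjective F.hom := fun y => by
    obtain ⟨t, x, rfl⟩ := LH.exists_of (A := A) (M := ModuleCat.of A A) (i := d) y
    refine ⟨((lcCocone R d).ι.app (op (op t))).hom ((levelEquiv R A d t).symm x), ?_⟩
    refine (hF _ _).trans ?_
    exact congrArg (LH.of t) ((levelEquiv R A d t).apply_symm_apply x)
  exact ⟨LinearEquiv.ofBijective F.hom ⟨hinj, hsurj⟩⟩

end LocalCohomology

section Transfer

instance isFormalExtension_adicCompletion (R : Type) [CommRing R] [IsNoetherianRing R]
    [IsLocalRing R] : IsFormalExtension R (AdicCompletion (maximalIdeal R) R) where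
  flat := AdicCompletion.flat_of_isNoetherian _
  map_maximalIdeal := (AdicCompletion.maximalIdeal_eq_map).symm
  exists_sub_mem a := by
    obtain ⟨z, hz⟩ := (AdicCompletion.residueField_map_bijective (R := R)).2 (residue _ a)
    obtain ⟨r, rfl⟩ := Ideal.Quotient.mk_surjective z
    exact ⟨r, Ideal.Quotient.eq.mp hz.symm⟩

theorem InjDimLE.of_linearEquiv {S : Type} [CommRing S] {n : ℕ} {M N : ModuleCat.{0} S}
    (e : M ≃ₗ[S] N) (h : InjDimLE S n M) : InjDimLE S n N := by
  cases n with
  | zero =>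
    have : Module.Injective S M := h
    exact injective_congr e.symm
  | succ n =>
    obtain ⟨E, f, hf, hE, hC⟩ := h
    refine ⟨E, f ∘ₗ e.symm.toLinearMap, hf.comp e.symm.injective, hE, ?_⟩
    rwa [LinearMap.range_comp_of_range_eq_top f (LinearEquiv.range e.symm)]

theorem InjDimLE.subsingleton_ext {S : Type} [CommRing S] (X : ModuleCat.{0} S) {n : ℕ}
    {M : ModuleCat.{0} S} (h : InjDimLE S n M) (j : ℕ) (hj : n < j) :
    Subsingleton (Abelian.Ext X M j) := by
  induction n generalizing M j with
  | zero =>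
    have : Module.Injective S M := h
    have : Injective M := Module.injective_object_of_injective_module S M
    obtain ⟨j, rfl⟩ := Nat.exists_eq_succ_of_ne_zero hj.ne'
    exact Abelian.Ext.subsingleton_of_injective (X := X) (I := M) j
  | succ n ih =>
    obtain ⟨E, f, hf, hE, hC⟩ := h
    obtain ⟨j, rfl⟩ := Nat.exists_eq_succ_of_ne_zero (Nat.ne_zero_of_lt hj)
    have h1 := ih hC j (by lia)
    have : Injective E := Module.injective_object_of_injective_module S E
    have h2 := Abelian.Ext.subsingleton_of_injective (X := X) (I := E) j
    have hS := shortExact_mk f (LinearMap.range f).mkQ hf (Submodule.mkQ_surjective _)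
      (LinearMap.exact_map_mkQ_range f)
    refine subsingleton_of_forall_eq 0 fun x => ?_
    obtain ⟨y, rfl⟩ := Abelian.Ext.covariant_sequence_exact₁ X hS x (h2.elim _ _) rfl
    rw [h1.elim y 0, Abelian.Ext.zero_comp]

variable {R A : Type} [CommRing R] [IsLocalRing R] [CommRing A]
  [IsLocalRing A] [Algebra R A] [IsFormalExtension R A]

theorem subsingleton_ext_of_restrict (Y : ModuleCat.{0} A) (j : ℕ)
    (h : Subsingleton (Abelian.Ext ((resF R A).obj (ModuleCat.of A (A ⧸ maximalIdeal A)))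
      ((resF R A).obj Y) j)) :
    Subsingleton (Abelian.Ext (ModuleCat.of A (A ⧸ maximalIdeal A)) Y j) := by
  have := bijective_mapExt_resF (maximalIdeal R)
    (by rw [IsFormalExtension.map_maximalIdeal]; exact IsFormalExtension.exists_sub_mem)
    (ModuleCat.of A (A ⧸ maximalIdeal A)) Y (fun x r hr => by
      obtain ⟨y, rfl⟩ := Submodule.Quotient.mk_surjective _ x
      rw [← Submodule.Quotient.mk_smul, Submodule.Quotient.mk_eq_zero, smul_eq_mul,
        ← IsFormalExtension.map_maximalIdeal (R := R)]
      exact Ideal.mul_mem_right _ _ (Ideal.mem_map_of_mem _ hr)) j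
  exact this.1.subsingleton

theorem IsMatlis.isInjHull_restrict (E : ModuleCat.{0} A) (hE : IsMatlis A E) :
    IsInjHull R (maximalIdeal R) ((resF R A).obj E) := by
  have hm (r : R) (hr : r ∈ maximalIdeal R) : algebraMap R A r ∈ maximalIdeal A := by
    rw [← IsFormalExtension.map_maximalIdeal (R := R)]
    exact Ideal.mem_map_of_mem _ hr
  have : Module.Injective A E := hE.inj
  have : Injective E := Module.injective_object_of_injective_module A E
  have : Injective ((resF R A).obj E) := injective_resF E
  refine ⟨Module.injective_module_of_injective_object R ((resF R A).obj E), ?_⟩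
  obtain ⟨u, hu0, hu, hsoc⟩ := hE.soc
  let g : R →ₗ[R] (resF R A).obj E := LinearMap.toSpanSingleton R ((resF R A).obj E) u
  have hg (r : R) : g r = (algebraMap R A r • u : E) := rfl
  have hker : maximalIdeal R ≤ LinearMap.ker g := fun r hr => hu _ (hm r hr)
  have hker' : LinearMap.ker g ≤ maximalIdeal R := fun r hr => by
    refine (mem_maximalIdeal r).mpr fun hunit => hu0 ?_
    exact ((hunit.map (algebraMap R A)).smul_eq_zero).mp hr
  refine ⟨(maximalIdeal R).liftQ g hker, ?_, fun N hN => ?_⟩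
  · rw [← LinearMap.ker_eq_bot]
    exact Submodule.ker_liftQ_eq_bot _ _ _ hker'
  · obtain ⟨x, hxN, hx⟩ := N.ne_bot_iff.mp hN
    have htor : IsTor R ((resF R A).obj E) := fun y => by
      obtain ⟨t, ht⟩ := hE.tor y
      refine ⟨t, fun r hr => ht (algebraMap R A r) ?_⟩
      rw [← IsFormalExtension.map_pow R A]
      exact Ideal.mem_map_of_mem _ hr
    obtain ⟨c, hc0, hc⟩ := exists_socle htor x hx
    have hc' : ∀ a ∈ maximalIdeal A, a • (c • x : E) = 0 := fun a ha => by
      have h : (maximalIdeal R).map (algebraMap R A) ≤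
          LinearMap.ker (LinearMap.toSpanSingleton A E (c • x)) :=
        Ideal.map_le_iff_le_comap.mpr fun r hr => hc r hr
      rw [IsFormalExtension.map_maximalIdeal] at h
      exact h ha
    obtain ⟨a, ha⟩ := hsoc _ hc'
    obtain ⟨r, hr⟩ := IsFormalExtension.exists_sub_mem (R := R) a
    have har : a • u = algebraMap R A r • u := by
      rw [← sub_eq_zero, ← sub_smul]; exact hu _ hr
    refine (Submodule.ne_bot_iff _).mpr ⟨c • x, ⟨N.smul_mem c hxN, ?_⟩, hc0⟩
    exact ⟨Submodule.Quotient.mk r, (ha.trans har).symm⟩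

end Transfer

end QuasiGorenstein

theorem stmt12 (R : Type) [CommRing R] [IsNoetherianRing R] [IsLocalRing R]
    (d : ℕ) (hd : ringKrullDim R = (d : WithBot ℕ∞)) :
    (∃ n : ℕ, InjDimLE R n (LC R (maximalIdeal R) d (ModuleCat.of R R))) ↔
      IsQuasiGorensteinAt R (maximalIdeal R) := by
  constructor
  · rintro ⟨n, hn⟩
    let A := AdicCompletion (maximalIdeal R) R
    obtain ⟨φ⟩ := QuasiGorenstein.exists_lc_equiv R A d
    have h := QuasiGorenstein.InjDimLE.of_linearEquiv φ hn
    obtain ⟨E, _, _, hE⟩ := QuasiGorenstein.exists_isMatlis A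
    obtain ⟨ψ⟩ := hE.nonempty_hm_equiv ((QuasiGorenstein.ringKrullDim_adicCompletion R).trans hd) n
      fun j hj => QuasiGorenstein.subsingleton_ext_of_restrict (R := R) _ j
        (QuasiGorenstein.InjDimLE.subsingleton_ext _ h j hj)
    let ψ' := ((QuasiGorenstein.resF R A).mapIso ψ.toModuleIso).toLinearEquiv
    exact ⟨d, hd, (QuasiGorenstein.resF R A).obj (ModuleCat.of A E),
      QuasiGorenstein.IsMatlis.isInjHull_restrict _ hE, ⟨φ.trans ψ'⟩⟩
  · rintro ⟨d', hd', E, hE, ⟨e⟩⟩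
    obtain rfl : d = d' := by exact_mod_cast hd.symm.trans hd'
    have : Module.Injective R E := hE.1
    exact ⟨0, QuasiGorenstein.injective_congr e⟩
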